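/- arXiv:2209.04510 — 11 statements merged into one kernel-verified Lean document; each statement's English description precedes it below -/
import Mathlib

section
/- For every τ > 0 and every x ∈ ℝ with x ≠ 0, the marginal horseshoe density admits the Laplace (double-exponential) mixture representation p_HS(x) = (2/(π√π τ)) ∫₀^∞ exp(−u|x|/τ) · D₊(u/√2) du, where D₊ is the Dawson function. -/
open MeasureTheory Real Set

/-- The Dawson function `D₊(z) = exp(-z²) ∫₀^z exp(t²) dt`. -/
noncomputable def dawson (z : ℝ) : ℝ := Real.exp (-z ^ 2) * ∫ t in (0:ℝ)..z, Real.exp (t ^ 2)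

/-- The marginal horseshoe density with global scale `τ`. -/
noncomputable def pHS (τ x : ℝ) : ℝ :=
  ∫ l in Set.Ioi (0:ℝ),
    (Real.sqrt (2 * Real.pi))⁻¹ * (l * τ)⁻¹ * Real.exp (-x ^ 2 / (2 * l ^ 2 * τ ^ 2)) *
      ((2 / Real.pi) * (1 + l ^ 2)⁻¹)

open Filter Topology

lemma integrable_gaussian_Ioi : IntegrableOn (fun s : ℝ => exp (-s ^ 2)) (Ioi 0) := by
  simpa using (integrable_exp_neg_mul_sq (b := 1) one_pos).integrableOn (s := Ioi 0)

lemma integrable_mul_gaussian_Ioi :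
    IntegrableOn (fun s : ℝ => 2 * s * exp (-s ^ 2)) (Ioi 0) := by
  have h := ((integrable_mul_exp_neg_mul_sq (b := 1) one_pos).const_mul 2).integrableOn
    (s := Ioi (0 : ℝ))
  simpa [mul_assoc] using h

lemma integrable_gaussian_mul_sin (z : ℝ) :
    IntegrableOn (fun s : ℝ => exp (-s ^ 2) * sin (2 * z * s)) (Ioi 0) := by
  refine integrable_gaussian_Ioi.mono' (by fun_prop) (ae_of_all _ fun s => ?_)
  rw [norm_mul, norm_eq_abs, norm_eq_abs, abs_exp]
  exact mul_le_of_le_one_right (exp_pos _).le (abs_sin_le_one _)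

lemma integrable_mul_gaussian_mul_cos (z : ℝ) :
    IntegrableOn (fun s : ℝ => 2 * s * exp (-s ^ 2) * cos (2 * z * s)) (Ioi 0) := by
  refine integrable_mul_gaussian_Ioi.norm.mono' (by fun_prop) (ae_of_all _ fun s => ?_)
  rw [norm_mul _ (cos _)]
  exact mul_le_of_le_one_right (norm_nonneg _) (abs_cos_le_one _)

/-- Integration by parts for the cosine moment of the Gaussian on the half line. -/
lemma integral_mul_gaussian_mul_cos (z : ℝ) :
    ∫ s in Ioi (0 : ℝ), 2 * s * exp (-s ^ 2) * cos (2 * z * s) =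
      1 - 2 * z * ∫ s in Ioi (0 : ℝ), exp (-s ^ 2) * sin (2 * z * s) := by
  have hderiv : ∀ s ∈ Ici (0 : ℝ), HasDerivAt (fun s : ℝ => -(exp (-s ^ 2) * cos (2 * z * s)))
      (2 * s * exp (-s ^ 2) * cos (2 * z * s) + 2 * z * (exp (-s ^ 2) * sin (2 * z * s))) s := by
    intro s _
    have h1 : HasDerivAt (fun s : ℝ => exp (-s ^ 2)) (exp (-s ^ 2) * (-(2 * s))) s := by
      simpa using ((hasDerivAt_pow 2 s).neg).exp
    have h2 : HasDerivAt (fun s : ℝ => cos (2 * z * s)) (-sin (2 * z * s) * (2 * z)) s := by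
      simpa using ((hasDerivAt_id s).const_mul (2 * z)).cos
    exact (h1.mul h2).neg.congr_deriv (by ring)
  have hlim : Tendsto (fun s : ℝ => -(exp (-s ^ 2) * cos (2 * z * s))) atTop (𝓝 0) := by
    have hg : Tendsto (fun s : ℝ => exp (-s ^ 2)) atTop (𝓝 0) :=
      tendsto_exp_atBot.comp (tendsto_neg_atTop_atBot.comp (tendsto_pow_atTop two_ne_zero))
    refine squeeze_zero_norm (fun s => ?_) hg
    rw [norm_neg, norm_mul, norm_eq_abs, norm_eq_abs, abs_exp]
    exact mul_le_of_le_one_right (exp_pos _).le (abs_cos_le_one _)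
  have hsin := (integrable_gaussian_mul_sin z).const_mul (2 * z)
  have h := integral_Ioi_of_hasDerivAt_of_tendsto' hderiv
    ((integrable_mul_gaussian_mul_cos z).add hsin) hlim
  rw [integral_add (integrable_mul_gaussian_mul_cos z) hsin, integral_const_mul] at h
  simp only [ne_eq, OfNat.ofNat_ne_zero, not_false_eq_true, zero_pow, neg_zero, exp_zero,
    mul_zero, cos_zero, mul_one, sub_neg_eq_add, zero_add] at h
  linarith

/-- Sine-transform representation of the Dawson function. -/
lemma dawson_eq_integral_sin (z : ℝ) :
    dawson z = ∫ s in Ioi (0 : ℝ), exp (-s ^ 2) * sin (2 * z * s) := by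
  set F : ℝ → ℝ := fun z => ∫ s in Ioi (0 : ℝ), exp (-s ^ 2) * sin (2 * z * s) with hF
  have hFderiv : ∀ z, HasDerivAt F (1 - 2 * z * F z) z := by
    intro z
    rw [hF, ← integral_mul_gaussian_mul_cos z]
    refine (hasDerivAt_integral_of_dominated_loc_of_deriv_le
      (F := fun z s : ℝ => exp (-s ^ 2) * sin (2 * z * s))
      (F' := fun z s : ℝ => 2 * s * exp (-s ^ 2) * cos (2 * z * s))
      (bound := fun s => ‖2 * s * exp (-s ^ 2)‖) univ_mem
      (Eventually.of_forall fun z => (integrable_gaussian_mul_sin z).aestronglyMeasurable)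
      (integrable_gaussian_mul_sin z) (integrable_mul_gaussian_mul_cos z).aestronglyMeasurable
      (ae_of_all _ fun s y _ => ?_) integrable_mul_gaussian_Ioi.norm
      (ae_of_all _ fun s y _ => ?_)).2
    · rw [norm_mul _ (cos _)]
      exact mul_le_of_le_one_right (norm_nonneg _) (abs_cos_le_one _)
    · have h := ((((hasDerivAt_id y).const_mul 2).mul_const s).sin).const_mul (exp (-s ^ 2))
      exact h.congr_deriv (by simp only [id_eq]; ring)
  have hderiv : ∀ t ∈ uIcc 0 z, HasDerivAt (fun t => exp (t ^ 2) * F t) (exp (t ^ 2)) t := by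
    intro t _
    have h1 : HasDerivAt (fun s : ℝ => exp (s ^ 2)) (exp (t ^ 2) * (2 * t)) t := by
      simpa using (hasDerivAt_pow 2 t).exp
    exact (h1.mul (hFderiv t)).congr_deriv (by ring)
  have hF0 : F 0 = 0 := by simp [hF]
  have h := intervalIntegral.integral_eq_sub_of_hasDerivAt hderiv
    (Continuous.intervalIntegrable (by fun_prop) _ _)
  rw [dawson, h, hF0, mul_zero, sub_zero, ← mul_assoc, ← exp_add]
  simp [hF]

/-- Laplace transform of the sine. -/
lemma integral_exp_mul_sin {a : ℝ} (ha : 0 < a) (b : ℝ) :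
    ∫ u in Ioi (0 : ℝ), exp (-a * u) * sin (b * u) = b / (a ^ 2 + b ^ 2) := by
  have hab : a ^ 2 + b ^ 2 ≠ 0 := by positivity
  have hderiv : ∀ u ∈ Ici (0 : ℝ), HasDerivAt
      (fun u : ℝ => exp (-a * u) * (-(a * sin (b * u) + b * cos (b * u)) / (a ^ 2 + b ^ 2)))
      (exp (-a * u) * sin (b * u)) u := by
    intro u _
    have h1 : HasDerivAt (fun u : ℝ => exp (-a * u)) (exp (-a * u) * (-a)) u := by
      simpa using ((hasDerivAt_id u).const_mul (-a)).exp
    have h2 : HasDerivAt (fun u : ℝ => sin (b * u)) (cos (b * u) * b) u := by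
      simpa using ((hasDerivAt_id u).const_mul b).sin
    have h3 : HasDerivAt (fun u : ℝ => cos (b * u)) (-sin (b * u) * b) u := by
      simpa using ((hasDerivAt_id u).const_mul b).cos
    refine (h1.mul (((h2.const_mul a).add (h3.const_mul b)).neg.div_const
      (a ^ 2 + b ^ 2))).congr_deriv ?_
    simp only [Pi.add_apply, Pi.neg_apply]
    field_simp
    ring
  have hexp : Tendsto (fun u : ℝ => exp (-a * u)) atTop (𝓝 0) :=
    tendsto_exp_atBot.comp (tendsto_id.const_mul_atTop_of_neg (neg_lt_zero.2 ha))
  have hlim : Tendsto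
      (fun u : ℝ => exp (-a * u) * (-(a * sin (b * u) + b * cos (b * u)) / (a ^ 2 + b ^ 2)))
      atTop (𝓝 0) := by
    refine hexp.zero_mul_isBoundedUnder_le
      (isBoundedUnder_of ⟨(|a| + |b|) / (a ^ 2 + b ^ 2), fun u => ?_⟩)
    simp only [Function.comp_apply, norm_eq_abs, abs_div, abs_neg]
    rw [abs_of_nonneg (by positivity : 0 ≤ a ^ 2 + b ^ 2)]
    gcongr
    refine (abs_add_le _ _).trans ?_
    rw [abs_mul, abs_mul]
    gcongr
    · exact mul_le_of_le_one_right (abs_nonneg _) (abs_sin_le_one _)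
    · exact mul_le_of_le_one_right (abs_nonneg _) (abs_cos_le_one _)
  have hint : IntegrableOn (fun u : ℝ => exp (-a * u) * sin (b * u)) (Ioi 0) := by
    refine (exp_neg_integrableOn_Ioi 0 ha).mono' (by fun_prop) (ae_of_all _ fun u => ?_)
    rw [norm_mul, norm_eq_abs, norm_eq_abs, abs_exp]
    exact mul_le_of_le_one_right (exp_pos _).le (abs_sin_le_one _)
  rw [integral_Ioi_of_hasDerivAt_of_tendsto' hderiv hint hlim]
  simp [neg_div]

/-- Laplace transform of the rescaled Dawson function. -/
lemma integral_exp_mul_dawson {a : ℝ} (ha : 0 < a) :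
    ∫ u in Ioi (0 : ℝ), exp (-a * u) * dawson (u / √2) =
      ∫ s in Ioi (0 : ℝ), exp (-s ^ 2) * (√2 * s / (a ^ 2 + 2 * s ^ 2)) := by
  have h2 : 2 / √2 = √2 := div_sqrt
  have hint : Integrable
      (Function.uncurry fun u s : ℝ => exp (-a * u) * (exp (-s ^ 2) * sin (2 * (u / √2) * s)))
      ((volume.restrict (Ioi 0)).prod (volume.restrict (Ioi 0))) := by
    refine ((exp_neg_integrableOn_Ioi 0 ha).mul_prod integrable_gaussian_Ioi).mono'
      (Continuous.aestronglyMeasurable (by unfold Function.uncurry; fun_prop))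
      (ae_of_all _ fun p => ?_)
    simp only [Function.uncurry, norm_mul, norm_eq_abs, abs_exp]
    gcongr
    exact mul_le_of_le_one_right (exp_pos _).le (abs_sin_le_one _)
  simp_rw [dawson_eq_integral_sin, ← integral_const_mul]
  rw [integral_integral_swap hint]
  refine integral_congr_ae (ae_of_all _ fun s => ?_)
  have h := integral_exp_mul_sin ha (√2 * s)
  rw [mul_pow, sq_sqrt zero_le_two] at h
  simp only
  rw [← h, ← integral_const_mul]
  refine integral_congr_ae (ae_of_all _ fun u => ?_)
  simp only
  rw [show 2 * (u / √2) * s = √2 * s * u by linear_combination u * s * h2]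
  ring

/-- The substitution `y = c / t` on the positive half line. -/
lemma integral_Ioi_comp_const_div {c : ℝ} (hc : 0 < c) (g : ℝ → ℝ) :
    ∫ y in Ioi (0 : ℝ), g y = ∫ t in Ioi (0 : ℝ), c / t ^ 2 * g (c / t) := by
  have himage : (fun t : ℝ => c / t) '' Ioi 0 = Ioi 0 := by
    ext y
    constructor
    · rintro ⟨t, ht, rfl⟩
      exact div_pos hc ht
    · intro hy
      exact ⟨c / y, div_pos hc hy, div_div_cancel₀ hc.ne'⟩
  have hderiv : ∀ t ∈ Ioi (0 : ℝ),
      HasDerivWithinAt (fun t : ℝ => c / t) (-(c / t ^ 2)) (Ioi 0) t := by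
    intro t ht
    have h := ((hasDerivAt_inv (ne_of_gt ht)).const_mul c).hasDerivWithinAt (s := Ioi 0)
    simpa [div_eq_mul_inv] using h
  have hinj : InjOn (fun t : ℝ => c / t) (Ioi 0) := by
    intro s _ t _ hst
    simpa [div_div_cancel₀ hc.ne'] using congrArg (c / ·) hst
  rw [← himage, integral_image_eq_integral_abs_deriv_smul measurableSet_Ioi hderiv hinj, himage]
  refine setIntegral_congr_fun measurableSet_Ioi fun t _ => ?_
  simp only [smul_eq_mul, abs_neg]
  rw [abs_of_nonneg (by positivity)]

/-- Laplace (double-exponential) mixture representation of the horseshoe density. -/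
theorem horseshoe_laplace_mixture (τ : ℝ) (hτ : 0 < τ) (x : ℝ) (hx : x ≠ 0) :
    pHS τ x =
      (2 / (π * Real.sqrt π * τ)) *
        ∫ u in Ioi (0:ℝ), Real.exp (-u * |x| / τ) * dawson (u / Real.sqrt 2) := by
  have ha : 0 < |x| / τ := div_pos (abs_pos.2 hx) hτ
  have hs : √2 ^ 2 = 2 := sq_sqrt zero_le_two
  have h2 : 0 < √2 := by positivity
  have hlaplace : ∀ u : ℝ, -u * |x| / τ = -(|x| / τ) * u := fun u => by ring
  simp_rw [hlaplace]
  rw [integral_exp_mul_dawson ha, integral_Ioi_comp_const_div (div_pos ha h2),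
    ← integral_const_mul, pHS]
  refine setIntegral_congr_fun measurableSet_Ioi fun l hl => ?_
  have hl : 0 < l := hl
  have hexp : -x ^ 2 / (2 * l ^ 2 * τ ^ 2) = -(|x| / τ / √2 / l) ^ 2 := by
    simp only [div_pow, sq_abs, hs]
    field_simp
  have hden : (|x| / τ) ^ 2 + 2 * (|x| / τ / √2 / l) ^ 2 = (|x| / τ) ^ 2 * (1 + l ^ 2) / l ^ 2 := by
    simp only [div_pow, hs]
    field_simp
    ring
  rw [hexp, hden, sqrt_mul zero_le_two]
  have hx' : 0 < |x| := abs_pos.2 hx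
  generalize exp _ = E
  field_simp
end

section
/- For every u > 0, the inner integral produced by the change of variables in the Laplace-mixture derivation evaluates to the Dawson function: ∫₀^{u²/2} e^{−v} (u² − 2v)^{−1/2} dv = √2 · D₊(u/√2). -/
open MeasureTheory Real Set

/-- The inner integral from the change of variables evaluates to the Dawson function. -/
theorem inner_integral_eq_dawson (u : ℝ) (hu : 0 < u) :
    (∫ v in (0:ℝ)..(u ^ 2 / 2), Real.exp (-v) * (Real.sqrt (u ^ 2 - 2 * v))⁻¹) =
      Real.sqrt 2 * dawson (u / Real.sqrt 2) := by
  have hle : (0:ℝ) ≤ u ^ 2 / 2 := by positivity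
  have hs : (Real.sqrt 2) ^ 2 = 2 := Real.sq_sqrt (by norm_num)
  -- Substitute `t = √(u² - 2v) / √2`.
  have key := intervalIntegral.integral_comp_mul_deriv_of_deriv_nonpos
    (a := 0) (b := u ^ 2 / 2)
    (f := fun v => Real.sqrt (u ^ 2 - 2 * v) / Real.sqrt 2)
    (f' := fun v => -((Real.sqrt (u ^ 2 - 2 * v))⁻¹ / Real.sqrt 2))
    (g := fun t => Real.exp (t ^ 2))
    (by fun_prop)
    (by
      intro x hx
      rw [min_eq_left hle, max_eq_right hle] at hx
      have hpos : 0 < u ^ 2 - 2 * x := by linarith [hx.2]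
      have h1 : HasDerivAt (fun v : ℝ => u ^ 2 - 2 * v) (-(2 * 1)) x :=
        ((hasDerivAt_id x).const_mul 2).const_sub _
      have h2 := (h1.sqrt hpos.ne').div_const (Real.sqrt 2)
      have : Real.sqrt (u ^ 2 - 2 * x) ≠ 0 := (Real.sqrt_pos.2 hpos).ne'
      refine h2.congr_deriv ?_
      field_simp)
    (by
      intro x _
      exact neg_nonpos.2 (by positivity))
  have hcongr : (∫ v in (0:ℝ)..(u ^ 2 / 2), Real.exp (-v) * (Real.sqrt (u ^ 2 - 2 * v))⁻¹) =
      ∫ v in (0:ℝ)..(u ^ 2 / 2), (-(Real.sqrt 2 * Real.exp (-(u ^ 2 / 2)))) *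
        (((fun t => Real.exp (t ^ 2)) ∘ fun v => Real.sqrt (u ^ 2 - 2 * v) / Real.sqrt 2) v *
          -((Real.sqrt (u ^ 2 - 2 * v))⁻¹ / Real.sqrt 2)) := by
    refine intervalIntegral.integral_congr fun v hv => ?_
    rw [uIcc_of_le hle] at hv
    have hnn : 0 ≤ u ^ 2 - 2 * v := by linarith [hv.2]
    have hexp : Real.exp (-v) = Real.exp (-(u ^ 2 / 2)) * Real.exp ((u ^ 2 - 2 * v) / 2) := by
      rw [← Real.exp_add]
      ring_nf
    simp only [Function.comp_apply, div_pow, hs, Real.sq_sqrt hnn]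
    rw [hexp]
    field_simp
  rw [hcongr, intervalIntegral.integral_const_mul, key, dawson, div_pow, hs]
  have h0 : u ^ 2 - 2 * (u ^ 2 / 2) = 0 := by ring
  simp only [h0, mul_zero, sub_zero, Real.sqrt_sq hu.le, Real.sqrt_zero, zero_div]
  rw [intervalIntegral.integral_symm]
  ring
end

section
/- For every a > 0 and t > 0, ∫₀^∞ λ^{−1} exp(−a²/(2λ²) − tλ²) dλ = ∫₀^∞ exp(−a√(2t) · cosh ζ) dζ; that is, the generalized inverse Gaussian integral over the scale parameter coincides with the cosh-integral representation of the same modified Bessel value K₀(a√(2t)). -/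
open MeasureTheory Real Set

/-- The logarithmic substitution `l = c * exp (x / 2)` in an integral over the half-line. -/
theorem integral_Ioi_eq_integral_comp_mul_exp_half (g : ℝ → ℝ) {c : ℝ} (hc : 0 < c) :
    ∫ l in Ioi (0:ℝ), g l = ∫ x : ℝ, c * (Real.exp (x / 2) * (1 / 2)) * g (c * Real.exp (x / 2)) := by
  have hderiv (x : ℝ) : HasDerivAt (fun x => c * Real.exp (x / 2))
      (c * (Real.exp (x / 2) * (1 / 2))) x :=
    (((hasDerivAt_id x).div_const 2).exp).const_mul c
  have hinj : Function.Injective fun x => c * Real.exp (x / 2) := by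
    intro x y h
    have := Real.exp_injective (mul_left_cancel₀ hc.ne' h)
    linarith
  have himage : (fun x => c * Real.exp (x / 2)) '' univ = Ioi 0 := by
    ext l
    simp only [image_univ, mem_range, mem_Ioi]
    constructor
    · rintro ⟨x, rfl⟩
      positivity
    · intro hl
      refine ⟨2 * Real.log (l / c), ?_⟩
      rw [mul_div_cancel_left₀ _ two_ne_zero, Real.exp_log (by positivity)]
      field_simp
  have h := integral_image_eq_integral_abs_deriv_smul MeasurableSet.univ
    (fun x _ => (hderiv x).hasDerivWithinAt) hinj.injOn g
  rw [himage, setIntegral_univ] at h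
  rw [h]
  refine integral_congr_ae (Filter.Eventually.of_forall fun x => ?_)
  simp only [smul_eq_mul]
  rw [abs_of_pos (by positivity)]

/-- The generalized inverse Gaussian integral over the scale parameter coincides with the
cosh-integral representation of the same modified Bessel value `K₀(a√(2t))`. -/
theorem gig_integral_eq_cosh_integral (a t : ℝ) (ha : 0 < a) (ht : 0 < t) :
    (∫ l in Ioi (0:ℝ), l⁻¹ * Real.exp (-a ^ 2 / (2 * l ^ 2) - t * l ^ 2)) =
      ∫ ζ in Ioi (0:ℝ), Real.exp (-a * Real.sqrt (2 * t) * Real.cosh ζ) := by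
  set s := Real.sqrt (2 * t)
  have hs : 0 < s := Real.sqrt_pos.2 (by positivity)
  have hst : t = s ^ 2 / 2 := by
    rw [Real.sq_sqrt (by positivity)]
    ring
  have hc : 0 < Real.sqrt (a / s) := Real.sqrt_pos.2 (by positivity)
  have hintegrand (x : ℝ) :
      Real.sqrt (a / s) * (Real.exp (x / 2) * (1 / 2)) * ((Real.sqrt (a / s) * Real.exp (x / 2))⁻¹ *
        Real.exp (-a ^ 2 / (2 * (Real.sqrt (a / s) * Real.exp (x / 2)) ^ 2) -
          t * (Real.sqrt (a / s) * Real.exp (x / 2)) ^ 2)) =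
      1 / 2 * Real.exp (-a * s * Real.cosh |x|) := by
    have hsq : (Real.sqrt (a / s) * Real.exp (x / 2)) ^ 2 = a / s * Real.exp x := by
      rw [mul_pow, Real.sq_sqrt (by positivity), ← Real.exp_nat_mul]
      congr 2
      push_cast
      ring
    have hexponent : -a ^ 2 / (2 * (a / s * Real.exp x)) - t * (a / s * Real.exp x) =
        -a * s * Real.cosh |x| := by
      rw [Real.cosh_abs, Real.cosh_eq, Real.exp_neg, hst]
      field_simp
      ring
    rw [hsq, hexponent]
    field_simp
  rw [integral_Ioi_eq_integral_comp_mul_exp_half _ hc]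
  simp_rw [hintegrand]
  rw [integral_const_mul, integral_comp_abs (f := fun x => Real.exp (-a * s * Real.cosh x))]
  ring
end

section
/- For every a > 0, the change of variables u = √(2t)·cosh ζ, v = t gives the identity ∫₀^∞ ∫₀^∞ exp(−a√(2t)·cosh ζ − t) dζ dt = ∫₀^∞ exp(−a u) ( ∫₀^{u²/2} e^{−v} (u² − 2v)^{−1/2} dv ) du, with both sides finite. -/
open MeasureTheory Real Set

lemma image_mul_cosh_Ioi {c : ℝ} (hc : 0 < c) :
    (fun ζ => c * Real.cosh ζ) '' Ioi 0 = Ioi c := by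
  ext u
  simp only [mem_image, mem_Ioi]
  constructor
  · rintro ⟨ζ, hζ, rfl⟩
    exact lt_mul_of_one_lt_right hc (Real.one_lt_cosh.2 hζ.ne')
  · intro hu
    have h : 1 < u / c := (one_lt_div hc).2 hu
    exact ⟨Real.arcosh (u / c), Real.arcosh_pos h, by
      rw [Real.cosh_arcosh h.le]; field_simp⟩

/-- The substitution `u = c * cosh ζ`. -/
lemma setIntegral_Ioi_mul_inv_sqrt_eq {c : ℝ} (hc : 0 < c) (g : ℝ → ℝ) :
    ∫ u in Ioi c, g u * (Real.sqrt (u ^ 2 - c ^ 2))⁻¹ =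
      ∫ ζ in Ioi (0:ℝ), g (c * Real.cosh ζ) := by
  rw [← image_mul_cosh_Ioi hc,
    integral_image_eq_integral_abs_deriv_smul (f' := fun ζ => c * Real.sinh ζ) measurableSet_Ioi
      (fun ζ _ => ((Real.hasDerivAt_cosh ζ).const_mul c).hasDerivWithinAt)]
  · refine setIntegral_congr_fun measurableSet_Ioi fun ζ hζ => ?_
    have hs : 0 < c * Real.sinh ζ := mul_pos hc (Real.sinh_pos_iff.2 hζ)
    have h : (c * Real.cosh ζ) ^ 2 - c ^ 2 = (c * Real.sinh ζ) ^ 2 := by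
      rw [mul_pow, mul_pow, Real.cosh_sq]; ring
    simp only [smul_eq_mul]
    rw [h, Real.sqrt_sq hs.le, abs_of_pos hs, mul_comm (g _), mul_inv_cancel_left₀ hs.ne']
  · intro x hx y hy hxy
    exact Real.cosh_strictMonoOn.injOn (mem_Ici.2 (le_of_lt hx)) (mem_Ici.2 (le_of_lt hy))
      (mul_left_cancel₀ hc.ne' hxy)

lemma setIntegral_Ioi_zero_eq_Ioi_sqrt {t : ℝ} (g : ℝ → ℝ) :
    ∫ u in Ioi (0:ℝ), g u * (Real.sqrt (u ^ 2 - 2 * t))⁻¹ =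
      ∫ u in Ioi (Real.sqrt (2 * t)), g u * (Real.sqrt (u ^ 2 - 2 * t))⁻¹ := by
  refine setIntegral_eq_of_subset_of_forall_sdiff_eq_zero measurableSet_Ioi
    (Ioi_subset_Ioi (Real.sqrt_nonneg _)) fun u hu => ?_
  have h : u ^ 2 ≤ 2 * t := (Real.le_sqrt' hu.1).1 (not_lt.1 hu.2)
  rw [Real.sqrt_eq_zero_of_nonpos (by linarith), inv_zero, mul_zero]

lemma hasDerivAt_neg_sqrt_sq_sub {u v : ℝ} (hv : v < u ^ 2 / 2) :
    HasDerivAt (fun v => -Real.sqrt (u ^ 2 - 2 * v)) (Real.sqrt (u ^ 2 - 2 * v))⁻¹ v := by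
  have hpos : 0 < u ^ 2 - 2 * v := by linarith
  have hs := Real.sqrt_pos.2 hpos
  have h : HasDerivAt (fun v : ℝ => u ^ 2 - 2 * v) (-(2 * 1)) v :=
    ((hasDerivAt_id v).const_mul 2).const_sub (u ^ 2)
  refine (h.sqrt hpos.ne').fun_neg.congr_deriv ?_
  field_simp

lemma integrableOn_inv_sqrt_sq_sub (u : ℝ) :
    IntegrableOn (fun v => (Real.sqrt (u ^ 2 - 2 * v))⁻¹) (Ioc 0 (u ^ 2 / 2)) :=
  intervalIntegral.integrableOn_deriv_of_nonneg (g := fun v => -Real.sqrt (u ^ 2 - 2 * v))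
    (by fun_prop) (fun _ hv => hasDerivAt_neg_sqrt_sq_sub hv.2) (fun _ _ => by positivity)

lemma integral_inv_sqrt_sq_sub {u : ℝ} (hu : 0 ≤ u) :
    ∫ v in (0:ℝ)..(u ^ 2 / 2), (Real.sqrt (u ^ 2 - 2 * v))⁻¹ = u := by
  have h0 : 0 ≤ u ^ 2 / 2 := by positivity
  rw [intervalIntegral.integral_eq_sub_of_hasDerivAt_of_le h0
    (f := fun v => -Real.sqrt (u ^ 2 - 2 * v)) (by fun_prop)
    (fun v hv => hasDerivAt_neg_sqrt_sq_sub hv.2)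
    ((intervalIntegrable_iff_integrableOn_Ioc_of_le h0).2 (integrableOn_inv_sqrt_sq_sub u))]
  simp [mul_div_cancel₀, Real.sqrt_sq hu]

lemma exp_neg_mul_inv_sqrt_eq_zero {u v : ℝ} (hv : v ∈ Ioi 0 \ Ioc 0 (u ^ 2 / 2)) :
    Real.exp (-v) * (Real.sqrt (u ^ 2 - 2 * v))⁻¹ = 0 := by
  have h : u ^ 2 / 2 < v := not_le.1 fun h => hv.2 ⟨hv.1, h⟩
  rw [Real.sqrt_eq_zero_of_nonpos (by linarith), inv_zero, mul_zero]

lemma exp_neg_mul_inv_sqrt_le {u v : ℝ} (hv : 0 ≤ v) :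
    Real.exp (-v) * (Real.sqrt (u ^ 2 - 2 * v))⁻¹ ≤ (Real.sqrt (u ^ 2 - 2 * v))⁻¹ :=
  mul_le_of_le_one_left (by positivity) (Real.exp_le_one_iff.2 (by linarith))

lemma integrableOn_exp_neg_mul_inv_sqrt (u : ℝ) :
    IntegrableOn (fun v => Real.exp (-v) * (Real.sqrt (u ^ 2 - 2 * v))⁻¹) (Ioi 0) := by
  refine IntegrableOn.of_forall_sdiff_eq_zero (s := Ioc 0 (u ^ 2 / 2)) ?_ measurableSet_Ioi
    fun v hv => exp_neg_mul_inv_sqrt_eq_zero hv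
  refine (integrableOn_inv_sqrt_sq_sub u).mono'
    (Measurable.aestronglyMeasurable (by fun_prop)) ?_
  refine (ae_restrict_mem measurableSet_Ioc).mono fun v hv => ?_
  rw [Real.norm_of_nonneg (by positivity)]
  exact exp_neg_mul_inv_sqrt_le hv.1.le

lemma setIntegral_Ioi_exp_neg_mul_inv_sqrt (u : ℝ) :
    ∫ v in Ioi (0:ℝ), Real.exp (-v) * (Real.sqrt (u ^ 2 - 2 * v))⁻¹ =
      ∫ v in (0:ℝ)..(u ^ 2 / 2), Real.exp (-v) * (Real.sqrt (u ^ 2 - 2 * v))⁻¹ := by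
  rw [intervalIntegral.integral_of_le (by positivity)]
  exact setIntegral_eq_of_subset_of_forall_sdiff_eq_zero measurableSet_Ioi
    Ioc_subset_Ioi_self fun v hv => exp_neg_mul_inv_sqrt_eq_zero hv

lemma setIntegral_Ioi_exp_neg_mul_inv_sqrt_le {u : ℝ} (hu : 0 ≤ u) :
    ∫ v in Ioi (0:ℝ), Real.exp (-v) * (Real.sqrt (u ^ 2 - 2 * v))⁻¹ ≤ u := by
  have h0 : 0 ≤ u ^ 2 / 2 := by positivity
  rw [setIntegral_Ioi_exp_neg_mul_inv_sqrt]
  refine le_trans ?_ (integral_inv_sqrt_sq_sub hu).le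
  rw [intervalIntegral.integral_of_le h0, intervalIntegral.integral_of_le h0]
  exact setIntegral_mono_on
    ((integrableOn_exp_neg_mul_inv_sqrt u).mono_set Ioc_subset_Ioi_self)
    (integrableOn_inv_sqrt_sq_sub u) measurableSet_Ioc
    fun v hv => exp_neg_mul_inv_sqrt_le hv.1.le

lemma setIntegral_exp_cosh_eq (a : ℝ) {t : ℝ} (ht : 0 < t) :
    ∫ ζ in Ioi (0:ℝ), Real.exp (-a * Real.sqrt (2 * t) * Real.cosh ζ - t) =
      ∫ u in Ioi (0:ℝ),
        Real.exp (-a * u) * (Real.exp (-t) * (Real.sqrt (u ^ 2 - 2 * t))⁻¹) := by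
  have h2 : 0 < 2 * t := by positivity
  have h := setIntegral_Ioi_mul_inv_sqrt_eq (Real.sqrt_pos.2 h2)
    (fun u => Real.exp (-a * u) * Real.exp (-t))
  rw [Real.sq_sqrt h2.le, ← setIntegral_Ioi_zero_eq_Ioi_sqrt] at h
  simp only [← mul_assoc]
  rw [h]
  congr 1 with ζ
  rw [← Real.exp_add]
  ring_nf

lemma integrable_prod_exp_mul_inv_sqrt {a : ℝ} (ha : 0 < a) :
    Integrable (Function.uncurry fun t u : ℝ =>
        Real.exp (-a * u) * (Real.exp (-t) * (Real.sqrt (u ^ 2 - 2 * t))⁻¹))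
      ((volume.restrict (Ioi 0)).prod (volume.restrict (Ioi 0))) := by
  have hmeas : Measurable (Function.uncurry fun t u : ℝ =>
      Real.exp (-a * u) * (Real.exp (-t) * (Real.sqrt (u ^ 2 - 2 * t))⁻¹)) := by
    unfold Function.uncurry
    fun_prop
  rw [integrable_prod_iff' hmeas.aestronglyMeasurable]
  refine ⟨ae_of_all _ fun u => (integrableOn_exp_neg_mul_inv_sqrt u).integrable.const_mul
    (Real.exp (-a * u)), ?_⟩
  have hbound : IntegrableOn (fun u : ℝ => u * Real.exp (-a * u)) (Ioi 0) := by
    simpa using integrableOn_rpow_mul_exp_neg_mul_rpow (p := 1) (s := 1) (by norm_num)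
      zero_lt_one ha
  refine hbound.mono' hmeas.norm.stronglyMeasurable.integral_prod_left.aestronglyMeasurable ?_
  refine (ae_restrict_mem measurableSet_Ioi).mono fun u hu => ?_
  rw [Real.norm_of_nonneg (integral_nonneg fun _ => norm_nonneg _)]
  have h : ∀ t : ℝ, ‖Function.uncurry (fun t u : ℝ =>
      Real.exp (-a * u) * (Real.exp (-t) * (Real.sqrt (u ^ 2 - 2 * t))⁻¹)) (t, u)‖ =
      Real.exp (-a * u) * (Real.exp (-t) * (Real.sqrt (u ^ 2 - 2 * t))⁻¹) :=
    fun t => Real.norm_of_nonneg (by simp only [Function.uncurry]; positivity)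
  simp only [h]
  rw [integral_const_mul, mul_comm]
  exact mul_le_mul_of_nonneg_right (setIntegral_Ioi_exp_neg_mul_inv_sqrt_le (le_of_lt hu))
    (Real.exp_pos _).le

/-- The change of variables `u = √(2t)·cosh ζ`, `v = t` in the double integral, with both
sides finite. -/
theorem change_of_variables_double_integral (a : ℝ) (ha : 0 < a) :
    IntegrableOn
      (fun t => ∫ ζ in Ioi (0:ℝ), Real.exp (-a * Real.sqrt (2 * t) * Real.cosh ζ - t))
      (Ioi 0) ∧
    IntegrableOn
      (fun u => Real.exp (-a * u) *
        ∫ v in (0:ℝ)..(u ^ 2 / 2), Real.exp (-v) * (Real.sqrt (u ^ 2 - 2 * v))⁻¹)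
      (Ioi 0) ∧
    (∫ t in Ioi (0:ℝ), ∫ ζ in Ioi (0:ℝ), Real.exp (-a * Real.sqrt (2 * t) * Real.cosh ζ - t)) =
      ∫ u in Ioi (0:ℝ), Real.exp (-a * u) *
        ∫ v in (0:ℝ)..(u ^ 2 / 2), Real.exp (-v) * (Real.sqrt (u ^ 2 - 2 * v))⁻¹ := by
  have hF := integrable_prod_exp_mul_inv_sqrt ha
  have hu (u : ℝ) : ∫ t in Ioi (0:ℝ),
      Real.exp (-a * u) * (Real.exp (-t) * (Real.sqrt (u ^ 2 - 2 * t))⁻¹) =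
      Real.exp (-a * u) *
        ∫ v in (0:ℝ)..(u ^ 2 / 2), Real.exp (-v) * (Real.sqrt (u ^ 2 - 2 * v))⁻¹ := by
    rw [integral_const_mul, setIntegral_Ioi_exp_neg_mul_inv_sqrt]
  refine ⟨?_, ?_, ?_⟩
  · exact IntegrableOn.congr_fun hF.integral_prod_left
      (fun t ht => (setIntegral_exp_cosh_eq a ht).symm) measurableSet_Ioi
  · exact IntegrableOn.congr_fun hF.integral_prod_right (fun u _ => hu u) measurableSet_Ioi
  · rw [setIntegral_congr_fun measurableSet_Ioi fun t ht => setIntegral_exp_cosh_eq a ht,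
      integral_integral_swap hF]
    simp only [hu]
end

section
/- The function u ↦ D₊(u/√2)/u is a (unnormalized) probability density on (0,∞) with explicit normalizing constant: ∫₀^∞ D₊(s)/s ds = π^{3/2}/4. Equivalently, π(u) = (4/(π√π)) · D₊(u/√2)/u is a probability density on (0,∞). -/
open MeasureTheory Real Set

/-- Substituting `t = s sin θ` in the integral defining the Dawson function. -/
lemma dawson_eq_mul_integral (s : ℝ) :
    dawson s = s * ∫ θ in (0:ℝ)..(π / 2), cos θ * exp (-(cos θ ^ 2) * s ^ 2) := by
  have h := intervalIntegral.integral_comp_mul_deriv (a := 0) (b := π / 2)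
    (f := fun θ => s * sin θ) (f' := fun θ => s * cos θ) (g := fun t => exp (t ^ 2))
    (fun θ _ => (hasDerivAt_sin θ).const_mul s) (by fun_prop) (by fun_prop)
  simp only [sin_zero, mul_zero, sin_pi_div_two, mul_one] at h
  rw [dawson, ← h, ← intervalIntegral.integral_const_mul, ← intervalIntegral.integral_const_mul]
  congr 1 with θ
  have hexp : exp (-(cos θ ^ 2) * s ^ 2) = exp (-s ^ 2) * exp ((s * sin θ) ^ 2) := by
    rw [← exp_add, cos_sq']
    ring_nf
  rw [hexp, Function.comp_apply]
  ring

lemma dawson_nonneg {s : ℝ} (hs : 0 ≤ s) : 0 ≤ dawson s :=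
  mul_nonneg (exp_pos _).le (intervalIntegral.integral_nonneg hs fun _ _ => (exp_pos _).le)

lemma integral_Ioi_mul_exp_neg_sq_mul_sq {c : ℝ} (hc : 0 < c) :
    ∫ s in Ioi (0:ℝ), c * exp (-(c ^ 2) * s ^ 2) = √π / 2 := by
  rw [integral_const_mul, integral_gaussian_Ioi, sqrt_div pi_pos.le, sqrt_sq hc.le]
  field_simp

lemma integrable_cos_mul_exp_prod :
    Integrable (Function.uncurry fun s θ : ℝ => cos θ * exp (-(cos θ ^ 2) * s ^ 2))
      ((volume.restrict (Ioi (0:ℝ))).prod (volume.restrict (Ioo 0 (π / 2)))) := by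
  have hcos : ∀ᵐ θ ∂(volume.restrict (Ioo 0 (π / 2))), 0 < cos θ := by
    filter_upwards [ae_restrict_mem measurableSet_Ioo] with θ hθ
    exact cos_pos_of_mem_Ioo ⟨by linarith [hθ.1, pi_pos], hθ.2⟩
  refine (integrable_prod_iff' (Continuous.aestronglyMeasurable (by fun_prop))).2 ⟨?_, ?_⟩
  · filter_upwards [hcos] with θ hθ
    exact ((integrable_exp_neg_mul_sq (pow_pos hθ 2)).const_mul (cos θ)).restrict
  · refine (integrable_const (√π / 2)).congr ?_
    filter_upwards [hcos] with θ hθ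
    rw [← integral_Ioi_mul_exp_neg_sq_mul_sq hθ]
    congr 1 with s
    exact (norm_of_nonneg (mul_pos hθ (exp_pos _)).le).symm

lemma integral_Ioi_dawson_div :
    ∫ s in Ioi (0:ℝ), dawson s / s = π ^ ((3:ℝ) / 2) / 4 := by
  calc ∫ s in Ioi (0:ℝ), dawson s / s
      = ∫ s in Ioi (0:ℝ), ∫ θ in Ioo 0 (π / 2), cos θ * exp (-(cos θ ^ 2) * s ^ 2) := by
        refine setIntegral_congr_fun measurableSet_Ioi fun s hs => ?_
        rw [dawson_eq_mul_integral, mul_div_cancel_left₀ _ (ne_of_gt hs),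
          intervalIntegral.integral_of_le (by positivity), integral_Ioc_eq_integral_Ioo]
    _ = ∫ θ in Ioo 0 (π / 2), ∫ s in Ioi (0:ℝ), cos θ * exp (-(cos θ ^ 2) * s ^ 2) :=
        integral_integral_swap integrable_cos_mul_exp_prod
    _ = ∫ θ in Ioo 0 (π / 2), √π / 2 := by
        refine setIntegral_congr_fun measurableSet_Ioo fun θ hθ => ?_
        exact integral_Ioi_mul_exp_neg_sq_mul_sq
          (cos_pos_of_mem_Ioo ⟨by linarith [hθ.1, pi_pos], hθ.2⟩)
    _ = π ^ ((3:ℝ) / 2) / 4 := by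
        rw [setIntegral_const, Real.volume_real_Ioo_of_le (by positivity), smul_eq_mul,
          show (3:ℝ) / 2 = 1 + 1 / 2 by norm_num, rpow_add pi_pos, rpow_one, ← sqrt_eq_rpow]
        ring

/-- `u ↦ D₊(u/√2)/u` is an unnormalized density on `(0,∞)` with normalizing constant
`π^{3/2}/4`; equivalently `π(u) = (4/(π√π)) D₊(u/√2)/u` is a probability density. -/
theorem dawson_mixing_density :
    (∫ s in Ioi (0:ℝ), dawson s / s) = π ^ ((3:ℝ) / 2) / 4 ∧
    (∀ u : ℝ, 0 < u → 0 ≤ (4 / (π * Real.sqrt π)) * (dawson (u / Real.sqrt 2) / u)) ∧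
    (∫ u in Ioi (0:ℝ), (4 / (π * Real.sqrt π)) * (dawson (u / Real.sqrt 2) / u)) = 1 := by
  refine ⟨integral_Ioi_dawson_div, fun u hu => ?_, ?_⟩
  · have := dawson_nonneg (s := u / √2) (by positivity)
    positivity
  · have h2 : (0:ℝ) < (√2)⁻¹ := by positivity
    have hscale : ∫ u in Ioi (0:ℝ), dawson (u / √2) / u = ∫ s in Ioi (0:ℝ), dawson s / s := by
      rw [← mul_zero (√2)⁻¹, ← integral_comp_mul_left_Ioi' (fun s => dawson s / s) 0 h2,
        smul_eq_mul, mul_zero, ← integral_const_mul]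
      congr 1 with u
      rw [div_eq_inv_mul u]
      field_simp
    rw [integral_const_mul, hscale, integral_Ioi_dawson_div,
      show (3:ℝ) / 2 = 1 + 1 / 2 by norm_num, rpow_add pi_pos, rpow_one, ← sqrt_eq_rpow]
    have := pi_pos
    field_simp
end

section
/- For every τ > 0, x > 0 and every natural number k, the k-th derivative of the marginal horseshoe density satisfies p_HS^{(k)}(x) = (−1)^k · (2/(π√π τ^{k+1})) ∫₀^∞ u^k exp(−u x/τ) · D₊(u/√2) du, the integral on the right being finite. -/
open MeasureTheory Real Set

theorem continuous_dawson : Continuous dawson := by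
  unfold dawson
  refine (by fun_prop : Continuous fun z : ℝ => Real.exp (-z ^ 2)).mul ?_
  exact intervalIntegral.continuous_primitive
    (fun a b => (by fun_prop : Continuous fun t : ℝ => Real.exp (t ^ 2)).intervalIntegrable a b) 0

theorem dawson_nonneg_s5 {z : ℝ} (hz : 0 ≤ z) : 0 ≤ dawson z :=
  mul_nonneg (Real.exp_pos _).le
    (intervalIntegral.integral_nonneg hz fun _ _ => (Real.exp_pos _).le)

theorem dawson_le_self {z : ℝ} (hz : 0 ≤ z) : dawson z ≤ z := by
  have h : ∫ t in (0:ℝ)..z, Real.exp (t ^ 2) ≤ ∫ _ in (0:ℝ)..z, Real.exp (z ^ 2) := by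
    refine intervalIntegral.integral_mono_on hz ?_ ?_ fun t ht => ?_
    · exact (by fun_prop : Continuous fun t : ℝ => Real.exp (t ^ 2)).intervalIntegrable _ _
    · exact continuous_const.intervalIntegrable _ _
    · exact Real.exp_le_exp.2 (pow_le_pow_left₀ ht.1 ht.2 2)
  calc dawson z ≤ Real.exp (-z ^ 2) * ∫ _ in (0:ℝ)..z, Real.exp (z ^ 2) :=
        mul_le_mul_of_nonneg_left h (Real.exp_pos _).le
    _ = z := by
        rw [intervalIntegral.integral_const, smul_eq_mul, mul_left_comm, ← Real.exp_add]
        simp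

/-- The Dawson function at `s / √2` as a truncated convolution-type integral. -/
theorem dawson_div_sqrt_two (s : ℝ) :
    dawson (s / Real.sqrt 2) =
      (Real.sqrt 2)⁻¹ * ∫ v in (0:ℝ)..s, Real.exp (-s * v + v ^ 2 / 2) := by
  have h2 : (Real.sqrt 2) ≠ 0 := by positivity
  have hsq : (Real.sqrt 2) ^ 2 = 2 := Real.sq_sqrt (by norm_num)
  have h := intervalIntegral.integral_comp_sub_div (a := 0) (b := s)
    (fun t : ℝ => Real.exp (t ^ 2)) h2 (s / Real.sqrt 2)
  simp only [zero_div, sub_zero, sub_self, smul_eq_mul] at h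
  have hI : ∫ t in (0:ℝ)..(s / Real.sqrt 2), Real.exp (t ^ 2) =
      (Real.sqrt 2)⁻¹ * ∫ v in (0:ℝ)..s, Real.exp ((s / Real.sqrt 2 - v / Real.sqrt 2) ^ 2) := by
    rw [h]; field_simp
  rw [dawson, hI, mul_left_comm, ← intervalIntegral.integral_const_mul]
  congr 1
  refine intervalIntegral.integral_congr fun v _ => ?_
  rw [← Real.exp_add]
  congr 1
  rw [← sub_div, div_pow, div_pow, hsq]
  ring

theorem integrableOn_pow_mul_exp_neg_mul (n : ℕ) {b : ℝ} (hb : 0 < b) :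
    IntegrableOn (fun u : ℝ => u ^ n * Real.exp (-b * u)) (Ioi 0) := by
  have h := integrableOn_rpow_mul_exp_neg_mul_rpow (p := 1) (s := n) (b := b)
    (by linarith [n.cast_nonneg (α := ℝ)]) one_pos hb
  simpa using h

theorem integrableOn_pow_mul_exp_mul_dawson (k : ℕ) {y : ℝ} (hy : 0 < y) :
    IntegrableOn (fun u => u ^ k * Real.exp (-y * u) * dawson (u / Real.sqrt 2)) (Ioi 0) := by
  have hc : Continuous fun u : ℝ => u ^ k * Real.exp (-y * u) * dawson (u / Real.sqrt 2) :=
    (by fun_prop : Continuous fun u : ℝ => u ^ k * Real.exp (-y * u)).mul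
      (continuous_dawson.comp (by fun_prop))
  refine (integrableOn_pow_mul_exp_neg_mul (k + 1) hy).mono' hc.aestronglyMeasurable ?_
  filter_upwards [ae_restrict_mem measurableSet_Ioi] with u hu
  have hu : 0 < u := hu
  have hz : 0 ≤ u / Real.sqrt 2 := by positivity
  have h1 : dawson (u / Real.sqrt 2) ≤ u := (dawson_le_self hz).trans
    (div_le_self hu.le (Real.one_le_sqrt.2 (by norm_num)))
  rw [Real.norm_of_nonneg (mul_nonneg (by positivity) (dawson_nonneg_s5 hz))]
  calc _ ≤ u ^ k * Real.exp (-y * u) * u := mul_le_mul_of_nonneg_left h1 (by positivity)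
    _ = _ := by ring

/-- The Laplace transform of `s ↦ dawson (s / √2)`, by exchanging the order of integration. -/
theorem integral_exp_mul_dawson_s5 {y : ℝ} (hy : 0 < y) :
    ∫ s in Ioi (0:ℝ), Real.exp (-y * s) * dawson (s / Real.sqrt 2) =
      (Real.sqrt 2)⁻¹ * ∫ v in Ioi (0:ℝ), Real.exp (-v ^ 2 / 2 - y * v) / (v + y) := by
  let K : ℝ → ℝ → ℝ := fun s v =>
    (Iio s).indicator (fun v => Real.exp (-y * s) * Real.exp (-s * v + v ^ 2 / 2)) v
  have hKm : Measurable (Function.uncurry K) := by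
    have : Function.uncurry K = {p : ℝ × ℝ | p.2 < p.1}.indicator
        (fun p => Real.exp (-y * p.1) * Real.exp (-p.1 * p.2 + p.2 ^ 2 / 2)) := by
      ext ⟨s, v⟩
      simp [K, indicator, Function.uncurry]
    rw [this]
    exact Measurable.indicator (by fun_prop) (measurableSet_lt measurable_snd measurable_fst)
  have hK0 : ∀ s v, 0 ≤ K s v := fun s v => indicator_nonneg (fun _ _ => by positivity) _
  have hinner : ∀ s, 0 < s → ∫ v in Ioi (0:ℝ), K s v =
      Real.sqrt 2 * (Real.exp (-y * s) * dawson (s / Real.sqrt 2)) := by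
    intro s hs
    simp only [K]
    rw [setIntegral_indicator measurableSet_Iio, Ioi_inter_Iio, ← integral_Ioc_eq_integral_Ioo,
      ← intervalIntegral.integral_of_le hs.le, intervalIntegral.integral_const_mul,
      dawson_div_sqrt_two]
    field_simp
  have hint : Integrable (Function.uncurry K)
      ((volume.restrict (Ioi (0:ℝ))).prod (volume.restrict (Ioi (0:ℝ)))) := by
    rw [integrable_prod_iff hKm.aestronglyMeasurable]
    constructor
    · refine Filter.Eventually.of_forall fun s => ?_
      simp only [Function.uncurry, K]
      rw [integrable_indicator_iff measurableSet_Iio, IntegrableOn,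
        Measure.restrict_restrict measurableSet_Iio]
      refine IntegrableOn.mono_set (t := Icc 0 s) ?_ fun v hv => ⟨le_of_lt hv.2, le_of_lt hv.1⟩
      exact (by fun_prop : Continuous fun v : ℝ =>
        Real.exp (-y * s) * Real.exp (-s * v + v ^ 2 / 2)).continuousOn.integrableOn_Icc
    · have h := (integrableOn_pow_mul_exp_mul_dawson 0 hy).const_mul (Real.sqrt 2)
      refine h.congr ?_
      filter_upwards [ae_restrict_mem measurableSet_Ioi] with s hs
      simp only [Function.uncurry, Real.norm_of_nonneg (hK0 _ _), hinner s hs, pow_zero, one_mul]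
  have houter : ∀ v, 0 < v → ∫ s in Ioi (0:ℝ), K s v =
      Real.exp (-v ^ 2 / 2 - y * v) / (v + y) := by
    intro v hv
    have hK : (fun s => K s v) = (Ioi v).indicator
        (fun s => Real.exp (v ^ 2 / 2) * Real.exp (-(v + y) * s)) := by
      ext s
      simp only [K, indicator, mem_Iio, mem_Ioi, ← Real.exp_add]
      congr 2
      ring
    rw [hK, setIntegral_indicator measurableSet_Ioi, Ioi_inter_Ioi, max_eq_right hv.le,
      integral_const_mul, integral_exp_mul_Ioi (by linarith), neg_div_neg_eq, ← mul_div_assoc,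
      ← Real.exp_add]
    congr 2
    ring
  have hswap := integral_integral_swap hint
  rw [setIntegral_congr_fun measurableSet_Ioi hinner,
    setIntegral_congr_fun measurableSet_Ioi houter, integral_const_mul] at hswap
  rw [← hswap]
  field_simp

theorem pHS_eq_integral_exp_div_one_add {τ : ℝ} (hτ : 0 < τ) (x : ℝ) :
    pHS τ x = (Real.sqrt (2 * π))⁻¹ * (τ * π)⁻¹ *
      ∫ w in Ioi (0:ℝ), Real.exp (-((x / τ) ^ 2 * w / 2)) / (1 + w) := by
  have himg : (fun l : ℝ => (l ^ 2)⁻¹) '' Ioi 0 = Ioi 0 := by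
    ext w
    constructor
    · rintro ⟨l, hl, rfl⟩
      have hl : 0 < l := hl
      exact mem_Ioi.2 (by positivity)
    · intro hw
      have hw : 0 < w := hw
      refine ⟨(Real.sqrt w)⁻¹, mem_Ioi.2 (by positivity), ?_⟩
      simp only [inv_pow, Real.sq_sqrt hw.le, inv_inv]
  have hinj : InjOn (fun l : ℝ => (l ^ 2)⁻¹) (Ioi 0) := by
    intro a ha b hb h
    exact (pow_left_inj₀ (le_of_lt ha) (le_of_lt hb) two_ne_zero).1 (inv_injective h)
  have hder : ∀ l ∈ Ioi (0:ℝ), HasDerivWithinAt (fun l : ℝ => (l ^ 2)⁻¹) (-2 / l ^ 3)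
      (Ioi 0) l := by
    intro l hl
    have hl : 0 < l := hl
    have h := ((hasDerivAt_pow 2 l).inv (by positivity)).hasDerivWithinAt (s := Ioi 0)
    refine h.congr_deriv ?_
    field_simp
    norm_num [mul_comm]
  have h := integral_image_eq_integral_abs_deriv_smul measurableSet_Ioi hder hinj
    (fun w => Real.exp (-((x / τ) ^ 2 * w / 2)) / (1 + w))
  rw [himg] at h
  rw [h, pHS, ← integral_const_mul]
  refine setIntegral_congr_fun measurableSet_Ioi fun l hl => ?_
  have hl : 0 < l := hl
  have habs : |(-2 : ℝ) / l ^ 3| = 2 / l ^ 3 := by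
    rw [neg_div, abs_neg, abs_of_pos (by positivity)]
  have hexp : -x ^ 2 / (2 * l ^ 2 * τ ^ 2) = -((x / τ) ^ 2 * (l ^ 2)⁻¹ / 2) := by
    field_simp
  simp only [habs, hexp, smul_eq_mul]
  field_simp
  rw [add_comm]

theorem integral_exp_div_one_add_eq {y : ℝ} (hy : 0 < y) :
    ∫ w in Ioi (0:ℝ), Real.exp (-(y ^ 2 * w / 2)) / (1 + w) =
      2 * ∫ v in Ioi (0:ℝ), Real.exp (-v ^ 2 / 2 - y * v) / (v + y) := by
  have himg : (fun v : ℝ => (v + y) ^ 2 / y ^ 2 - 1) '' Ioi 0 = Ioi 0 := by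
    ext w
    constructor
    · rintro ⟨v, hv, rfl⟩
      have hv : 0 < v := hv
      have : (v + y) ^ 2 / y ^ 2 - 1 = (v ^ 2 + 2 * v * y) / y ^ 2 := by
        field_simp
        ring
      simp only [this]
      exact mem_Ioi.2 (by positivity)
    · intro hw
      have hw : 0 < w := hw
      have h1 : 1 < Real.sqrt (1 + w) := Real.lt_sqrt_of_sq_lt (by linarith)
      refine ⟨y * (Real.sqrt (1 + w) - 1), mem_Ioi.2 (mul_pos hy (by linarith)), ?_⟩
      have h2 : y * (Real.sqrt (1 + w) - 1) + y = y * Real.sqrt (1 + w) := by ring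
      simp only [h2, mul_pow, Real.sq_sqrt (by linarith : 0 ≤ 1 + w)]
      field_simp
      ring
  have hinj : InjOn (fun v : ℝ => (v + y) ^ 2 / y ^ 2 - 1) (Ioi 0) := by
    intro a ha b hb h
    have ha : 0 < a := ha
    have hb : 0 < b := hb
    have h' : (a + y) ^ 2 = (b + y) ^ 2 := by
      simpa [div_left_inj' (pow_ne_zero 2 hy.ne')] using h
    have := (pow_left_inj₀ (by positivity) (by positivity) two_ne_zero).1 h'
    linarith
  have hder : ∀ v ∈ Ioi (0:ℝ), HasDerivWithinAt (fun v : ℝ => (v + y) ^ 2 / y ^ 2 - 1)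
      (2 * (v + y) / y ^ 2) (Ioi 0) v := by
    intro v _
    have h := (((((hasDerivAt_id v).add_const y).pow 2).div_const (y ^ 2)).sub_const
      1).hasDerivWithinAt (s := Ioi 0)
    refine h.congr_deriv ?_
    simp
  have h := integral_image_eq_integral_abs_deriv_smul measurableSet_Ioi hder hinj
    (fun w => Real.exp (-(y ^ 2 * w / 2)) / (1 + w))
  rw [himg] at h
  rw [h, ← integral_const_mul]
  refine setIntegral_congr_fun measurableSet_Ioi fun v hv => ?_
  have hv : 0 < v := hv
  have habs : |2 * (v + y) / y ^ 2| = 2 * (v + y) / y ^ 2 := abs_of_pos (by positivity)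
  have hexp : -(y ^ 2 * ((v + y) ^ 2 / y ^ 2 - 1) / 2) = -v ^ 2 / 2 - y * v := by
    field_simp
    ring
  simp only [habs, hexp, smul_eq_mul, add_sub_cancel]
  field_simp

theorem pHS_eq_laplace_dawson {τ x : ℝ} (hτ : 0 < τ) (hx : 0 < x) :
    pHS τ x = 2 / (π * Real.sqrt π * τ) *
      ∫ u in Ioi (0:ℝ), Real.exp (-(x / τ) * u) * dawson (u / Real.sqrt 2) := by
  have hy : 0 < x / τ := div_pos hx hτ
  rw [pHS_eq_integral_exp_div_one_add hτ, integral_exp_div_one_add_eq hy,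
    integral_exp_mul_dawson_s5 hy, Real.sqrt_mul (by norm_num)]
  have := Real.pi_pos
  field_simp

/-- Differentiation of the Laplace transform of `u ↦ u ^ k * dawson (u / √2)`. -/
theorem hasDerivAt_laplace_pow_mul_dawson (k : ℕ) {τ x : ℝ} (hτ : 0 < τ) (hx : 0 < x) :
    HasDerivAt
      (fun x => ∫ u in Ioi (0:ℝ), u ^ k * Real.exp (-(x / τ) * u) * dawson (u / Real.sqrt 2))
      (-τ⁻¹ * ∫ u in Ioi (0:ℝ),
        u ^ (k + 1) * Real.exp (-(x / τ) * u) * dawson (u / Real.sqrt 2)) x := by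
  have hm : ∀ (n : ℕ) (z : ℝ), Continuous fun u : ℝ =>
      u ^ n * Real.exp (-(z / τ) * u) * dawson (u / Real.sqrt 2) := fun n z =>
    (by fun_prop : Continuous fun u : ℝ => u ^ n * Real.exp (-(z / τ) * u)).mul
      (continuous_dawson.comp (by fun_prop))
  rw [← integral_const_mul]
  refine (hasDerivAt_integral_of_dominated_loc_of_deriv_le
    (F' := fun z u => -τ⁻¹ * (u ^ (k + 1) * Real.exp (-(z / τ) * u) * dawson (u / Real.sqrt 2)))
    (bound := fun u => τ⁻¹ * (u ^ (k + 1) * Real.exp (-(x / 2 / τ) * u) *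
      dawson (u / Real.sqrt 2)))
    (Ioi_mem_nhds (half_lt_self hx)) (Filter.Eventually.of_forall fun z =>
      (hm k z).aestronglyMeasurable)
    (integrableOn_pow_mul_exp_mul_dawson k (div_pos hx hτ))
    ((hm (k + 1) x).const_mul _).aestronglyMeasurable ?_
    ((integrableOn_pow_mul_exp_mul_dawson (k + 1)
      (div_pos (half_pos hx) hτ)).const_mul _) ?_).2
  · filter_upwards [ae_restrict_mem measurableSet_Ioi] with u hu z hz
    have hu : 0 < u := hu
    have hz : x / 2 < z := hz
    have hD : 0 ≤ dawson (u / Real.sqrt 2) := dawson_nonneg_s5 (by positivity)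
    rw [norm_mul, norm_neg, Real.norm_of_nonneg (by positivity), Real.norm_of_nonneg
      (by positivity)]
    gcongr
  · refine Filter.Eventually.of_forall fun u z _ => ?_
    have h := ((((hasDerivAt_id z).div_const τ).neg.mul_const u).exp.const_mul
      (u ^ k)).mul_const (dawson (u / Real.sqrt 2))
    refine h.congr_deriv ?_
    simp only [id, Pi.neg_apply]
    ring

theorem iteratedDeriv_pHS {τ : ℝ} (hτ : 0 < τ) (k : ℕ) : ∀ x : ℝ, 0 < x →
    iteratedDeriv k (pHS τ) x = (-1) ^ k * (2 / (π * Real.sqrt π * τ ^ (k + 1))) *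
      ∫ u in Ioi (0:ℝ), u ^ k * Real.exp (-(x / τ) * u) * dawson (u / Real.sqrt 2) := by
  induction k with
  | zero =>
    intro x hx
    simpa using pHS_eq_laplace_dawson hτ hx
  | succ k ih =>
    intro x hx
    have hev : iteratedDeriv k (pHS τ) =ᶠ[nhds x] fun x =>
        (-1) ^ k * (2 / (π * Real.sqrt π * τ ^ (k + 1))) *
          ∫ u in Ioi (0:ℝ), u ^ k * Real.exp (-(x / τ) * u) * dawson (u / Real.sqrt 2) := by
      filter_upwards [Ioi_mem_nhds hx] with z hz using ih z hz
    rw [iteratedDeriv_succ, hev.deriv_eq,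
      ((hasDerivAt_laplace_pow_mul_dawson k hτ hx).const_mul _).deriv]
    have := Real.pi_pos
    field_simp
    ring

/-- Laplace-transform representation of the `k`-th derivative of the horseshoe density. -/
theorem horseshoe_iteratedDeriv_repr (τ : ℝ) (hτ : 0 < τ) (x : ℝ) (hx : 0 < x) (k : ℕ) :
    IntegrableOn (fun u => u ^ k * Real.exp (-u * x / τ) * dawson (u / Real.sqrt 2)) (Ioi 0) ∧
    iteratedDeriv k (pHS τ) x =
      (-1) ^ k * (2 / (π * Real.sqrt π * τ ^ (k + 1))) *
        ∫ u in Ioi (0:ℝ), u ^ k * Real.exp (-u * x / τ) * dawson (u / Real.sqrt 2) := by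
  have hexp : ∀ u : ℝ, -u * x / τ = -(x / τ) * u := fun u => by ring
  simp only [hexp]
  exact ⟨integrableOn_pow_mul_exp_mul_dawson k (div_pos hx hτ), iteratedDeriv_pHS hτ k x hx⟩
end

section
/- For every τ > 0, the marginal horseshoe density is completely monotone on the positive half-line: for every natural number k and every x > 0, (−1)^k · p_HS^{(k)}(x) ≥ 0 (in fact > 0), where p_HS^{(k)} denotes the k-th derivative. -/
open MeasureTheory Real Set

open Filter Topology ProbabilityTheory

lemma integrableOn_Ioi_exp_neg_sq :
    IntegrableOn (fun t : ℝ => exp (-t ^ 2)) (Ioi 0) := by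
  simpa using (integrable_exp_neg_mul_sq one_pos).integrableOn (s := Ioi 0)

lemma integrableOn_Ioi_mul_exp_neg_sq :
    IntegrableOn (fun t : ℝ => t * exp (-t ^ 2)) (Ioi 0) := by
  simpa using (integrable_mul_exp_neg_mul_sq one_pos).integrableOn (s := Ioi 0)

/-- The half-line sine transform of the Gaussian, `y ↦ ∫ t > 0, exp (-t²) sin (t y)`; up to
scaling this is the Dawson function. -/
noncomputable def gaussianSine (y : ℝ) : ℝ := ∫ t in Ioi (0 : ℝ), exp (-t ^ 2) * sin (t * y)

lemma integrableOn_exp_neg_sq_mul_sin (y : ℝ) :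
    IntegrableOn (fun t : ℝ => exp (-t ^ 2) * sin (t * y)) (Ioi 0) := by
  refine Integrable.mono' integrableOn_Ioi_exp_neg_sq (by fun_prop) (ae_of_all _ fun t => ?_)
  rw [norm_mul, norm_of_nonneg (exp_pos _).le]
  exact mul_le_of_le_one_right (exp_pos _).le (abs_sin_le_one _)

lemma hasDerivAt_gaussianSine_integral (y : ℝ) :
    IntegrableOn (fun t : ℝ => t * exp (-t ^ 2) * cos (t * y)) (Ioi 0) ∧
    HasDerivAt gaussianSine (∫ t in Ioi (0 : ℝ), t * exp (-t ^ 2) * cos (t * y)) y := by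
  refine hasDerivAt_integral_of_dominated_loc_of_deriv_le
    (μ := volume.restrict (Ioi 0)) (s := univ) (F := fun y t => exp (-t ^ 2) * sin (t * y))
    (F' := fun y t => t * exp (-t ^ 2) * cos (t * y))
    (bound := fun t => t * exp (-t ^ 2)) univ_mem (.of_forall fun y => by fun_prop)
    (integrableOn_exp_neg_sq_mul_sin y) (by fun_prop) ?_ integrableOn_Ioi_mul_exp_neg_sq ?_
  · filter_upwards [ae_restrict_mem measurableSet_Ioi] with t ht z _
    have ht : 0 < t := ht
    rw [norm_mul, norm_of_nonneg (by positivity)]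
    exact mul_le_of_le_one_right (by positivity) (abs_cos_le_one _)
  · refine ae_of_all _ fun t z _ => ?_
    have := (((hasDerivAt_id z).const_mul t).sin).const_mul (exp (-t ^ 2))
    convert! this using 1
    simp; ring

lemma integral_mul_exp_neg_sq_mul_cos (y : ℝ) :
    ∫ t in Ioi (0 : ℝ), t * exp (-t ^ 2) * cos (t * y) = 1 / 2 - y / 2 * gaussianSine y := by
  have hi := (hasDerivAt_gaussianSine_integral y).1
  have hs := integrableOn_exp_neg_sq_mul_sin y
  have hlim : Tendsto (fun t : ℝ => exp (-t ^ 2) * cos (t * y)) atTop (𝓝 0) := by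
    have h0 : Tendsto (fun t : ℝ => exp (-t ^ 2)) atTop (𝓝 0) :=
      tendsto_exp_neg_atTop_nhds_zero.comp (tendsto_pow_atTop two_ne_zero)
    refine squeeze_zero_norm (fun t => ?_) h0
    rw [norm_mul, norm_of_nonneg (exp_pos _).le]
    exact mul_le_of_le_one_right (exp_pos _).le (abs_cos_le_one _)
  have key := integral_Ioi_of_hasDerivAt_of_tendsto' (a := 0)
    (f := fun t : ℝ => exp (-t ^ 2) * cos (t * y))
    (f' := fun t => -2 * (t * exp (-t ^ 2) * cos (t * y)) - y * (exp (-t ^ 2) * sin (t * y)))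
    (fun t _ => by
      have h1 : HasDerivAt (fun t : ℝ => exp (-t ^ 2)) (exp (-t ^ 2) * (-(2 * t))) t := by
        simpa using ((hasDerivAt_pow 2 t).neg).exp
      have h2 : HasDerivAt (fun t : ℝ => cos (t * y)) (-sin (t * y) * y) t := by
        simpa using ((hasDerivAt_id t).mul_const y).cos
      convert! h1.mul h2 using 1
      ring)
    ((hi.const_mul _).sub (hs.const_mul _)) hlim
  rw [integral_sub (hi.const_mul _) (hs.const_mul _), integral_const_mul, integral_const_mul] at key
  change _ - y * gaussianSine y = _ at key
  simp at key
  linarith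

lemma hasDerivAt_gaussianSine (y : ℝ) :
    HasDerivAt gaussianSine (1 / 2 - y / 2 * gaussianSine y) y :=
  integral_mul_exp_neg_sq_mul_cos y ▸ (hasDerivAt_gaussianSine_integral y).2

lemma continuous_gaussianSine : Continuous gaussianSine :=
  continuous_iff_continuousAt.2 fun y => (hasDerivAt_gaussianSine y).continuousAt

lemma gaussianSine_pos {y : ℝ} (hy : 0 < y) : 0 < gaussianSine y := by
  have hd (z : ℝ) : HasDerivAt (fun z => exp (z ^ 2 / 4) * gaussianSine z)
      (exp (z ^ 2 / 4) / 2) z := by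
    have h1 : HasDerivAt (fun z : ℝ => exp (z ^ 2 / 4)) (exp (z ^ 2 / 4) * (2 * z / 4)) z := by
      simpa using ((hasDerivAt_pow 2 z).div_const 4).exp
    convert! h1.mul (hasDerivAt_gaussianSine z) using 1
    ring
  have hm := strictMono_of_hasDerivAt_pos hd (fun z => by positivity) hy
  simp only [gaussianSine, mul_zero, sin_zero, integral_zero] at hm
  exact pos_of_mul_pos_right hm (exp_pos _).le

lemma norm_gaussianSine_le (y : ℝ) :
    ‖gaussianSine y‖ ≤ ∫ t in Ioi (0 : ℝ), exp (-t ^ 2) := by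
  refine norm_integral_le_of_norm_le integrableOn_Ioi_exp_neg_sq (ae_of_all _ fun t => ?_)
  rw [norm_mul, norm_of_nonneg (exp_pos _).le]
  exact mul_le_of_le_one_right (exp_pos _).le (abs_sin_le_one _)

lemma integrableOn_Ioi_exp_neg_mul {c : ℝ} (hc : 0 < c) :
    IntegrableOn (fun y : ℝ => exp (-(c * y))) (Ioi 0) := by
  simpa using exp_neg_integrableOn_Ioi 0 hc

/-- The Laplace transform of the sine function. -/
lemma integral_exp_neg_mul_sin {c : ℝ} (hc : 0 < c) (t : ℝ) :
    ∫ y in Ioi (0 : ℝ), exp (-(c * y)) * sin (t * y) = t / (t ^ 2 + c ^ 2) := by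
  have hne : t ^ 2 + c ^ 2 ≠ 0 := by positivity
  have h0 : Tendsto (fun y : ℝ => exp (-(c * y))) atTop (𝓝 0) :=
    tendsto_exp_neg_atTop_nhds_zero.comp (tendsto_id.const_mul_atTop hc)
  have hlim : Tendsto (fun y : ℝ => -(exp (-(c * y)) *
      ((c * sin (t * y) + t * cos (t * y)) / (t ^ 2 + c ^ 2)))) atTop (𝓝 0) := by
    rw [← neg_zero]
    refine (h0.zero_mul_isBoundedUnder_le ?_).neg
    refine isBoundedUnder_of ⟨(|c| + |t|) / (t ^ 2 + c ^ 2), fun y => ?_⟩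
    simp only [Function.comp, norm_div, Real.norm_eq_abs,
      abs_of_pos (show 0 < t ^ 2 + c ^ 2 by positivity)]
    gcongr
    refine (abs_add_le _ _).trans ?_
    rw [abs_mul, abs_mul]
    exact add_le_add (mul_le_of_le_one_right (abs_nonneg _) (abs_sin_le_one _))
      (mul_le_of_le_one_right (abs_nonneg _) (abs_cos_le_one _))
  have h_int : IntegrableOn (fun y : ℝ => exp (-(c * y)) * sin (t * y)) (Ioi 0) := by
    refine Integrable.mono' (integrableOn_Ioi_exp_neg_mul hc) (by fun_prop)
      (ae_of_all _ fun y => ?_)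
    rw [norm_mul, norm_of_nonneg (exp_pos _).le]
    exact mul_le_of_le_one_right (exp_pos _).le (abs_sin_le_one _)
  have hderiv (y : ℝ) : HasDerivAt (fun y : ℝ => -(exp (-(c * y)) *
      ((c * sin (t * y) + t * cos (t * y)) / (t ^ 2 + c ^ 2))))
      (exp (-(c * y)) * sin (t * y)) y := by
    have h1 : HasDerivAt (fun y : ℝ => exp (-(c * y))) (exp (-(c * y)) * (-c)) y := by
      simpa using ((hasDerivAt_id y).const_mul c).neg.exp
    have h2 : HasDerivAt (fun y : ℝ => sin (t * y)) (cos (t * y) * t) y := by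
      simpa using ((hasDerivAt_id y).const_mul t).sin
    have h3 : HasDerivAt (fun y : ℝ => cos (t * y)) (-sin (t * y) * t) y := by
      simpa using ((hasDerivAt_id y).const_mul t).cos
    convert! (h1.mul (((h2.const_mul c).add (h3.const_mul t)).div_const (t ^ 2 + c ^ 2))).neg
      using 1
    simp only [Pi.add_apply]
    field_simp
    ring
  rw [integral_Ioi_of_hasDerivAt_of_tendsto' (fun y _ => hderiv y) h_int hlim]
  simp

/-- The Laplace transform of `gaussianSine`, by Fubini. -/
lemma integral_gaussianSine_mul_exp {c : ℝ} (hc : 0 < c) :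
    ∫ y in Ioi (0 : ℝ), gaussianSine y * exp (-(c * y)) =
      ∫ t in Ioi (0 : ℝ), exp (-t ^ 2) * (t / (t ^ 2 + c ^ 2)) := by
  simp only [← integral_exp_neg_mul_sin hc, gaussianSine, ← integral_const_mul,
    ← integral_mul_const]
  rw [integral_integral_swap]
  · congr! 4
    ring
  · refine Integrable.mono' ((integrableOn_Ioi_exp_neg_mul hc).mul_prod integrableOn_Ioi_exp_neg_sq)
      (by fun_prop) (ae_of_all _ fun p => ?_)
    simp only [Function.uncurry, norm_mul, norm_of_nonneg (exp_pos _).le]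
    rw [mul_right_comm, mul_comm (exp (-(c * p.1)))]
    exact mul_le_of_le_one_right (by positivity) (abs_sin_le_one _)

/-- The substitution `l = c / t` in the horseshoe scale mixture. -/
lemma integral_exp_neg_div_sq {c : ℝ} (hc : 0 < c) :
    ∫ l in Ioi (0 : ℝ), exp (-(c / l) ^ 2) * (l⁻¹ * (1 + l ^ 2)⁻¹) =
      ∫ t in Ioi (0 : ℝ), exp (-t ^ 2) * (t / (t ^ 2 + c ^ 2)) := by
  have himg : (fun t : ℝ => c / t) '' Ioi 0 = Ioi 0 := by
    ext l
    constructor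
    · rintro ⟨t, ht, rfl⟩
      exact div_pos hc ht
    · intro hl
      exact ⟨c / l, div_pos hc hl, div_div_cancel₀ hc.ne'⟩
  have hinj : InjOn (fun t : ℝ => c / t) (Ioi 0) := by
    intro s hs t ht h
    have := congrArg (fun u => c / u) h
    simpa only [div_div_cancel₀ hc.ne'] using this
  have h := integral_image_eq_integral_abs_deriv_smul (measurableSet_Ioi (a := (0 : ℝ)))
    (f := fun t : ℝ => c / t) (f' := fun t => -c / t ^ 2)
    (fun t ht => by
      have := ((hasDerivAt_inv (ne_of_gt ht : t ≠ 0)).const_mul c).hasDerivWithinAt (s := Ioi 0)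
      convert! this using 1
      ring) hinj
    (fun l => exp (-(c / l) ^ 2) * (l⁻¹ * (1 + l ^ 2)⁻¹))
  rw [himg] at h
  rw [h]
  refine setIntegral_congr_fun measurableSet_Ioi fun t ht => ?_
  have ht : 0 < t := ht
  simp only [div_div_cancel₀ hc.ne', smul_eq_mul, neg_div, abs_neg]
  rw [abs_of_pos (by positivity)]
  field_simp

/-- The horseshoe density is a Laplace transform of a positive function. -/
lemma pHS_eq_laplace {τ x : ℝ} (hτ : 0 < τ) (hx : 0 < x) :
    pHS τ x = (√(2 * π))⁻¹ * τ⁻¹ * (2 / π) *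
      ∫ y in Ioi (0 : ℝ), gaussianSine y * exp (-((√2 * τ)⁻¹ * x * y)) := by
  rw [integral_gaussianSine_mul_exp (by positivity), ← integral_exp_neg_div_sq (by positivity),
    ← integral_const_mul, pHS]
  refine setIntegral_congr_fun measurableSet_Ioi fun l hl => ?_
  have hl : 0 < l := hl
  have he : -x ^ 2 / (2 * l ^ 2 * τ ^ 2) = -((√2 * τ)⁻¹ * x / l) ^ 2 := by
    rw [div_pow, mul_pow, inv_pow, mul_pow, sq_sqrt zero_le_two]
    field_simp
  simp only [he, mul_inv]
  ring

/-- The measure on `(0, ∞)` with density `gaussianSine`. -/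
noncomputable def gaussianSineMeasure : Measure ℝ :=
  (volume.restrict (Ioi 0)).withDensity fun y => ((gaussianSine y).toNNReal : ENNReal)

lemma integral_gaussianSineMeasure (g : ℝ → ℝ) :
    ∫ y, g y ∂gaussianSineMeasure = ∫ y in Ioi (0 : ℝ), gaussianSine y * g y := by
  rw [gaussianSineMeasure,
    integral_withDensity_eq_integral_smul continuous_gaussianSine.measurable.real_toNNReal]
  refine setIntegral_congr_fun measurableSet_Ioi fun y hy => ?_
  simp [NNReal.smul_def, (gaussianSine_pos hy).le]

lemma integrable_gaussianSineMeasure_iff {g : ℝ → ℝ} :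
    Integrable g gaussianSineMeasure ↔ IntegrableOn (fun y => gaussianSine y * g y) (Ioi 0) := by
  rw [gaussianSineMeasure, integrable_withDensity_iff_integrable_smul
    continuous_gaussianSine.measurable.real_toNNReal]
  refine integrableOn_congr_fun (fun y hy => ?_) measurableSet_Ioi
  simp [NNReal.smul_def, (gaussianSine_pos hy).le]

lemma mem_interior_integrableExpSet_gaussianSineMeasure {a x : ℝ} (ha : 0 < a) (hx : 0 < x) :
    x ∈ interior (integrableExpSet (fun y => -(a * y)) gaussianSineMeasure) := by
  refine interior_maximal (fun z hz => ?_) isOpen_Ioi hx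
  have hz : 0 < z := hz
  have hc := continuous_gaussianSine
  refine integrable_gaussianSineMeasure_iff.2 ?_
  refine Integrable.mono' ((integrableOn_Ioi_exp_neg_mul (mul_pos hz ha)).const_mul
    (∫ t in Ioi (0 : ℝ), exp (-t ^ 2))) (by fun_prop) (ae_of_all _ fun y => ?_)
  rw [norm_mul, norm_of_nonneg (exp_pos _).le, mul_neg, ← mul_assoc z a y]
  gcongr
  exact norm_gaussianSine_le y

lemma neg_one_pow_mul_iteratedDeriv_mgf_pos {a x : ℝ} (ha : 0 < a) (hx : 0 < x) (k : ℕ) :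
    0 < (-1) ^ k * iteratedDeriv k (mgf (fun y => -(a * y)) gaussianSineMeasure) x := by
  have hmem := mem_interior_integrableExpSet_gaussianSineMeasure ha hx
  have h_int := integrable_gaussianSineMeasure_iff.1
    ((integrable_pow_mul_exp_of_mem_interior_integrableExpSet hmem k).const_mul ((-1) ^ k))
  rw [iteratedDeriv_mgf hmem, ← integral_const_mul, integral_gaussianSineMeasure]
  have hpos : ∀ y ∈ Ioi (0 : ℝ), 0 < gaussianSine y *
      ((-1) ^ k * ((-(a * y)) ^ k * exp (x * -(a * y)))) := by
    intro y hy
    have hy' : 0 < y := hy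
    have := gaussianSine_pos hy'
    rw [← mul_assoc ((-1) ^ k), ← mul_pow, neg_one_mul, neg_neg]
    positivity
  rw [setIntegral_pos_iff_support_of_nonneg_ae _ h_int]
  · rw [inter_eq_right.2 fun y hy => Function.mem_support.2 (hpos y hy).ne']
    simp
  · filter_upwards [ae_restrict_mem measurableSet_Ioi] with y hy using (hpos y hy).le

/-- The marginal horseshoe density is (strictly) completely monotone on `(0,∞)`. -/
theorem horseshoe_completely_monotone (τ : ℝ) (hτ : 0 < τ) (k : ℕ) (x : ℝ) (hx : 0 < x) :
    0 < (-1) ^ k * iteratedDeriv k (pHS τ) x := by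
  have heq : pHS τ =ᶠ[𝓝 x] fun z => (√(2 * π))⁻¹ * τ⁻¹ * (2 / π) *
      mgf (fun y => -((√2 * τ)⁻¹ * y)) gaussianSineMeasure z := by
    filter_upwards [Ioi_mem_nhds hx] with z hz
    rw [pHS_eq_laplace hτ hz, mgf, integral_gaussianSineMeasure]
    congr! 5 with y
    ring
  rw [heq.iteratedDeriv_eq, iteratedDeriv_const_mul_field, mul_left_comm]
  have := neg_one_pow_mul_iteratedDeriv_mgf_pos (a := (√2 * τ)⁻¹) (by positivity) hx k
  positivity
end

section
/- For every τ > 0, the marginal horseshoe density p_HS is strictly convex on (0,∞). -/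
open MeasureTheory Real Set

/-- The marginal horseshoe density is, up to a constant, the integral of the functions
`x ↦ exp (-(k * x * s)) / (x + s)`, each of which is strictly convex on `(0,∞)`. -/
theorem pHS_eq_mul_integral {τ x : ℝ} (hτ : 0 < τ) (hx : 0 < x) :
    pHS τ x = ((√(2 * π))⁻¹ * τ⁻¹ * π⁻¹) *
      ∫ s in Ioi (0:ℝ), exp (-((2 * τ ^ 2)⁻¹ * x * s)) / (x + s) := by
  have h₁ := integral_comp_rpow_Ioi
    (fun t : ℝ => exp (-((2 * τ ^ 2)⁻¹ * x ^ 2 * t)) / (1 + t)) (p := -2) (by norm_num)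
  have h₂ := integral_comp_mul_left_Ioi
    (fun t : ℝ => exp (-((2 * τ ^ 2)⁻¹ * x ^ 2 * t)) / (1 + t)) 0 (inv_pos.2 hx)
  have h₃ : ∫ s in Ioi (0:ℝ), exp (-((2 * τ ^ 2)⁻¹ * x * s)) / (x + s) =
      ∫ t in Ioi (0:ℝ), exp (-((2 * τ ^ 2)⁻¹ * x ^ 2 * t)) / (1 + t) := by
    rw [mul_zero, inv_inv, smul_eq_mul] at h₂
    rw [← mul_right_inj' hx.ne', ← h₂, ← integral_const_mul]
    refine setIntegral_congr_fun measurableSet_Ioi fun s hs => ?_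
    have hs' : 0 < s := hs
    have : (2 * τ ^ 2)⁻¹ * x ^ 2 * (x⁻¹ * s) = (2 * τ ^ 2)⁻¹ * x * s := by
      field_simp
    simp only [this]
    field_simp
  rw [h₃, ← h₁, pHS, ← integral_const_mul]
  refine setIntegral_congr_fun measurableSet_Ioi fun l hl => ?_
  have hl' : 0 < l := hl
  have e₁ : l ^ (-2 : ℝ) = (l ^ 2)⁻¹ := by
    rw [rpow_neg hl'.le]; norm_cast
  have e₂ : l ^ ((-2 : ℝ) - 1) = (l ^ 3)⁻¹ := by
    rw [show (-2 : ℝ) - 1 = -(3 : ℕ) by norm_num, rpow_neg hl'.le, rpow_natCast]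
  have e₃ : -((2 * τ ^ 2)⁻¹ * x ^ 2 * (l ^ 2)⁻¹) = -x ^ 2 / (2 * l ^ 2 * τ ^ 2) := by
    field_simp
  simp only [e₁, e₂, e₃, smul_eq_mul, abs_neg, abs_two]
  field_simp
  ring

theorem integrableOn_exp_neg_mul_div_add {k x : ℝ} (hk : 0 < k) (hx : 0 < x) :
    IntegrableOn (fun s : ℝ => exp (-(k * x * s)) / (x + s)) (Ioi 0) := by
  have h := (exp_neg_integrableOn_Ioi 0 (mul_pos hk hx)).const_mul x⁻¹
  refine Integrable.mono' h ?_ ?_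
  · exact (by fun_prop : Measurable fun s : ℝ => exp (-(k * x * s)) / (x + s)).aestronglyMeasurable
  · filter_upwards [ae_restrict_mem measurableSet_Ioi] with s hs
    have hs' : 0 < s := hs
    rw [norm_of_nonneg (by positivity), div_eq_inv_mul, neg_mul]
    gcongr
    linarith

theorem strictConvexOn_exp_neg_mul_div_add {k s : ℝ} (hk : 0 < k) (hs : 0 < s) :
    StrictConvexOn ℝ (Ioi (0:ℝ)) fun x => exp (-(k * x * s)) / (x + s) := by
  refine LinearOrder.strictConvexOn_of_lt (convex_Ioi 0) fun x hx y hy hxy a b ha hb hab => ?_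
  simp only [mem_Ioi, smul_eq_mul] at *
  have hne : -(k * x * s) ≠ -(k * y * s) := by
    have := mul_lt_mul_of_pos_right (mul_lt_mul_of_pos_left hxy hk) hs
    linarith
  have hexp := strictConvexOn_exp.2 (mem_univ _) (mem_univ _) hne ha hb hab
  simp only [smul_eq_mul] at hexp
  rw [show a * -(k * x * s) + b * -(k * y * s) = -(k * (a * x + b * y) * s) by ring] at hexp
  have huv : exp (-(k * y * s)) ≤ exp (-(k * x * s)) := by gcongr
  have hv := exp_pos (-(k * y * s))
  generalize exp (-(k * x * s)) = u at *
  generalize exp (-(k * y * s)) = v at *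
  have hX : 0 < x + s := by positivity
  have hY : 0 < y + s := by positivity
  have hZ : a * x + b * y + s = a * (x + s) + b * (y + s) := by
    linear_combination (-s) * hab
  calc _ < (a * u + b * v) / (a * x + b * y + s) := by gcongr
    _ ≤ _ := by
      rw [hZ]
      have h : 0 ≤ (y - x) * (u * (y + s) - v * (x + s)) :=
        mul_nonneg (by linarith) (sub_nonneg.2 (mul_le_mul huv (by linarith) hX.le (hv.le.trans huv)))
      have key : a * (u / (x + s)) + b * (v / (y + s)) -
          (a * u + b * v) / (a * (x + s) + b * (y + s)) =
          a * b * ((y - x) * (u * (y + s) - v * (x + s))) /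
            ((x + s) * (y + s) * (a * (x + s) + b * (y + s))) := by
        obtain rfl : b = 1 - a := by linarith
        have : a * (x + s) + (1 - a) * (y + s) ≠ 0 := by positivity
        field_simp
        ring
      rw [← sub_nonneg, key]
      positivity

/-- The marginal horseshoe density is strictly convex on `(0,∞)`. -/
theorem horseshoe_strictConvexOn (τ : ℝ) (hτ : 0 < τ) :
    StrictConvexOn ℝ (Ioi (0:ℝ)) (pHS τ) := by
  have hk : 0 < (2 * τ ^ 2)⁻¹ := by positivity
  refine ⟨convex_Ioi 0, fun x hx y hy hxy a b ha hb hab => ?_⟩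
  have hz : a • x + b • y ∈ Ioi (0:ℝ) := convex_Ioi 0 hx hy ha.le hb.le hab
  have ix := (integrableOn_exp_neg_mul_div_add hk hx).const_mul a
  have iy := (integrableOn_exp_neg_mul_div_add hk hy).const_mul b
  have iz := integrableOn_exp_neg_mul_div_add hk hz
  rw [pHS_eq_mul_integral hτ hx, pHS_eq_mul_integral hτ hy, pHS_eq_mul_integral hτ hz]
  simp only [smul_eq_mul] at iz ⊢
  rw [mul_left_comm a, mul_left_comm b, ← mul_add]
  refine mul_lt_mul_of_pos_left ?_ (by positivity)
  rw [← integral_const_mul a, ← integral_const_mul b, ← integral_add' ix iy]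
  have hlt : ∀ s ∈ Ioi (0:ℝ), _ := fun s hs =>
    sub_pos.2 ((strictConvexOn_exp_neg_mul_div_add hk hs).2 hx hy hxy ha hb hab)
  rw [← sub_pos, ← integral_sub (ix.add iy) iz,
    setIntegral_pos_iff_support_of_nonneg_ae]
  · refine lt_of_lt_of_le ?_ (measure_mono (subset_inter (fun s hs => (hlt s hs).ne') subset_rfl))
    simp
  · filter_upwards [ae_restrict_mem measurableSet_Ioi] with s hs using (hlt s hs).le
  · exact (ix.add iy).sub iz
end

section
/- For every τ > 0, the marginal horseshoe density is strictly log-convex on (0,∞); equivalently, the horseshoe penalty pen_HS(x) = −log p_HS(x) is strictly concave on (0,∞), i.e., its second derivative satisfies pen''_HS(x) < 0 for every x > 0. -/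
open MeasureTheory Real Set

open Filter Topology

/-- The exponential integral `E₁(z) = ∫_z^∞ e⁻ᵗ / t dt`. -/
noncomputable def expIntegralOne (z : ℝ) : ℝ := ∫ t in Ioi z, exp (-t) / t

lemma integrableOn_exp_neg_div_Ioi {a : ℝ} (ha : 0 < a) :
    IntegrableOn (fun t : ℝ => exp (-t) / t) (Ioi a) := by
  refine Integrable.mono' ((integrableOn_exp_neg_Ioi a).const_mul a⁻¹) ?_ ?_
  · exact (by fun_prop : Measurable fun t : ℝ => exp (-t) / t).aestronglyMeasurable
  · refine (ae_restrict_iff' measurableSet_Ioi).2 (.of_forall fun t ht => ?_)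
    have ht : a < t := ht
    rw [norm_of_nonneg (by have := ha.trans ht; positivity), div_eq_inv_mul]
    gcongr

lemma hasDerivAt_expIntegralOne {z : ℝ} (hz : 0 < z) :
    HasDerivAt expIntegralOne (-(exp (-z) / z)) z := by
  have h2 : 0 < z / 2 := half_pos hz
  have hI := integrableOn_exp_neg_div_Ioi h2
  have hd : HasDerivAt (fun w => ∫ t in (z / 2)..w, exp (-t) / t) (exp (-z) / z) z := by
    refine intervalIntegral.integral_hasDerivAt_right ?_ ?_ ?_
    · rw [intervalIntegrable_iff_integrableOn_Ioc_of_le (by linarith)]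
      exact hI.mono_set Ioc_subset_Ioi_self
    · exact (by fun_prop : Measurable fun t : ℝ => exp (-t) / t).stronglyMeasurable
        |>.stronglyMeasurableAtFilter
    · exact ContinuousAt.div (by fun_prop) continuousAt_id hz.ne'
  refine (hd.const_sub (expIntegralOne (z / 2))).congr_of_eventuallyEq ?_
  filter_upwards [Ioi_mem_nhds hz] with w hw
  have := intervalIntegral.integral_interval_add_Ioi hI (integrableOn_exp_neg_div_Ioi hw)
  simp only [expIntegralOne]
  linarith

lemma expIntegralOne_nonneg {z : ℝ} (hz : 0 < z) : 0 ≤ expIntegralOne z :=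
  setIntegral_nonneg measurableSet_Ioi fun t ht => by
    have : 0 < t := hz.trans ht
    positivity

/-- The fourth lower convergent of the continued fraction of `exp z * E₁ z`. -/
noncomputable def expIntegralConvergent (z : ℝ) : ℝ :=
  (z ^ 3 + 15 * z ^ 2 + 58 * z + 50) / (z ^ 4 + 16 * z ^ 3 + 72 * z ^ 2 + 96 * z + 24)

lemma hasDerivAt_expIntegralOne_sub_convergent {z : ℝ} (hz : 0 < z) :
    HasDerivAt (fun z => expIntegralOne z - expIntegralConvergent z * exp (-z))
      (-(576 * exp (-z) / (z * (z ^ 4 + 16 * z ^ 3 + 72 * z ^ 2 + 96 * z + 24) ^ 2))) z := by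
  have hQ : z ^ 4 + 16 * z ^ 3 + 72 * z ^ 2 + 96 * z + 24 ≠ 0 := by positivity
  have hP' : HasDerivAt (fun z : ℝ => z ^ 3 + 15 * z ^ 2 + 58 * z + 50)
      (3 * z ^ 2 + 30 * z + 58) z := by
    refine (((((hasDerivAt_pow 3 z).add ((hasDerivAt_pow 2 z).const_mul 15)).add
      ((hasDerivAt_id z).const_mul 58)).add_const 50)).congr_deriv ?_
    norm_num
    ring
  have hQ' : HasDerivAt (fun z : ℝ => z ^ 4 + 16 * z ^ 3 + 72 * z ^ 2 + 96 * z + 24)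
      (4 * z ^ 3 + 48 * z ^ 2 + 144 * z + 96) z := by
    refine ((((((hasDerivAt_pow 4 z).add ((hasDerivAt_pow 3 z).const_mul 16)).add
      ((hasDerivAt_pow 2 z).const_mul 72)).add
      ((hasDerivAt_id z).const_mul 96)).add_const 24)).congr_deriv ?_
    norm_num
    ring
  refine ((hasDerivAt_expIntegralOne hz).sub
    ((hP'.div hQ' hQ).mul (hasDerivAt_neg z).exp)).congr_deriv ?_
  simp only [Pi.div_apply]
  field_simp
  ring

lemma convergent_mul_exp_neg_lt_expIntegralOne {z : ℝ} (hz : 0 < z) :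
    expIntegralConvergent z * exp (-z) < expIntegralOne z := by
  set H : ℝ → ℝ := fun z => expIntegralOne z - expIntegralConvergent z * exp (-z) with hH
  have hanti : StrictAntiOn H (Ioi 0) := by
    refine strictAntiOn_of_deriv_neg (convex_Ioi 0) (fun w hw =>
      (hasDerivAt_expIntegralOne_sub_convergent hw).continuousAt.continuousWithinAt) fun w hw => ?_
    rw [interior_Ioi] at hw
    have hw' : 0 < w := hw
    rw [(hasDerivAt_expIntegralOne_sub_convergent hw').deriv, neg_lt_zero]
    positivity
  have hlim : Tendsto (fun w : ℝ => -exp (-w)) atTop (𝓝 0) := by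
    simpa using (tendsto_exp_neg_atTop_nhds_zero).neg
  have hz1 : (0 : ℝ) < z + 1 := by linarith
  have hnonneg : 0 ≤ H (z + 1) := by
    refine le_of_tendsto hlim ?_
    filter_upwards [eventually_ge_atTop (z + 1), eventually_ge_atTop 1] with w hw hw1
    have hw0 : 0 < w := by linarith
    refine le_trans ?_ (hanti.antitoneOn (mem_Ioi.2 hz1) (mem_Ioi.2 hw0) hw)
    have hR : expIntegralConvergent w ≤ 1 := by
      unfold expIntegralConvergent
      rw [div_le_one (by positivity)]
      nlinarith [pow_pos hw0 4, pow_pos hw0 3]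
    have := mul_le_mul_of_nonneg_right hR (exp_pos (-w)).le
    have := expIntegralOne_nonneg hw0
    simp only [hH]
    linarith
  have := hanti (mem_Ioi.2 hz) (mem_Ioi.2 hz1) (lt_add_one z)
  simp only [hH] at this hnonneg
  linarith

lemma quadratic_exp_mul_expIntegralOne_pos {z : ℝ} (hz : 0 < z) :
    0 < z * (exp z * expIntegralOne z) ^ 2 + (2 * z + 1) * (exp z * expIntegralOne z) - 2 := by
  have hR : 0 < expIntegralConvergent z := by unfold expIntegralConvergent; positivity
  have hlt : expIntegralConvergent z < exp z * expIntegralOne z := by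
    have := mul_lt_mul_of_pos_left (convergent_mul_exp_neg_lt_expIntegralOne hz) (exp_pos z)
    rwa [mul_left_comm, ← exp_add, add_neg_cancel, exp_zero, mul_one] at this
  have hbase : 0 < z * expIntegralConvergent z ^ 2
      + (2 * z + 1) * expIntegralConvergent z - 2 := by
    have : z * expIntegralConvergent z ^ 2 + (2 * z + 1) * expIntegralConvergent z - 2 =
        (z ^ 6 + 27 * z ^ 5 + 266 * z ^ 4 + 1176 * z ^ 3 + 2368 * z ^ 2 + 1876 * z + 48) /
        (z ^ 4 + 16 * z ^ 3 + 72 * z ^ 2 + 96 * z + 24) ^ 2 := by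
      unfold expIntegralConvergent
      field_simp
      ring
    rw [this]
    positivity
  refine hbase.trans ?_
  gcongr

lemma expIntegralOne_pos {z : ℝ} (hz : 0 < z) : 0 < expIntegralOne z := by
  refine lt_trans ?_ (convergent_mul_exp_neg_lt_expIntegralOne hz)
  unfold expIntegralConvergent
  positivity

lemma image_Ioi_add_div_sq {z : ℝ} (hz : 0 < z) :
    (fun l : ℝ => z + z / l ^ 2) '' Ioi 0 = Ioi z := by
  ext t
  constructor
  · rintro ⟨l, hl, rfl⟩
    have : 0 < l := hl
    have : 0 < z / l ^ 2 := by positivity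
    simpa using this
  · intro ht
    have ht' : 0 < t - z := sub_pos.2 ht
    refine ⟨√(z / (t - z)), sqrt_pos.2 (by positivity), ?_⟩
    simp only
    rw [sq_sqrt (by positivity)]
    field_simp
    ring

lemma expIntegralOne_eq_integral_Ioi {z : ℝ} (hz : 0 < z) :
    expIntegralOne z =
      ∫ l in Ioi (0 : ℝ), 2 * exp (-z) * (l⁻¹ * exp (-(z / l ^ 2)) * (1 + l ^ 2)⁻¹) := by
  have hderiv : ∀ l ∈ Ioi (0 : ℝ),
      HasDerivWithinAt (fun l : ℝ => z + z / l ^ 2) (-(2 * z / l ^ 3)) (Ioi 0) l := by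
    intro l hl
    have hl' : l ≠ 0 := (mem_Ioi.1 hl).ne'
    refine ((((hasDerivAt_const l z).div (hasDerivAt_pow 2 l)
      (pow_ne_zero 2 hl')).const_add z).congr_deriv ?_).hasDerivWithinAt
    field_simp
    norm_num
    ring
  have hinj : InjOn (fun l : ℝ => z + z / l ^ 2) (Ioi 0) := by
    intro a ha b hb hab
    have ha' : 0 < a := ha
    have hb' : 0 < b := hb
    have h : z / a ^ 2 = z / b ^ 2 := by simpa using hab
    field_simp at h
    nlinarith [sq_nonneg (a - b)]
  have := integral_image_eq_integral_abs_deriv_smul measurableSet_Ioi hderiv hinj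
    fun t => exp (-t) / t
  rw [image_Ioi_add_div_sq hz] at this
  rw [expIntegralOne, this]
  refine setIntegral_congr_fun measurableSet_Ioi fun l hl => ?_
  have hl' : 0 < l := hl
  simp only [smul_eq_mul]
  rw [abs_neg, abs_of_pos (by positivity), neg_add, exp_add]
  field_simp
  ring

lemma pHS_eq {τ x : ℝ} (hτ : 0 < τ) (hx : 0 < x) :
    pHS τ x = (√(2 * π))⁻¹ * τ⁻¹ * π⁻¹ *
      (exp (x ^ 2 / (2 * τ ^ 2)) * expIntegralOne (x ^ 2 / (2 * τ ^ 2))) := by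
  rw [expIntegralOne_eq_integral_Ioi (by positivity), ← integral_const_mul, ← integral_const_mul,
    pHS]
  refine setIntegral_congr_fun measurableSet_Ioi fun l hl => ?_
  have hl' : 0 < l := hl
  have h1 : -x ^ 2 / (2 * l ^ 2 * τ ^ 2) = -(x ^ 2 / (2 * τ ^ 2) / l ^ 2) := by field_simp
  simp only [h1, exp_neg (x ^ 2 / (2 * τ ^ 2))]
  field_simp

lemma hasDerivAt_sq_div {τ x : ℝ} :
    HasDerivAt (fun x : ℝ => x ^ 2 / (2 * τ ^ 2)) (x / τ ^ 2) x := by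
  refine ((hasDerivAt_pow 2 x).div_const _).congr_deriv ?_
  norm_num
  ring

lemma hasDerivAt_exp_mul_expIntegralOne {z : ℝ} (hz : 0 < z) :
    HasDerivAt (fun z => exp z * expIntegralOne z) (exp z * expIntegralOne z - z⁻¹) z := by
  refine ((Real.hasDerivAt_exp z).mul (hasDerivAt_expIntegralOne hz)).congr_deriv ?_
  rw [exp_neg]
  field_simp
  ring

lemma hasDerivAt_log_pHS {τ x : ℝ} (hτ : 0 < τ) (hx : 0 < x) :
    HasDerivAt (fun y => log (pHS τ y))
      (x / τ ^ 2 - 2 / x *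
        (exp (x ^ 2 / (2 * τ ^ 2)) * expIntegralOne (x ^ 2 / (2 * τ ^ 2)))⁻¹) x := by
  have hz : 0 < x ^ 2 / (2 * τ ^ 2) := by positivity
  have hF : 0 < exp (x ^ 2 / (2 * τ ^ 2)) * expIntegralOne (x ^ 2 / (2 * τ ^ 2)) :=
    mul_pos (exp_pos _) (expIntegralOne_pos hz)
  have hK : 0 < (√(2 * π))⁻¹ * τ⁻¹ * π⁻¹ := by positivity
  have hd := ((hasDerivAt_exp_mul_expIntegralOne hz).comp x hasDerivAt_sq_div).const_mul
    ((√(2 * π))⁻¹ * τ⁻¹ * π⁻¹)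
  have hlog := (hd.log (mul_pos hK hF).ne').congr_of_eventuallyEq
    (f₁ := fun y => log (pHS τ y)) (by
      filter_upwards [Ioi_mem_nhds hx] with y hy
      rw [pHS_eq hτ hy]
      rfl)
  refine hlog.congr_deriv ?_
  simp only [Function.comp_apply]
  rw [mul_div_mul_left _ _ hK.ne']
  generalize exp (x ^ 2 / (2 * τ ^ 2)) * expIntegralOne (x ^ 2 / (2 * τ ^ 2)) = F at hF
  field_simp

lemma deriv_deriv_log_pHS_pos {τ x : ℝ} (hτ : 0 < τ) (hx : 0 < x) :
    0 < deriv (deriv fun y => log (pHS τ y)) x := by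
  have hz : 0 < x ^ 2 / (2 * τ ^ 2) := by positivity
  have hF : 0 < exp (x ^ 2 / (2 * τ ^ 2)) * expIntegralOne (x ^ 2 / (2 * τ ^ 2)) :=
    mul_pos (exp_pos _) (expIntegralOne_pos hz)
  have hev : deriv (fun y => log (pHS τ y)) =ᶠ[𝓝 x] fun x => x / τ ^ 2 - 2 / x *
      (exp (x ^ 2 / (2 * τ ^ 2)) * expIntegralOne (x ^ 2 / (2 * τ ^ 2)))⁻¹ := by
    filter_upwards [Ioi_mem_nhds hx] with y hy
    exact (hasDerivAt_log_pHS hτ hy).deriv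
  have hF' := (hasDerivAt_exp_mul_expIntegralOne hz).comp x hasDerivAt_sq_div
  have hd := ((hasDerivAt_id x).div_const (τ ^ 2)).sub
    (((hasDerivAt_const x (2 : ℝ)).div (hasDerivAt_id x) hx.ne').mul (hF'.inv hF.ne'))
  have hval := hev.deriv_eq.trans hd.deriv
  rw [hval]
  have hquad := quadratic_exp_mul_expIntegralOne_pos hz
  simp only [Function.comp_apply, Pi.div_apply, Pi.inv_apply, id]
  generalize exp (x ^ 2 / (2 * τ ^ 2)) * expIntegralOne (x ^ 2 / (2 * τ ^ 2)) = F at hF hquad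
  have hpos : 0 < 2 / (x ^ 2 * F ^ 2) *
      (x ^ 2 / (2 * τ ^ 2) * F ^ 2 + (2 * (x ^ 2 / (2 * τ ^ 2)) + 1) * F - 2) := by positivity
  convert hpos using 1
  field_simp
  ring

/-- The horseshoe density is strictly log-convex on `(0,∞)`; equivalently the horseshoe
penalty `pen_HS = -log p_HS` is strictly concave there, with negative second derivative. -/
theorem horseshoe_strict_log_convex_penalty_concave (τ : ℝ) (hτ : 0 < τ) :
    StrictConvexOn ℝ (Ioi (0:ℝ)) (fun x => Real.log (pHS τ x)) ∧
    ∀ x : ℝ, 0 < x → deriv (deriv (fun y => -Real.log (pHS τ y))) x < 0 := by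
  constructor
  · exact strictConvexOn_of_deriv2_pos' (convex_Ioi 0)
      (fun x hx => (hasDerivAt_log_pHS hτ hx).continuousAt.continuousWithinAt)
      fun x hx => deriv_deriv_log_pHS_pos hτ hx
  · intro x hx
    have : deriv (fun y => -log (pHS τ y)) = fun y => -deriv (fun y => log (pHS τ y)) y :=
      funext fun y => deriv.fun_neg
    rw [this, deriv.fun_neg, neg_lt_zero]
    exact deriv_deriv_log_pHS_pos hτ hx
end

section
/- For every τ > 0, the horseshoe penalty is nondecreasing on (0,∞): its derivative pen'_HS(x) = −p'_HS(x)/p_HS(x) satisfies pen'_HS(x) > 0 for every x > 0. -/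
open MeasureTheory Real Set

/-- The integrand of `pHS`. -/
noncomputable def horseshoeIntegrand (τ y l : ℝ) : ℝ :=
  (Real.sqrt (2 * Real.pi))⁻¹ * (l * τ)⁻¹ * Real.exp (-y ^ 2 / (2 * l ^ 2 * τ ^ 2)) *
    ((2 / Real.pi) * (1 + l ^ 2)⁻¹)

lemma horseshoeIntegrand_pos {τ l : ℝ} (hτ : 0 < τ) (hl : 0 < l) (y : ℝ) :
    0 < horseshoeIntegrand τ y l := by
  unfold horseshoeIntegrand
  positivity

lemma measurable_horseshoeIntegrand (τ y : ℝ) : Measurable (horseshoeIntegrand τ y) := by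
  unfold horseshoeIntegrand
  fun_prop

lemma hasDerivAt_horseshoeIntegrand (τ y l : ℝ) :
    HasDerivAt (fun z => horseshoeIntegrand τ z l)
      (-(horseshoeIntegrand τ y l * (y / (l ^ 2 * τ ^ 2)))) y := by
  unfold horseshoeIntegrand
  have h : HasDerivAt (fun z : ℝ => -z ^ 2 / (2 * l ^ 2 * τ ^ 2))
      (-(2 * y) / (2 * l ^ 2 * τ ^ 2)) y := by
    simpa using ((hasDerivAt_pow 2 y).neg.div_const (2 * l ^ 2 * τ ^ 2))
  refine ((h.exp.const_mul _).mul_const _).congr_deriv ?_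
  have : -(2 * y) / (2 * l ^ 2 * τ ^ 2) = -(y / (l ^ 2 * τ ^ 2)) := by
    rw [mul_assoc 2, neg_div, mul_div_mul_left _ _ two_ne_zero]
  rw [this]
  ring

lemma mul_exp_neg_mul_sq_le {b : ℝ} (hb : 0 < b) {s : ℝ} :
    s * Real.exp (-(b * s ^ 2)) ≤ 1 + 1 / b := by
  have hu : 0 ≤ b * s ^ 2 := by positivity
  have h := Real.add_one_le_exp (b * s ^ 2)
  rw [Real.exp_neg, ← div_eq_mul_inv, div_le_iff₀ (Real.exp_pos _)]
  calc s ≤ (1 + 1 / b) * (b * s ^ 2 + 1) := by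
        have : (1 + 1 / b) * (b * s ^ 2 + 1) = b * s ^ 2 + 1 + s ^ 2 + 1 / b := by
          field_simp
          ring
        rw [this]
        have : 0 < 1 / b := by positivity
        nlinarith [sq_nonneg (s - 1)]
    _ ≤ _ := by gcongr

lemma cube_mul_exp_neg_mul_sq_le {b : ℝ} (hb : 0 < b) {s : ℝ} :
    s ^ 3 * Real.exp (-(b * s ^ 2)) ≤ 1 / b + 2 / b ^ 2 := by
  have hu : 0 ≤ b * s ^ 2 := by positivity
  have h := Real.quadratic_le_exp_of_nonneg hu
  rw [Real.exp_neg, ← div_eq_mul_inv, div_le_iff₀ (Real.exp_pos _)]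
  calc s ^ 3 ≤ (1 / b + 2 / b ^ 2) * (1 + b * s ^ 2 + (b * s ^ 2) ^ 2 / 2) := by
        have : (1 / b + 2 / b ^ 2) * (1 + b * s ^ 2 + (b * s ^ 2) ^ 2 / 2) =
            s ^ 2 + s ^ 4 + (1 / b + 2 / b ^ 2 + 2 * s ^ 2 / b + b * s ^ 4 / 2) := by
          field_simp
          ring
        rw [this]
        have : 0 ≤ 1 / b + 2 / b ^ 2 + 2 * s ^ 2 / b + b * s ^ 4 / 2 := by positivity
        nlinarith [sq_nonneg (s * (s - 1)), sq_nonneg s, sq_nonneg (s ^ 2)]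
    _ ≤ _ := by gcongr

/-- The Gaussian factor is controlled uniformly for `y` away from `0`. -/
lemma horseshoeIntegrand_le {τ c y l : ℝ} (hτ : 0 < τ) (hc : 0 < c) (hy : c ≤ y) (hl : 0 < l) :
    horseshoeIntegrand τ y l ≤ (Real.sqrt (2 * Real.pi))⁻¹ * τ⁻¹ * (2 / Real.pi) *
      (l⁻¹ * Real.exp (-(c ^ 2 / (2 * τ ^ 2) * l⁻¹ ^ 2))) * (1 + l ^ 2)⁻¹ := by
  have h : Real.exp (-y ^ 2 / (2 * l ^ 2 * τ ^ 2)) ≤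
      Real.exp (-(c ^ 2 / (2 * τ ^ 2) * l⁻¹ ^ 2)) := by
    have : -y ^ 2 / (2 * l ^ 2 * τ ^ 2) = -(y ^ 2 / (2 * τ ^ 2) * l⁻¹ ^ 2) := by
      field_simp
    rw [this]
    gcongr
  calc horseshoeIntegrand τ y l = (Real.sqrt (2 * Real.pi))⁻¹ * τ⁻¹ * (2 / Real.pi) *
        (l⁻¹ * Real.exp (-y ^ 2 / (2 * l ^ 2 * τ ^ 2))) * (1 + l ^ 2)⁻¹ := by
        unfold horseshoeIntegrand
        rw [mul_inv]
        ring
    _ ≤ _ := by gcongr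

lemma integrableOn_horseshoeIntegrand {τ y : ℝ} (hτ : 0 < τ) (hy : 0 < y) :
    IntegrableOn (horseshoeIntegrand τ y) (Ioi 0) := by
  refine Integrable.mono'
    ((integrable_inv_one_add_sq.const_mul ((Real.sqrt (2 * Real.pi))⁻¹ * τ⁻¹ * (2 / Real.pi) *
      (1 + 1 / (y ^ 2 / (2 * τ ^ 2))))).integrableOn)
    (measurable_horseshoeIntegrand τ y).aestronglyMeasurable ?_
  filter_upwards [ae_restrict_mem measurableSet_Ioi] with l hl
  rw [Real.norm_of_nonneg (horseshoeIntegrand_pos hτ hl y).le]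
  refine (horseshoeIntegrand_le hτ hy le_rfl hl).trans ?_
  gcongr
  exact mul_exp_neg_mul_sq_le (by positivity)

lemma hasDerivAt_pHS {τ x : ℝ} (hτ : 0 < τ) (hx : 0 < x) :
    IntegrableOn (fun l => -(horseshoeIntegrand τ x l * (x / (l ^ 2 * τ ^ 2)))) (Ioi 0) ∧
    HasDerivAt (pHS τ)
      (∫ l in Ioi (0:ℝ), -(horseshoeIntegrand τ x l * (x / (l ^ 2 * τ ^ 2)))) x := by
  set b := (x / 2) ^ 2 / (2 * τ ^ 2) with hb
  have hb_pos : 0 < b := by positivity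
  refine hasDerivAt_integral_of_dominated_loc_of_deriv_le (s := Ioo (x / 2) (2 * x))
    (F := horseshoeIntegrand τ)
    (F' := fun y l => -(horseshoeIntegrand τ y l * (y / (l ^ 2 * τ ^ 2))))
    (bound := fun l => (Real.sqrt (2 * Real.pi))⁻¹ * τ⁻¹ * (2 / Real.pi) * (2 * x / τ ^ 2) *
      (1 / b + 2 / b ^ 2) * (1 + l ^ 2)⁻¹)
    (Ioo_mem_nhds (by linarith) (by linarith))
    (Filter.Eventually.of_forall fun y => (measurable_horseshoeIntegrand τ y).aestronglyMeasurable)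
    (integrableOn_horseshoeIntegrand hτ hx) ?_ ?_
    (integrable_inv_one_add_sq.const_mul _).integrableOn
    (Filter.Eventually.of_forall fun l y _ => hasDerivAt_horseshoeIntegrand τ y l)
  · have := measurable_horseshoeIntegrand τ x
    exact Measurable.aestronglyMeasurable (by fun_prop)
  · filter_upwards [ae_restrict_mem measurableSet_Ioi] with l hl y hy
    have hl : 0 < l := hl
    have hy_pos : 0 < y := lt_trans (by positivity) hy.1
    have hf := horseshoeIntegrand_pos hτ hl y
    rw [norm_neg, Real.norm_of_nonneg (by positivity)]
    calc horseshoeIntegrand τ y l * (y / (l ^ 2 * τ ^ 2))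
        ≤ ((Real.sqrt (2 * Real.pi))⁻¹ * τ⁻¹ * (2 / Real.pi) *
          (l⁻¹ * Real.exp (-(b * l⁻¹ ^ 2))) * (1 + l ^ 2)⁻¹) * (2 * x / (l ^ 2 * τ ^ 2)) := by
          gcongr
          · exact horseshoeIntegrand_le hτ (by positivity) hy.1.le hl
          · exact hy.2.le
      _ = (Real.sqrt (2 * Real.pi))⁻¹ * τ⁻¹ * (2 / Real.pi) * (2 * x / τ ^ 2) *
          (l⁻¹ ^ 3 * Real.exp (-(b * l⁻¹ ^ 2))) * (1 + l ^ 2)⁻¹ := by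
          rw [div_eq_mul_inv (2 * x) (l ^ 2 * τ ^ 2), mul_inv]
          ring
      _ ≤ _ := by
          gcongr
          exact cube_mul_exp_neg_mul_sq_le hb_pos

lemma setIntegral_Ioi_pos {f : ℝ → ℝ} {a : ℝ} (hf : IntegrableOn f (Ioi a))
    (hpos : ∀ l ∈ Ioi a, 0 < f l) : 0 < ∫ l in Ioi a, f l := by
  rw [setIntegral_pos_iff_support_of_nonneg_ae _ hf]
  · have : Function.support f ∩ Ioi a = Ioi a :=
      inter_eq_right.2 fun l hl => (hpos l hl).ne'
    simp [this]
  · filter_upwards [ae_restrict_mem measurableSet_Ioi] with l hl using (hpos l hl).le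

/-- The horseshoe penalty is nondecreasing on `(0,∞)`: its derivative
`pen'_HS(x) = -p'_HS(x)/p_HS(x)` is positive for every `x > 0`. -/
theorem horseshoe_penalty_deriv_pos (τ : ℝ) (hτ : 0 < τ) (x : ℝ) (hx : 0 < x) :
    deriv (fun y => -Real.log (pHS τ y)) x = -(deriv (pHS τ) x) / pHS τ x ∧
    0 < deriv (fun y => -Real.log (pHS τ y)) x := by
  obtain ⟨hint, hderiv⟩ := hasDerivAt_pHS hτ hx
  have hp : 0 < pHS τ x := setIntegral_Ioi_pos (integrableOn_horseshoeIntegrand hτ hx)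
    fun l hl => horseshoeIntegrand_pos hτ hl x
  have hneg : 0 < -deriv (pHS τ) x := by
    rw [hderiv.deriv, ← integral_neg]
    refine setIntegral_Ioi_pos hint.neg fun l hl => ?_
    have hl : 0 < l := hl
    have := horseshoeIntegrand_pos hτ hl x
    rw [neg_neg]
    positivity
  have h : deriv (fun y => -Real.log (pHS τ y)) x = -(deriv (pHS τ) x) / pHS τ x := by
    rw [(hderiv.log hp.ne').fun_neg.deriv, hderiv.deriv, neg_div]
  exact ⟨h, h ▸ div_pos hneg hp⟩
end

section
/- For every τ > 0, the derivative of the horseshoe penalty, pen'_HS(x) = −p'_HS(x)/p_HS(x), is completely monotone on (0,∞): for every natural number k and every x > 0, (−1)^k (pen'_HS)^{(k)}(x) ≥ 0. Consequently pen_HS is a Bernstein function on (0,∞). -/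
open MeasureTheory Real Set

namespace Horseshoe
open scoped Nat

/-- The exponential generating function `∑ bₖ tᵏ / k!`. -/
noncomputable def expSeries (b : ℕ → ℝ) (t : ℝ) : ℝ := ∑' k, b k * t ^ k / k !

/-- The exponential generating function of `b` converges absolutely everywhere. -/
def EntireCoeff (b : ℕ → ℝ) : Prop := ∀ r : ℝ, 0 ≤ r → Summable fun k => |b k| * r ^ k / k !

/-- The coefficients of the antiderivative of `expSeries b` vanishing at `0`. -/
def shiftRight (b : ℕ → ℝ) : ℕ → ℝ
  | 0 => 0
  | k + 1 => b k

theorem EntireCoeff.summable_norm {b : ℕ → ℝ} (hb : EntireCoeff b) (t : ℝ) :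
    Summable fun k => ‖b k * t ^ k / (k ! : ℝ)‖ := by
  refine (hb (|t|) (abs_nonneg t)).congr fun k => ?_
  rw [norm_div, norm_mul, norm_pow]
  simp [Real.norm_eq_abs]

theorem EntireCoeff.summable {b : ℕ → ℝ} (hb : EntireCoeff b) (t : ℝ) :
    Summable fun k => b k * t ^ k / k ! := (hb.summable_norm t).of_norm

theorem EntireCoeff.shiftLeft {b : ℕ → ℝ} (hb : EntireCoeff b) :
    EntireCoeff fun k => b (k + 1) := by
  intro r hr
  have h := (summable_nat_add_iff 1).2 (hb (2 * (r + 1)) (by positivity))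
  refine Summable.of_nonneg_of_le (fun k => by positivity) (fun k => ?_) h
  rw [Nat.factorial_succ, div_le_div_iff₀ (by positivity) (by positivity)]
  have h1 : ((k + 1 : ℕ) : ℝ) ≤ 2 ^ (k + 1) := by exact_mod_cast Nat.lt_two_pow_self.le
  have h2 : r ^ k ≤ (r + 1) ^ (k + 1) := by
    calc r ^ k ≤ (r + 1) ^ k := by gcongr; linarith
      _ ≤ (r + 1) ^ (k + 1) := pow_le_pow_right₀ (by linarith) (by lia)
  push_cast at h1 ⊢
  calc |b (k + 1)| * r ^ k * (((k : ℝ) + 1) * k !)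
      = |b (k + 1)| * ((((k : ℝ) + 1) * r ^ k) * k !) := by ring
    _ ≤ |b (k + 1)| * ((2 ^ (k + 1) * (r + 1) ^ (k + 1)) * k !) := by gcongr
    _ = |b (k + 1)| * (2 * (r + 1)) ^ (k + 1) * k ! := by rw [mul_pow]; ring

theorem entireCoeff_succ_mul {b : ℕ → ℝ} (hb : EntireCoeff b) :
    EntireCoeff fun k => k * shiftRight b k := by
  intro r hr
  rw [← summable_nat_add_iff 1]
  refine ((hb r hr).mul_left r).congr fun k => ?_
  simp only [shiftRight, Nat.factorial_succ]
  push_cast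
  rw [abs_mul, abs_of_nonneg (by positivity : (0 : ℝ) ≤ (k : ℝ) + 1)]
  field_simp
  ring

theorem EntireCoeff.shiftRight {b : ℕ → ℝ} (hb : EntireCoeff b) :
    EntireCoeff (shiftRight b) := by
  intro r hr
  refine Summable.of_nonneg_of_le (fun k => by positivity) (fun k => ?_)
    (entireCoeff_succ_mul hb r hr)
  cases k with
  | zero => simp [Horseshoe.shiftRight]
  | succ k =>
    refine div_le_div_of_nonneg_right (mul_le_mul_of_nonneg_right ?_ (by positivity))
      (by positivity)
    rw [abs_mul, Nat.abs_cast]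
    have : (1 : ℝ) ≤ ((k + 1 : ℕ) : ℝ) := by push_cast; linarith [(k.cast_nonneg : (0 : ℝ) ≤ k)]
    exact le_mul_of_one_le_left (abs_nonneg _) this

theorem mul_expSeries {b : ℕ → ℝ} (hb : EntireCoeff b) (t : ℝ) :
    expSeries (fun k => k * shiftRight b k) t = t * expSeries b t := by
  unfold expSeries
  rw [((entireCoeff_succ_mul hb).summable t).tsum_eq_zero_add, ← tsum_mul_left]
  simp only [shiftRight, Nat.factorial_succ]
  simp only [Nat.cast_zero, zero_mul, zero_div, zero_add]
  refine tsum_congr fun k => ?_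
  push_cast
  field_simp
  ring

theorem hasDerivAt_expSeries {b : ℕ → ℝ} (hb : EntireCoeff b) (t : ℝ) :
    HasDerivAt (expSeries b) (expSeries (fun k => b (k + 1)) t) t := by
  have hder : ∀ k : ℕ, ∀ y : ℝ, HasDerivAt (fun y => b (k + 1) * y ^ (k + 1) / (k + 1)!)
      (b (k + 1) * y ^ k / k !) y := by
    intro k y
    convert! (((hasDerivAt_pow (k + 1) y).const_mul (b (k + 1))).div_const ((k + 1)! : ℝ)) using 1
    rw [Nat.factorial_succ]
    push_cast
    field_simp
  have hsplit : expSeries b = fun y => b 0 + ∑' k, b (k + 1) * y ^ (k + 1) / (k + 1)! := by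
    funext y
    unfold expSeries
    rw [(hb.summable y).tsum_eq_zero_add]
    simp
  rw [hsplit]
  refine HasDerivAt.const_add _ ?_
  have habs : 0 ≤ |t| + 1 := by positivity
  refine hasDerivAt_tsum_of_isPreconnected (t := Metric.ball 0 (|t| + 1))
    (hb.shiftLeft (|t| + 1) habs) Metric.isOpen_ball
    (convex_ball _ _).isPreconnected (fun k y _ => hder k y) (fun k y hy => ?_)
    (y₀ := t) (by simp) ((summable_nat_add_iff 1).2 (hb.summable t)) (by simp)
  have hy' : |y| ≤ |t| + 1 := by simpa using (mem_ball_zero_iff.1 hy).le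
  rw [norm_div, norm_mul, norm_pow, Real.norm_eq_abs, Real.norm_eq_abs, Real.norm_eq_abs,
    Nat.abs_cast]
  gcongr

theorem continuous_expSeries {b : ℕ → ℝ} (hb : EntireCoeff b) : Continuous (expSeries b) :=
  continuous_iff_continuousAt.2 fun t => (hasDerivAt_expSeries hb t).continuousAt

theorem expSeries_zero (b : ℕ → ℝ) : expSeries b 0 = b 0 := by
  unfold expSeries
  rw [tsum_eq_single 0 (fun k hk => by simp [hk])]
  simp

theorem integral_pow_mul_sub_pow (i j : ℕ) (t : ℝ) :
    ∫ s in (0 : ℝ)..t, s ^ i / i ! * ((t - s) ^ j / j !) = t ^ (i + j + 1) / (i + j + 1)! := by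
  have hpow : ∀ (n : ℕ) (y : ℝ),
      HasDerivAt (fun s : ℝ => s ^ (n + 1) / (n + 1)!) (y ^ n / n !) y := by
    intro n y
    convert! (hasDerivAt_pow (n + 1) y).div_const ((n + 1)! : ℝ) using 1
    rw [Nat.factorial_succ]
    push_cast
    field_simp
  have hsub : ∀ (n : ℕ) (y : ℝ),
      HasDerivAt (fun s : ℝ => -((t - s) ^ (n + 1) / (n + 1)!)) ((t - y) ^ n / n !) y := by
    intro n y
    have h := ((hpow n (t - y)).comp y ((hasDerivAt_id y).const_sub t)).neg
    convert! h using 1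
    simp
  induction i generalizing j with
  | zero =>
    have := intervalIntegral.integral_eq_sub_of_hasDerivAt (fun y _ => hsub j y)
      (Continuous.intervalIntegrable (by fun_prop) 0 t)
    simp only [pow_zero, Nat.factorial_zero, Nat.cast_one, div_one, one_mul, zero_add, this]
    simp
  | succ i ih =>
    have := intervalIntegral.integral_mul_deriv_eq_deriv_mul (a := 0) (b := t)
      (fun y _ => hpow i y) (fun y _ => hsub j y)
      (Continuous.intervalIntegrable (by fun_prop) 0 t)
      (Continuous.intervalIntegrable (by fun_prop) 0 t)
    rw [this]
    simp only [mul_neg, intervalIntegral.integral_neg, ih (j + 1)]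
    simp
    congr 1
    · ring
    · congr 2; ring

theorem integral_expSeries_mul_sub {b c : ℕ → ℝ} (hb : EntireCoeff b) (hc : EntireCoeff c)
    {t : ℝ} (ht : 0 ≤ t) :
    HasSum (fun n => (∑ p ∈ Finset.HasAntidiagonal.antidiagonal n,
      b p.1 * c p.2) * t ^ (n + 1) / (n + 1)!)
      (∫ s in (0 : ℝ)..t, expSeries b s * expSeries c (t - s)) := by
  have hprod : ∀ s, expSeries b s * expSeries c (t - s) =
      ∑' n, ∑ p ∈ Finset.HasAntidiagonal.antidiagonal n,
        (b p.1 * s ^ p.1 / p.1 !) * (c p.2 * (t - s) ^ p.2 / p.2 !) := fun s =>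
    tsum_mul_tsum_eq_tsum_sum_antidiagonal_of_summable_norm (hb.summable_norm s)
      (hc.summable_norm (t - s))
  have hbound := summable_norm_sum_mul_antidiagonal_of_summable_norm
    (f := fun k => |b k| * t ^ k / k !)
    (g := fun k => |c k| * t ^ k / k !) (hb t ht).norm (hc t ht).norm
  have hmain := intervalIntegral.hasSum_integral_of_dominated_convergence (μ := volume)
    (a := (0 : ℝ)) (b := t)
    (F := fun n s => ∑ p ∈ Finset.HasAntidiagonal.antidiagonal n,
        (b p.1 * s ^ p.1 / p.1 !) * (c p.2 * (t - s) ^ p.2 / p.2 !))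
    (f := fun s => expSeries b s * expSeries c (t - s))
    (fun n _ => ‖∑ p ∈ Finset.HasAntidiagonal.antidiagonal n,
      (|b p.1| * t ^ p.1 / p.1 !) * (|c p.2| * t ^ p.2 / p.2 !)‖)
    (fun n => (Continuous.aestronglyMeasurable (by fun_prop)))
    (fun n => Filter.Eventually.of_forall fun s hs => ?_)
    (Filter.Eventually.of_forall fun s _ => hbound)
    intervalIntegrable_const
    (Filter.Eventually.of_forall fun s _ => ?_)
  · refine hmain.congr_fun fun n => ?_
    rw [intervalIntegral.integral_finsetSum
      fun p _ => Continuous.intervalIntegrable (by fun_prop) 0 t, Finset.sum_mul, Finset.sum_div]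
    refine Finset.sum_congr rfl fun p hp => ?_
    have hpn : p.1 + p.2 = n := Finset.HasAntidiagonal.mem_antidiagonal.1 hp
    rw [← hpn, mul_div_assoc, ← integral_pow_mul_sub_pow, ← intervalIntegral.integral_const_mul]
    refine intervalIntegral.integral_congr fun s _ => ?_
    ring
  · rw [uIoc_of_le ht] at hs
    refine (norm_sum_le _ _).trans ((Finset.sum_le_sum fun p _ => ?_).trans (le_abs_self _))
    rw [norm_mul, norm_div, norm_mul, norm_pow, norm_div, norm_mul, norm_pow]
    simp only [Real.norm_eq_abs, Nat.abs_cast]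
    have h1 : |s| ≤ t := by rw [abs_of_pos hs.1]; exact hs.2
    have h2 : |t - s| ≤ t := by rw [abs_of_nonneg (by linarith [hs.2])]; linarith [hs.1]
    gcongr
  · rw [hprod s]
    refine Summable.hasSum (Summable.of_norm ?_)
    exact summable_norm_sum_mul_antidiagonal_of_summable_norm
      (f := fun k => b k * s ^ k / k !) (g := fun k => c k * (t - s) ^ k / k !)
      (hb.summable_norm s) (hc.summable_norm (t - s))

/-- The absolute values of the Taylor coefficients of the memory kernel. -/
def kernelCoeff : ℕ → ℕ
  | 0 => 2
  | n + 1 => 4 * n * kernelCoeff n + 2 * ∑ i : Fin (n + 1), kernelCoeff i * kernelCoeff (n - i)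

theorem kernelCoeff_zero : kernelCoeff 0 = 2 := by rw [kernelCoeff]

theorem kernelCoeff_succ (n : ℕ) : kernelCoeff (n + 1) =
    4 * n * kernelCoeff n + 2 * ∑ i ∈ Finset.range (n + 1), kernelCoeff i *
      kernelCoeff (n - i) := by
  rw [kernelCoeff, Finset.sum_range]

theorem kernelCoeff_le (n : ℕ) : kernelCoeff n ≤ 2 * 8 ^ n * n ! := by
  induction n using Nat.strong_induction_on with
  | _ n ih =>
    cases n with
    | zero => simp [kernelCoeff_zero]
    | succ n =>
      have hterm : ∀ i ∈ Finset.range (n + 1),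
          kernelCoeff i * kernelCoeff (n - i) ≤ 4 * 8 ^ n * n ! := by
        intro i hi
        have hin : i ≤ n := Nat.lt_succ_iff.1 (Finset.mem_range.1 hi)
        calc kernelCoeff i * kernelCoeff (n - i)
            ≤ (2 * 8 ^ i * i !) * (2 * 8 ^ (n - i) * (n - i)!) :=
              Nat.mul_le_mul (ih i (by lia)) (ih (n - i) (by lia))
          _ = 4 * 8 ^ (i + (n - i)) * (i ! * (n - i)!) := by rw [pow_add]; ring
          _ ≤ 4 * 8 ^ n * n ! := by
              rw [Nat.add_sub_cancel' hin]
              exact Nat.mul_le_mul le_rfl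
                (Nat.le_of_dvd n.factorial_pos (Nat.factorial_mul_factorial_dvd_factorial hin))
      have hsum := Finset.sum_le_card_nsmul _ _ _ hterm
      rw [Finset.card_range, smul_eq_mul] at hsum
      rw [kernelCoeff_succ, Nat.factorial_succ]
      have hn := ih n (by lia)
      calc _ ≤ 4 * n * (2 * 8 ^ n * n !) + 2 * ((n + 1) * (4 * 8 ^ n * n !)) := by gcongr
        _ ≤ 4 * (n + 1) * (2 * 8 ^ n * n !) + 2 * ((n + 1) * (4 * 8 ^ n * n !)) := by gcongr; lia
        _ = 2 * 8 ^ (n + 1) * ((n + 1) * n !) := by ring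

/-- The Taylor coefficients (times factorials) of the memory kernel. -/
noncomputable def kernelTaylor (k : ℕ) : ℝ :=
  if Even k then (-1) ^ (k / 2) * kernelCoeff (k / 2) else 0

theorem kernelTaylor_two_mul (n : ℕ) : kernelTaylor (2 * n) = (-1) ^ n * kernelCoeff n := by
  simp [kernelTaylor]

theorem kernelTaylor_two_mul_add_one (n : ℕ) : kernelTaylor (2 * n + 1) = 0 := by
  simp [kernelTaylor]

theorem sum_range_two_mul_add_one {f : ℕ → ℝ} (hf : ∀ i, f (2 * i + 1) = 0) (n : ℕ) :
    ∑ i ∈ Finset.range (2 * n + 1), f i = ∑ i ∈ Finset.range (n + 1), f (2 * i) := by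
  induction n with
  | zero => simp
  | succ n ih =>
    rw [Finset.sum_range_succ _ (n + 1), ← ih, show 2 * (n + 1) + 1 = (2 * n + 1) + 1 + 1 by ring,
      Finset.sum_range_succ, Finset.sum_range_succ, hf, add_zero]
    rfl

theorem kernelTaylor_add_two (k : ℕ) : kernelTaylor (k + 2) = -(2 * k) * kernelTaylor k -
    2 * ∑ p ∈ Finset.HasAntidiagonal.antidiagonal k, kernelTaylor p.1 * kernelTaylor p.2 := by
  rcases Nat.even_or_odd' k with ⟨n, rfl | rfl⟩
  · rw [Finset.Nat.sum_antidiagonal_eq_sum_range_succ (fun i j => kernelTaylor i * kernelTaylor j),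
      sum_range_two_mul_add_one (fun i => by rw [kernelTaylor_two_mul_add_one, zero_mul]),
      show 2 * n + 2 = 2 * (n + 1) by ring, kernelTaylor_two_mul, kernelTaylor_two_mul,
      kernelCoeff_succ]
    have hsum : ∑ i ∈ Finset.range (n + 1), kernelTaylor (2 * i) * kernelTaylor (2 * n - 2 * i) =
        (-1) ^ n * ∑ i ∈ Finset.range (n + 1), (kernelCoeff i : ℝ) * kernelCoeff (n - i) := by
      rw [Finset.mul_sum]
      refine Finset.sum_congr rfl fun i hi => ?_
      have hin : i ≤ n := Nat.lt_succ_iff.1 (Finset.mem_range.1 hi)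
      rw [← Nat.mul_sub, kernelTaylor_two_mul, kernelTaylor_two_mul]
      nth_rewrite 3 [← Nat.add_sub_cancel' hin]
      rw [pow_add]
      ring
    rw [hsum]
    push_cast
    ring
  · rw [show 2 * n + 1 + 2 = 2 * (n + 1) + 1 by ring, kernelTaylor_two_mul_add_one,
      kernelTaylor_two_mul_add_one, Finset.sum_eq_zero]
    · simp
    · intro p hp
      have hpn : p.1 + p.2 = 2 * n + 1 := Finset.HasAntidiagonal.mem_antidiagonal.1 hp
      rcases Nat.even_or_odd' p.1 with ⟨i, hi | hi⟩
      · rw [show p.2 = 2 * (n - i) + 1 by lia, kernelTaylor_two_mul_add_one, mul_zero]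
      · rw [hi, kernelTaylor_two_mul_add_one, zero_mul]

/-- The growth rate `8ⁿ n! / (2n)!` of the Taylor coefficients of the memory kernel. -/
noncomputable def kernelBound (n : ℕ) : ℝ := 8 ^ n * n ! / (2 * n)!

theorem kernelBound_pos (n : ℕ) : 0 < kernelBound n := by unfold kernelBound; positivity

theorem kernelBound_succ (n : ℕ) : kernelBound (n + 1) = kernelBound n * (4 / (2 * n + 1)) := by
  unfold kernelBound
  rw [show 2 * (n + 1) = 2 * n + 1 + 1 by ring]
  simp only [Nat.factorial_succ]
  push_cast
  field_simp
  ring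

theorem kernelBound_add_le (N n : ℕ) :
    kernelBound (N + n) ≤ kernelBound N * (4 / (2 * N + 1)) ^ n := by
  induction n with
  | zero => simp
  | succ n ih =>
    rw [← add_assoc, kernelBound_succ, pow_succ, ← mul_assoc]
    refine mul_le_mul ih ?_ (by positivity) (by have := kernelBound_pos N; positivity)
    gcongr
    lia

theorem summable_kernelBound (w : ℝ) (hw : 0 ≤ w) : Summable fun n => kernelBound n * w ^ n := by
  obtain ⟨N, hN⟩ := exists_nat_gt (4 * w)
  rw [← summable_nat_add_iff N]
  have hr : 4 / (2 * (N : ℝ) + 1) * w < 1 := by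
    rw [div_mul_eq_mul_div, div_lt_one (by positivity)]
    linarith [(N.cast_nonneg : (0 : ℝ) ≤ N)]
  refine Summable.of_nonneg_of_le (fun n => by have := kernelBound_pos (n + N); positivity)
    (fun n => ?_)
    ((summable_geometric_of_lt_one (by positivity) hr).mul_left (kernelBound N * w ^ N))
  rw [add_comm n N, mul_pow, pow_add]
  calc kernelBound (N + n) * (w ^ N * w ^ n)
      ≤ (kernelBound N * (4 / (2 * N + 1)) ^ n) * (w ^ N * w ^ n) := by
        gcongr; exact kernelBound_add_le N n
    _ = _ := by ring

theorem abs_kernelCoeff_term_le (n : ℕ) (w : ℝ) (hw : 0 ≤ w) :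
    |(-1) ^ n * (kernelCoeff n : ℝ) * w ^ n / (2 * n)!| ≤ 2 * (kernelBound n * w ^ n) := by
  rw [abs_div, abs_mul, abs_mul, abs_pow, abs_neg, abs_one, one_pow, one_mul, Nat.abs_cast,
    Nat.abs_cast, abs_of_nonneg (pow_nonneg hw n)]
  have h : (kernelCoeff n : ℝ) ≤ 2 * 8 ^ n * n ! := by exact_mod_cast kernelCoeff_le n
  calc (kernelCoeff n : ℝ) * w ^ n / (2 * n)! ≤ (2 * 8 ^ n * n !) * w ^ n / (2 * n)! := by gcongr
    _ = _ := by unfold kernelBound; ring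

theorem entireCoeff_kernelTaylor : EntireCoeff kernelTaylor := by
  intro r hr
  have hinj : Function.Injective fun n : ℕ => 2 * n := fun a b h => by simpa using h
  rw [← hinj.summable_iff]
  · refine Summable.of_nonneg_of_le (fun n => by simp only [Function.comp]; positivity)
      (fun n => ?_) ((summable_kernelBound (r ^ 2) (by positivity)).mul_left 2)
    refine le_trans (le_of_eq ?_) (abs_kernelCoeff_term_le n (r ^ 2) (by positivity))
    simp only [Function.comp, kernelTaylor_two_mul]
    rw [abs_div, abs_mul _ ((r ^ 2) ^ n), Nat.abs_cast, ← pow_mul, abs_of_nonneg (pow_nonneg hr _)]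
  · intro k hk
    have : ¬ Even k := fun ⟨n, hn⟩ => hk ⟨n, by simp only; lia⟩
    simp [kernelTaylor, this]

/-- The function whose Laplace transform is the logarithmic derivative of the horseshoe density
(up to scaling). -/
noncomputable def memoryKernel : ℝ → ℝ := expSeries kernelTaylor

theorem hasSum_memoryKernel (t : ℝ) :
    HasSum (fun n => (-1) ^ n * (kernelCoeff n : ℝ) * (t ^ 2) ^ n / (2 * n)!) (memoryKernel t) := by
  have hinj : Function.Injective fun n : ℕ => 2 * n := fun a b h => by simpa using h
  have h := (entireCoeff_kernelTaylor.summable t).hasSum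
  rw [← hinj.hasSum_iff] at h
  · refine h.congr_fun fun n => ?_
    simp only [Function.comp, kernelTaylor_two_mul, pow_mul]
  · intro k hk
    have : ¬ Even k := fun ⟨n, hn⟩ => hk ⟨n, by simp only; lia⟩
    simp [kernelTaylor, this]

/-- The antiderivative of the memory kernel. -/
noncomputable def memoryPrimitive : ℝ → ℝ := expSeries (shiftRight kernelTaylor)

theorem hasDerivAt_memoryPrimitive (t : ℝ) : HasDerivAt memoryPrimitive (memoryKernel t) t :=
  hasDerivAt_expSeries entireCoeff_kernelTaylor.shiftRight t

theorem memoryPrimitive_zero : memoryPrimitive 0 = 0 := expSeries_zero _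

theorem memoryKernel_zero : memoryKernel 0 = 2 := by
  rw [memoryKernel, expSeries_zero]
  simp [kernelTaylor, kernelCoeff_zero]

theorem continuous_memoryKernel : Continuous memoryKernel :=
  continuous_expSeries entireCoeff_kernelTaylor

theorem continuous_memoryPrimitive : Continuous memoryPrimitive :=
  continuous_expSeries entireCoeff_kernelTaylor.shiftRight

theorem memoryPrimitive_eq_integral (t : ℝ) :
    memoryPrimitive t = ∫ s in (0 : ℝ)..t, memoryKernel s := by
  rw [intervalIntegral.integral_eq_sub_of_hasDerivAt (fun s _ => hasDerivAt_memoryPrimitive s)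
    (continuous_memoryKernel.intervalIntegrable _ _), memoryPrimitive_zero, sub_zero]

theorem hasDerivAt_memoryKernel {t : ℝ} (ht : 0 ≤ t) : HasDerivAt memoryKernel
    (2 * (memoryPrimitive t - t * memoryKernel t -
      ∫ s in (0 : ℝ)..t, memoryKernel s * memoryKernel (t - s))) t := by
  have hb := entireCoeff_kernelTaylor
  refine (hasDerivAt_expSeries hb t).congr_deriv ?_
  have hconv := integral_expSeries_mul_sub hb hb ht
  have hprim := (summable_nat_add_iff 1).2 (hb.shiftRight.summable t)
  have hmul := (summable_nat_add_iff 1).2 ((entireCoeff_succ_mul hb).summable t)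
  unfold memoryKernel memoryPrimitive
  rw [← hconv.tsum_eq, ← mul_expSeries hb, expSeries, expSeries, expSeries,
    (hb.shiftLeft.summable t).tsum_eq_zero_add, (hb.shiftRight.summable t).tsum_eq_zero_add,
    ((entireCoeff_succ_mul hb).summable t).tsum_eq_zero_add]
  simp only [shiftRight] at hprim hmul
  have h1 : kernelTaylor 1 = 0 := kernelTaylor_two_mul_add_one 0
  simp only [zero_add, h1, zero_mul, zero_div, shiftRight, Nat.cast_zero]
  rw [← hprim.tsum_sub hmul, ← (hprim.sub hmul).tsum_sub hconv.summable, ← tsum_mul_left]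
  refine tsum_congr fun k => ?_
  rw [kernelTaylor_add_two]
  push_cast
  ring

/-- The Taylor polynomial of the memory kernel, in the variable `w = t ^ 2`. -/
noncomputable def kernelPoly (w : ℝ) : ℝ :=
  2 - 4 * w ^ 1 + 4 * w ^ 2 - 104 / 45 * w ^ 3 + 284 / 315 * w ^ 4 - 3688 / 14175 * w ^ 5 +
    3064 / 51975 * w ^ 6 - 465488 / 42567525 * w ^ 7 + 156196 / 91216125 * w ^ 8 - 905384 /
    3907698795 * w ^ 9 + 85330408 / 3093594879375 * w ^ 10 - 6283903312 / 2143861251406875 * w ^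
    11 + 8321698328 / 29585285269414875 * w ^ 12 - 1183094790608 / 48076088562799171875 * w ^ 13
    + 260544064432 / 131686677367667296875 * w ^ 14 - 34215018009248 / 232504448305325524453125
    * w ^ 15 + 1247804579315452 / 122529844256906551386796875 * w ^ 16 - 45293590198788968 /
    68739242628124575327993046875 * w ^ 17

theorem kernelPoly_eq_sum_of_recurrence {e : ℕ → ℕ} (h0 : e 0 = 2)
    (hs : ∀ n, e (n + 1) = 4 * n * e n + 2 * ∑ i ∈ Finset.range (n + 1), e i * e (n - i)) (w : ℝ) :
    kernelPoly w = ∑ n ∈ Finset.range 18, (-1) ^ n * (e n : ℝ) * w ^ n / (2 * n)! := by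
  have h1 : e 1 = 8 := by
    rw [hs]; simp [h0]
  have h2 : e 2 = 96 := by
    rw [hs]; simp [Finset.sum_range_succ, h1, h0]
  have h3 : e 3 = 1664 := by
    rw [hs]; simp [Finset.sum_range_succ, h2, h1, h0]
  have h4 : e 4 = 36352 := by
    rw [hs]; simp [Finset.sum_range_succ, h3, h2, h1, h0]
  have h5 : e 5 = 944128 := by
    rw [hs]; simp [Finset.sum_range_succ, h4, h3, h2, h1, h0]
  have h6 : e 6 = 28237824 := by
    rw [hs]; simp [Finset.sum_range_succ, h5, h4, h3, h2, h1, h0]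
  have h7 : e 7 = 953319424 := by
    rw [hs]; simp [Finset.sum_range_succ, h6, h5, h4, h3, h2, h1, h0]
  have h8 : e 8 = 35827613696 := by
    rw [hs]; simp [Finset.sum_range_succ, h7, h6, h5, h4, h3, h2, h1, h0]
  have h9 : e 9 = 1483381145600 := by
    rw [hs]; simp [Finset.sum_range_succ, h8, h7, h6, h5, h4, h3, h2, h1, h0]
  have h10 : e 10 = 67106563424256 := by
    rw [hs]; simp [Finset.sum_range_succ, h9, h8, h7, h6, h5, h4, h3, h2, h1, h0]
  have h11 : e 11 = 3294575099641856 := by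
    rw [hs]; simp [Finset.sum_range_succ, h10, h9, h8, h7, h6, h5, h4, h3, h2, h1, h0]
  have h12 : e 12 = 174518662919618560 := by
    rw [hs]; simp [Finset.sum_range_succ, h11, h10, h9, h8, h7, h6, h5, h4, h3, h2, h1, h0]
  have h13 : e 13 = 9924518425252593664 := by
    rw [hs]; simp [Finset.sum_range_succ, h12, h11, h10, h9, h8, h7, h6, h5, h4, h3, h2, h1, h0]
  have h14 : e 14 = 603226158416114221056 := by
    rw [hs]; simp [Finset.sum_range_succ, h13, h12, h11, h10, h9, h8, h7, h6, h5, h4, h3, h2, h1,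
      h0]
  have h15 : e 15 = 39034226835782971162624 := by
    rw [hs]; simp [Finset.sum_range_succ, h14, h13, h12, h11, h10, h9, h8, h7, h6, h5, h4, h3, h2,
      h1, h0]
  have h16 : e 16 = 2679639929979452203728896 := by
    rw [hs]; simp [Finset.sum_range_succ, h15, h14, h13, h12, h11, h10, h9, h8, h7, h6, h5, h4,
      h3, h2, h1, h0]
  have h17 : e 17 = 194534488622224756365590528 := by
    rw [hs]; simp [Finset.sum_range_succ, h16, h15, h14, h13, h12, h11, h10, h9, h8, h7, h6, h5,
      h4, h3, h2, h1, h0]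
  have f0 : (2 * 0)! = 1 := rfl
  have f1 : (2 * 1)! = 2 := rfl
  have f2 : (2 * 2)! = 24 := rfl
  have f3 : (2 * 3)! = 720 := rfl
  have f4 : (2 * 4)! = 40320 := rfl
  have f5 : (2 * 5)! = 3628800 := rfl
  have f6 : (2 * 6)! = 479001600 := rfl
  have f7 : (2 * 7)! = 87178291200 := rfl
  have f8 : (2 * 8)! = 20922789888000 := rfl
  have f9 : (2 * 9)! = 6402373705728000 := rfl
  have f10 : (2 * 10)! = 2432902008176640000 := rfl
  have f11 : (2 * 11)! = 1124000727777607680000 := rfl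
  have f12 : (2 * 12)! = 620448401733239439360000 := rfl
  have f13 : (2 * 13)! = 403291461126605635584000000 := rfl
  have f14 : (2 * 14)! = 304888344611713860501504000000 := rfl
  have f15 : (2 * 15)! = 265252859812191058636308480000000 := rfl
  have f16 : (2 * 16)! = 263130836933693530167218012160000000 := rfl
  have f17 : (2 * 17)! = 295232799039604140847618609643520000000 := rfl
  simp only [Finset.sum_range_succ, Finset.sum_range_zero, h0, h1, h2, h3, h4, h5, h6, h7, h8, h9,
    h10, h11, h12, h13, h14, h15, h16, h17,
    f0, f1, f2, f3, f4, f5, f6, f7, f8, f9, f10, f11, f12, f13, f14, f15, f16, f17]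
  unfold kernelPoly
  push_cast
  ring

theorem kernelPoly_eq_sum (w : ℝ) : kernelPoly w =
    ∑ n ∈ Finset.range 18, (-1) ^ n * (kernelCoeff n : ℝ) * w ^ n / (2 * n)! :=
  kernelPoly_eq_sum_of_recurrence kernelCoeff_zero kernelCoeff_succ w

theorem abs_memoryKernel_sub_kernelPoly_le {t : ℝ} (ht : t ^ 2 ≤ 64 / 25) :
    |memoryKernel t - kernelPoly (t ^ 2)| ≤ 3 * kernelBound 18 * (t ^ 2) ^ 18 := by
  have hw := sq_nonneg t
  set w := t ^ 2
  have hs := hasSum_memoryKernel t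
  rw [kernelPoly_eq_sum, ← hs.tsum_eq, ← hs.summable.sum_add_tsum_nat_add 18, add_sub_cancel_left]
  have hr : (256 / 925 : ℝ) < 1 := by norm_num
  have hgeo := (hasSum_geometric_of_lt_one (by norm_num) hr).mul_left (2 * kernelBound 18 * w ^ 18)
  refine (tsum_of_norm_bounded (E := ℝ) hgeo fun n => ?_).trans ?_
  · refine (abs_kernelCoeff_term_le (n + 18) w hw).trans ?_
    have h1 := kernelBound_add_le 18 n
    have h2 : (4 / (2 * ((18 : ℕ) : ℝ) + 1) * w) ^ n ≤ (256 / 925) ^ n := by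
      gcongr
      push_cast
      linarith
    have h3 := kernelBound_pos 18
    rw [add_comm n 18]
    calc 2 * (kernelBound (18 + n) * w ^ (18 + n))
        ≤ 2 * ((kernelBound 18 * (4 / (2 * ((18 : ℕ) : ℝ) + 1)) ^ n) * w ^ (18 + n)) := by gcongr
      _ = 2 * kernelBound 18 * w ^ 18 * (4 / (2 * ((18 : ℕ) : ℝ) + 1) * w) ^ n := by
          rw [mul_pow, pow_add]; ring
      _ ≤ _ := by gcongr
  · have h3 := kernelBound_pos 18
    have h4 : 0 ≤ kernelBound 18 * w ^ 18 := by positivity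
    norm_num
    linarith

theorem three_mul_kernelBound_le : 3 * kernelBound 18 ≤ 1 / 10 ^ 9 := by
  norm_num [kernelBound, Nat.factorial]

theorem le_kernelPoly {w : ℝ} (h0 : 0 ≤ w) (h1 : w ≤ 64 / 25) : 28 / 100 ≤ kernelPoly w := by
  obtain ⟨u, rfl⟩ : ∃ u, w = 64 / 25 * u := ⟨25 / 64 * w, by ring⟩
  have hu0 : 0 ≤ u := by linarith
  have hu1 : 0 ≤ 1 - u := by linarith
  have key : kernelPoly (64 / 25 * u) - 28 / 100 =
    43 / 25 * (u ^ 0 * (1 - u) ^ 17) +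
    19 * (u ^ 1 * (1 - u) ^ 16) +
    60184 / 625 * (u ^ 2 * (1 - u) ^ 15) +
    207592024 / 703125 * (u ^ 3 * (1 - u) ^ 14) +
    74763125644 / 123046875 * (u ^ 4 * (1 - u) ^ 13) +
    121881163346588 / 138427734375 * (u ^ 5 * (1 - u) ^ 12) +
    11686937697790904 / 12689208984375 * (u ^ 6 * (1 - u) ^ 11) +
    186816930838422184648 / 259811553955078125 * (u ^ 7 * (1 - u) ^ 10) +
    46326248042179081145782 / 97429332733154296875 * (u ^ 8 * (1 - u) ^ 9) +
    5402101739774769626709958 / 14906687908172607421875 * (u ^ 9 * (1 - u) ^ 8) +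
    309529621358373467593528663624 / 885084594547748565673828125 * (u ^ 10 * (1 - u) ^ 7) +
    1603585352966823676935101563841432 / 5111363533513247966766357421875 * (u ^ 11 * (1 - u) ^ 6) +
    378809704347718756180164632432770028 / 1763420419062070548534393310546875 * (u ^ 12 *
      (1 - u) ^ 5) +
    844678925066636776136635431902561620972 /
      7959883836044068448245525360107421875 * (u ^ 13 * (1 - u) ^ 4) +
    4146228292771475141185654818237811075425176 /
      112831353375924670253880321979522705078125 * (u ^ 14 * (1 - u) ^ 3) +
    1841653339409565299969247321383546948951979448 /
      216536641405267198060755617916584014892578125 * (u ^ 15 * (1 - u) ^ 2) +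
    3385559938093793027022390148515767503438750337297 /
      2852870250514395334450455266050994396209716796875 * (u ^ 16 * (1 - u) ^ 1) +
    97774562727934194922121080897885195732285014832663 /
      1290693718176270792440891455044038593769073486328125 * (u ^ 17 * (1 - u) ^ 0) := by
    unfold kernelPoly
    ring
  rw [← sub_nonneg, key]
  positivity

theorem kernelPoly_le {w : ℝ} (h0 : 16 / 25 ≤ w) (h1 : w ≤ 64 / 25) :
    kernelPoly w ≤ 64 / 100 := by
  obtain ⟨u, rfl⟩ : ∃ u, w = 16 / 25 + 48 / 25 * u := ⟨25 / 48 * (w - 16 / 25), by ring⟩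
  have hu0 : 0 ≤ u := by linarith
  have hu1 : 0 ≤ 1 - u := by linarith
  have key : 64 / 100 - kernelPoly (16 / 25 + 48 / 25 * u) =
    85296931578847667419243508272134231891209228537582 /
      2105868698077073398193033426650799810886383056640625 * (u ^ 0 * (1 - u) ^ 17) +
    5956548135965320420583827413377725817799381493576682 /
      2353617956674376150921625594492070376873016357421875 * (u ^ 1 * (1 - u) ^ 16) +
    71728169306610425093113178746378582527449110871078224 /
      2353617956674376150921625594492070376873016357421875 * (u ^ 2 * (1 - u) ^ 15) +
    87907095921915671368683465294663154035209047373340496 /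
      470723591334875230184325118898414075374603271484375 * (u ^ 3 * (1 - u) ^ 14) +
    49133664776875625033734503630400628901020025785921192 /
      67246227333553604312046445556916296482086181640625 * (u ^ 4 * (1 - u) ^ 13) +
    52197476887657648963136072533346880294785773645510568 /
      25863933589828309350787094444967806339263916015625 * (u ^ 5 * (1 - u) ^ 12) +
    107495501127961606259562013107755054214125797569860944 /
      25863933589828309350787094444967806339263916015625 * (u ^ 6 * (1 - u) ^ 11) +
    6381196432718825722226174920302036183207641989851728 /
      968168637052396606713955407030880451202392578125 * (u ^ 7 * (1 - u) ^ 10) +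
    1588730998812090804370021934106227721500197556971028 /
      193633727410479321342791081406176090240478515625 * (u ^ 8 * (1 - u) ^ 9) +
    2051246245916977988976901737277778935607111841551908 /
      253213335844472958679034491069614887237548828125 * (u ^ 9 * (1 - u) ^ 8) +
    350328715583322595221905716471520759590390586775536 /
      55046377357494121451964019797742366790771484375 * (u ^ 10 * (1 - u) ^ 7) +
    102555760649096416712831243362749169453884507855224656 /
      25863933589828309350787094444967806339263916015625 * (u ^ 11 * (1 - u) ^ 6) +
    50140137518091141564046045745351918867488488548601512 /
      25863933589828309350787094444967806339263916015625 * (u ^ 12 * (1 - u) ^ 5) +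
    49027663979362690232378480851758990114411356346279848 /
      67246227333553604312046445556916296482086181640625 * (u ^ 13 * (1 - u) ^ 4) +
    143882485563591699207064376915326655415397927693552 /
      705732520741941874339318019337952136993408203125 * (u ^ 14 * (1 - u) ^ 3) +
    94078456908812113930250800582664919574067537637568336 /
      2353617956674376150921625594492070376873016357421875 * (u ^ 15 * (1 - u) ^ 2) +
    502242340087398156414078537258205621599344542228966 /
      102331215507581571779201112804003059864044189453125 * (u ^ 16 * (1 - u) ^ 1) +
    366875175815523290356599842917968698024581440245462 /
      1290693718176270792440891455044038593769073486328125 * (u ^ 17 * (1 - u) ^ 0) := by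
    unfold kernelPoly
    ring
  rw [← sub_nonneg, key]
  positivity

theorem half_le_kernelPoly {w : ℝ} (h0 : 0 ≤ w) (h1 : w ≤ 16 / 25) : 51 / 100 ≤ kernelPoly w := by
  have hquartic : 51 / 100 ≤ 2 - 4 * w + 4 * w ^ 2 - 104 / 45 * w ^ 3 + 7 / 10 * w ^ 4 := by
    obtain ⟨u, rfl⟩ : ∃ u, w = 16 / 25 * u := ⟨25 / 16 * w, by ring⟩
    have hu0 : 0 ≤ u := by linarith
    have hu1 : 0 ≤ 1 - u := by linarith
    rw [← sub_nonneg]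
    have key : 2 - 4 * (16 / 25 * u) + 4 * (16 / 25 * u) ^ 2 - 104 / 45 * (16 / 25 * u) ^ 3 +
        7 / 10 * (16 / 25 * u) ^ 4 - 51 / 100 =
      149 / 100 * (u ^ 0 * (1 - u) ^ 4) +
      17 / 5 * (u ^ 1 * (1 - u) ^ 3) +
      3623 / 1250 * (u ^ 2 * (1 - u) ^ 2) +
      668641 / 703125 * (u ^ 3 * (1 - u) ^ 1) +
      5624761 / 70312500 * (u ^ 4 * (1 - u) ^ 0) := by
      ring
    rw [key]
    positivity
  have htail : kernelPoly w - (2 - 4 * w + 4 * w ^ 2 - 104 / 45 * w ^ 3 + 7 / 10 * w ^ 4) =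
    w ^ 4 * (284 / 315 - 7 / 10 - 3688 / 14175 * w) +
    w ^ 6 * (3064 / 51975 - 465488 / 42567525 * w) +
    w ^ 8 * (156196 / 91216125 - 905384 / 3907698795 * w) +
    w ^ 10 * (85330408 / 3093594879375 - 6283903312 / 2143861251406875 * w) +
    w ^ 12 * (8321698328 / 29585285269414875 - 1183094790608 / 48076088562799171875 * w) +
    w ^ 14 * (260544064432 / 131686677367667296875 - 34215018009248 /
      232504448305325524453125 * w) +
    w ^ 16 * (1247804579315452 / 122529844256906551386796875 - 45293590198788968 /
      68739242628124575327993046875 * w) := by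
    unfold kernelPoly
    ring
  have hrest : 0 ≤ w ^ 4 * (284 / 315 - 7 / 10 - 3688 / 14175 * w) +
    w ^ 6 * (3064 / 51975 - 465488 / 42567525 * w) +
    w ^ 8 * (156196 / 91216125 - 905384 / 3907698795 * w) +
    w ^ 10 * (85330408 / 3093594879375 - 6283903312 / 2143861251406875 * w) +
    w ^ 12 * (8321698328 / 29585285269414875 - 1183094790608 / 48076088562799171875 * w) +
    w ^ 14 * (260544064432 / 131686677367667296875 - 34215018009248 /
      232504448305325524453125 * w) +
    w ^ 16 * (1247804579315452 / 122529844256906551386796875 - 45293590198788968 /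
      68739242628124575327993046875 * w) := by
    have hp := fun k : ℕ => pow_nonneg h0 k
    repeat' apply add_nonneg
    all_goals exact mul_nonneg (hp _) (by linarith)
  linarith

theorem kernelPoly_le_quadratic {w : ℝ} (h0 : 0 ≤ w) (h1 : w ≤ 16 / 25) :
    kernelPoly w ≤ 2 - 4 * w + 4 * w ^ 2 - w ^ 3 := by
  have htail : 2 - 4 * w + 4 * w ^ 2 - w ^ 3 - kernelPoly w =
    w ^ 3 * (104 / 45 - 1 - 284 / 315 * w) +
    w ^ 5 * (3688 / 14175 - 3064 / 51975 * w) +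
    w ^ 7 * (465488 / 42567525 - 156196 / 91216125 * w) +
    w ^ 9 * (905384 / 3907698795 - 85330408 / 3093594879375 * w) +
    w ^ 11 * (6283903312 / 2143861251406875 - 8321698328 / 29585285269414875 * w) +
    w ^ 13 * (1183094790608 / 48076088562799171875 - 260544064432 / 131686677367667296875 * w) +
    w ^ 15 * (34215018009248 / 232504448305325524453125 - 1247804579315452 /
      122529844256906551386796875 * w) +
    w ^ 17 * (45293590198788968 / 68739242628124575327993046875) := by
    unfold kernelPoly
    ring
  have hrest : 0 ≤ w ^ 3 * (104 / 45 - 1 - 284 / 315 * w) +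
    w ^ 5 * (3688 / 14175 - 3064 / 51975 * w) +
    w ^ 7 * (465488 / 42567525 - 156196 / 91216125 * w) +
    w ^ 9 * (905384 / 3907698795 - 85330408 / 3093594879375 * w) +
    w ^ 11 * (6283903312 / 2143861251406875 - 8321698328 / 29585285269414875 * w) +
    w ^ 13 * (1183094790608 / 48076088562799171875 - 260544064432 / 131686677367667296875 * w) +
    w ^ 15 * (34215018009248 / 232504448305325524453125 - 1247804579315452 /
      122529844256906551386796875 * w) +
    w ^ 17 * (45293590198788968 / 68739242628124575327993046875) := by
    have hp := fun k : ℕ => pow_nonneg h0 k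
    repeat' apply add_nonneg
    all_goals exact mul_nonneg (hp _) (by linarith)
  linarith

theorem abs_memoryKernel_sub_kernelPoly_le_const {t : ℝ} (h0 : 0 ≤ t) (h1 : t ≤ 8 / 5) :
    |memoryKernel t - kernelPoly (t ^ 2)| ≤ 23 / 1000 := by
  have hw : t ^ 2 ≤ 64 / 25 := by nlinarith
  refine (abs_memoryKernel_sub_kernelPoly_le hw).trans ?_
  calc 3 * kernelBound 18 * (t ^ 2) ^ 18 ≤ 1 / 10 ^ 9 * (64 / 25) ^ 18 := by
        have := three_mul_kernelBound_le
        gcongr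
    _ ≤ 23 / 1000 := by norm_num

theorem quarter_le_memoryKernel {t : ℝ} (h0 : 0 ≤ t) (h1 : t ≤ 8 / 5) : 1 / 4 ≤ memoryKernel t := by
  have h := (abs_le.1 (abs_memoryKernel_sub_kernelPoly_le_const h0 h1)).1
  have hp := le_kernelPoly (sq_nonneg t) (by nlinarith)
  linarith

theorem memoryKernel_lt_two_thirds {t : ℝ} (h0 : 4 / 5 ≤ t) (h1 : t ≤ 8 / 5) :
    memoryKernel t < 2 / 3 := by
  have h := (abs_le.1 (abs_memoryKernel_sub_kernelPoly_le_const (by linarith) h1)).2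
  have hp := kernelPoly_le (w := t ^ 2) (by nlinarith) (by nlinarith)
  linarith

theorem abs_memoryKernel_sub_kernelPoly_le_cube {t : ℝ} (h0 : 0 ≤ t) (h1 : t ≤ 4 / 5) :
    |memoryKernel t - kernelPoly (t ^ 2)| ≤ 1 / 10 ^ 9 * (t ^ 2) ^ 3 := by
  have hw : t ^ 2 ≤ 16 / 25 := by nlinarith
  refine (abs_memoryKernel_sub_kernelPoly_le (by linarith)).trans ?_
  have h3 := three_mul_kernelBound_le
  have h4 : (t ^ 2) ^ 18 ≤ (t ^ 2) ^ 3 :=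
    pow_le_pow_of_le_one (sq_nonneg t) (by linarith) (by norm_num)
  gcongr

theorem half_le_memoryKernel {t : ℝ} (h0 : 0 ≤ t) (h1 : t ≤ 4 / 5) : 1 / 2 ≤ memoryKernel t := by
  have hw : t ^ 2 ≤ 16 / 25 := by nlinarith
  have h := (abs_le.1 (abs_memoryKernel_sub_kernelPoly_le_cube h0 h1)).1
  have hp := half_le_kernelPoly (sq_nonneg t) hw
  have h3 : (t ^ 2) ^ 3 ≤ 1 := pow_le_one₀ (sq_nonneg t) (by linarith)
  linarith

theorem memoryKernel_le_quartic {t : ℝ} (h0 : 0 ≤ t) (h1 : t ≤ 4 / 5) :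
    memoryKernel t ≤ 2 - 4 * t ^ 2 + 4 * t ^ 4 := by
  have hw : t ^ 2 ≤ 16 / 25 := by nlinarith
  have h := (abs_le.1 (abs_memoryKernel_sub_kernelPoly_le_cube h0 h1)).2
  have hp := kernelPoly_le_quadratic (sq_nonneg t) hw
  have h3 : 0 ≤ (t ^ 2) ^ 3 := by positivity
  have h4 : (t ^ 2) ^ 2 = t ^ 4 := by ring
  linarith

theorem memoryKernel_le_two_of_le {t : ℝ} (h0 : 0 ≤ t) (h1 : t ≤ 4 / 5) : memoryKernel t ≤ 2 := by
  have h := memoryKernel_le_quartic h0 h1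
  have hw : t ^ 2 ≤ 1 := by nlinarith
  have h4 : t ^ 4 = t ^ 2 * t ^ 2 := by ring
  have h5 := mul_nonneg (sq_nonneg t) (sub_nonneg.2 hw)
  linarith

theorem integral_eq_integral_half_add_reflect {f : ℝ → ℝ} (hf : Continuous f) (t : ℝ) :
    ∫ s in (0 : ℝ)..t, f s = ∫ s in (0 : ℝ)..t / 2, (f s + f (t - s)) := by
  rw [intervalIntegral.integral_add (hf.intervalIntegrable _ _)
    (Continuous.intervalIntegrable (by fun_prop) _ _),
    intervalIntegral.integral_comp_sub_left (fun s => f s), sub_zero,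
    show t - t / 2 = t / 2 by ring,
    intervalIntegral.integral_add_adjacent_intervals (hf.intervalIntegrable _ _)
      (hf.intervalIntegrable _ _)]

theorem hasDerivAt_memoryKernel_symm {t : ℝ} (ht : 0 ≤ t) : HasDerivAt memoryKernel
    (2 * ∫ s in (0 : ℝ)..t / 2, (memoryKernel s + memoryKernel (t - s) -
      2 * memoryKernel s * memoryKernel (t - s) - 2 * memoryKernel t)) t := by
  have hm := continuous_memoryKernel
  refine (hasDerivAt_memoryKernel ht).congr_deriv ?_
  have hconv : Continuous fun s => memoryKernel s * memoryKernel (t - s) := by fun_prop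
  rw [memoryPrimitive_eq_integral, integral_eq_integral_half_add_reflect hm,
    integral_eq_integral_half_add_reflect hconv,
    intervalIntegral.integral_sub (Continuous.intervalIntegrable (by fun_prop) _ _)
      (Continuous.intervalIntegrable (by fun_prop) _ _),
    intervalIntegral.integral_sub (Continuous.intervalIntegrable (by fun_prop) _ _)
      (Continuous.intervalIntegrable (by fun_prop) _ _), intervalIntegral.integral_const]
  have : (fun s => memoryKernel s * memoryKernel (t - s) +
      memoryKernel (t - s) * memoryKernel (t - (t - s))) =
      fun s => 2 * memoryKernel s * memoryKernel (t - s) := by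
    funext s
    rw [sub_sub_cancel]
    ring
  rw [this, smul_eq_mul]
  ring

theorem integral_pos_of_memoryKernel_eq_zero {t : ℝ} (ht : 8 / 5 ≤ t) (hz : memoryKernel t = 0)
    (hlb : ∀ s ∈ Icc 0 t, 0 ≤ memoryKernel s)
    (hub : ∀ s ∈ Icc (4 / 5) t, memoryKernel s ≤ 2 / 3) :
    0 < ∫ s in (0 : ℝ)..t / 2, (memoryKernel s + memoryKernel (t - s) -
      2 * memoryKernel s * memoryKernel (t - s) - 2 * memoryKernel t) := by
  have hm := continuous_memoryKernel
  refine intervalIntegral.integral_pos (by linarith) (Continuous.continuousOn (by fun_prop))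
    (fun s hs => ?_) ⟨0, ⟨le_rfl, by linarith⟩, by simp [hz, memoryKernel_zero]⟩
  obtain ⟨hs0, hs1⟩ := hs
  have ha := hlb s ⟨hs0.le, by linarith⟩
  have hb := hlb (t - s) ⟨by linarith, by linarith⟩
  have hb' := hub (t - s) ⟨by linarith, by linarith⟩
  have ha' : memoryKernel s ≤ 2 := by
    rcases le_total s (4 / 5) with h | h
    · exact memoryKernel_le_two_of_le hs0.le h
    · linarith [hub s ⟨h, by linarith⟩]
  rw [hz]
  nlinarith [mul_nonneg (sub_nonneg.2 ha') (sub_nonneg.2 hb'), mul_nonneg ha (sub_nonneg.2 hb'),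
    mul_nonneg (sub_nonneg.2 ha') hb, mul_nonneg ha hb]

theorem integral_even_quartic (a b c d : ℝ) :
    ∫ s in a..b, (c - d * s ^ 2 + d * s ^ 4) =
      c * (b - a) - d * (b ^ 3 - a ^ 3) / 3 + d * (b ^ 5 - a ^ 5) / 5 := by
  have h (s : ℝ) : HasDerivAt (fun s => c * s - d * s ^ 3 / 3 + d * s ^ 5 / 5)
      (c - d * s ^ 2 + d * s ^ 4) s := by
    refine HasDerivAt.congr_deriv ((((hasDerivAt_id s).const_mul c).sub
      ((((hasDerivAt_id s).pow 3).const_mul d).div_const 3)).add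
      ((((hasDerivAt_id s).pow 5).const_mul d).div_const 5)) ?_
    simp only [id]
    push_cast
    ring
  rw [intervalIntegral.integral_eq_sub_of_hasDerivAt (fun s _ => h s)
    (Continuous.intervalIntegrable (by fun_prop) _ _)]
  ring

theorem integral_neg_of_memoryKernel_eq_two_thirds {t : ℝ} (ht : 8 / 5 ≤ t)
    (hz : memoryKernel t = 2 / 3) (hlb : ∀ s ∈ Icc 0 t, 0 ≤ memoryKernel s)
    (hub : ∀ s ∈ Icc (4 / 5) t, memoryKernel s ≤ 2 / 3) :
    ∫ s in (0 : ℝ)..t / 2, (memoryKernel s + memoryKernel (t - s) -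
      2 * memoryKernel s * memoryKernel (t - s) - 2 * memoryKernel t) < 0 := by
  have hm := continuous_memoryKernel
  set g : ℝ → ℝ := fun s => memoryKernel s + memoryKernel (t - s) -
    2 * memoryKernel s * memoryKernel (t - s) - 2 * memoryKernel t with hg
  have hgc : Continuous g := by fun_prop
  have hgi := fun a b : ℝ => hgc.intervalIntegrable (μ := volume) a b
  have hnear : ∀ s, 0 ≤ s → s ≤ 4 / 5 → g s ≤ 2 / 3 - 4 * s ^ 2 + 4 * s ^ 4 := by
    intro s h0 h1
    have ha := half_le_memoryKernel h0 h1
    have ha' := memoryKernel_le_quartic h0 h1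
    have hb := hlb (t - s) ⟨by linarith, by linarith⟩
    simp only [hg, hz]
    nlinarith [mul_nonneg hb (sub_nonneg.2 ha)]
  have hfar : ∀ s, 4 / 5 ≤ s → s ≤ t / 2 → g s ≤ -(2 / 3) := by
    intro s h0 h1
    have ha := hlb s ⟨by linarith, by linarith⟩
    have ha' := hub s ⟨h0, by linarith⟩
    have hb := hlb (t - s) ⟨by linarith, by linarith⟩
    have hb' := hub (t - s) ⟨by linarith, by linarith⟩
    simp only [hg, hz]
    nlinarith [mul_nonneg (sub_nonneg.2 ha') (sub_nonneg.2 hb'), mul_nonneg ha (sub_nonneg.2 hb'),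
      mul_nonneg (sub_nonneg.2 ha') hb, mul_nonneg ha hb]
  have hI₁ : ∫ s in (0 : ℝ)..2 / 5, g s ≤ 19 / 100 := by
    refine (intervalIntegral.integral_mono_on (by norm_num) (hgi _ _)
      (Continuous.intervalIntegrable (by fun_prop) _ _)
      (fun s hs => hnear s hs.1 (by linarith [hs.2]))).trans ?_
    rw [integral_even_quartic]
    norm_num
  have hI₃ : ∫ s in (4 / 5 : ℝ)..t / 2, g s ≤ -(2 / 3) * (t / 2 - 4 / 5) := by
    refine (intervalIntegral.integral_mono_on (by linarith) (hgi _ _)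
      intervalIntegrable_const (fun s hs => hfar s hs.1 hs.2)).trans (le_of_eq ?_)
    rw [intervalIntegral.integral_const, smul_eq_mul]
    ring
  have hsplit : ∫ s in (0 : ℝ)..t / 2, g s = (∫ s in (0 : ℝ)..2 / 5, g s) +
      (∫ s in (2 / 5 : ℝ)..4 / 5, g s) + ∫ s in (4 / 5 : ℝ)..t / 2, g s := by
    rw [intervalIntegral.integral_add_adjacent_intervals (hgi _ _) (hgi _ _),
      intervalIntegral.integral_add_adjacent_intervals (hgi _ _) (hgi _ _)]
  rw [hsplit]
  rcases le_total 2 t with h2 | h2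
  · have hI₂ : ∫ s in (2 / 5 : ℝ)..4 / 5, g s ≤ -(7 / 100) := by
      refine (intervalIntegral.integral_mono_on (by norm_num) (hgi _ _)
        (Continuous.intervalIntegrable (by fun_prop) _ _)
        (fun s hs => hnear s (by linarith [hs.1]) hs.2)).trans ?_
      rw [integral_even_quartic]
      norm_num
    linarith
  · have hI₂ : ∫ s in (2 / 5 : ℝ)..4 / 5, g s ≤ -(2 / 10) := by
      refine (intervalIntegral.integral_mono_on
        (g := fun s => -(1 / 12) - 2 * s ^ 2 + 2 * s ^ 4) (by norm_num) (hgi _ _)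
        (Continuous.intervalIntegrable (by fun_prop) _ _) (fun s hs => ?_)).trans ?_
      · obtain ⟨h0, h1⟩ := hs
        have ha := half_le_memoryKernel (by linarith) h1
        have ha' := memoryKernel_le_quartic (by linarith) h1
        have hb := quarter_le_memoryKernel (t := t - s) (by linarith) (by linarith)
        simp only [hg, hz]
        nlinarith [mul_nonneg (sub_nonneg.2 hb) (sub_nonneg.2 ha)]
      · rw [integral_even_quartic]
        norm_num
    linarith

theorem HasDerivAt.nonpos_of_le_left {f : ℝ → ℝ} {d a t : ℝ} (hf : HasDerivAt f d t) (hat : a < t)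
    (h : ∀ s ∈ Ioo a t, f t ≤ f s) : d ≤ 0 := by
  have hs := (hasDerivWithinAt_iff_tendsto_slope' (by simp)).1
    (hf.hasDerivWithinAt (s := Iio t))
  refine le_of_tendsto hs ?_
  filter_upwards [Ioo_mem_nhdsLT hat] with s hs
  rw [slope_def_field]
  exact div_nonpos_of_nonneg_of_nonpos (by linarith [h s hs]) (by linarith [hs.2])

theorem memoryKernel_mem_Ioo {t : ℝ} (ht : 8 / 5 ≤ t) : memoryKernel t ∈ Ioo (0 : ℝ) (2 / 3) := by
  have hm := continuous_memoryKernel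
  by_contra hcon
  set S : Set ℝ := Ici (8 / 5) ∩ memoryKernel ⁻¹' (Ioo 0 (2 / 3))ᶜ with hS
  have hclosed : IsClosed S := isClosed_Ici.inter (isOpen_Ioo.isClosed_compl.preimage hm)
  have hbdd : BddBelow S := ⟨8 / 5, fun s hs => hs.1⟩
  have hmem : sInf S ∈ S := hclosed.csInf_mem ⟨t, ht, hcon⟩ hbdd
  set u := sInf S
  have hu : 8 / 5 < u := by
    refine lt_of_le_of_ne hmem.1 fun h => hmem.2 ?_
    rw [← h]
    exact ⟨by linarith [quarter_le_memoryKernel (t := 8 / 5) (by norm_num) le_rfl],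
      memoryKernel_lt_two_thirds (by norm_num) le_rfl⟩
  have hbefore : ∀ s ∈ Ico (8 / 5) u, memoryKernel s ∈ Ioo (0 : ℝ) (2 / 3) := by
    intro s hs
    by_contra h
    exact (not_le.2 hs.2) (csInf_le hbdd ⟨hs.1, h⟩)
  have hIcc : memoryKernel u ∈ Icc (0 : ℝ) (2 / 3) := by
    rw [← closure_Ioo (by norm_num : (0 : ℝ) ≠ 2 / 3)]
    have hnb : (nhdsWithin u (Iio u)).NeBot := inferInstance
    refine mem_closure_of_tendsto (hm.continuousAt.tendsto.mono_left nhdsWithin_le_nhds)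
      (b := nhdsWithin u (Iio u)) ?_
    filter_upwards [Ico_mem_nhdsLT hu] with s hs using hbefore s hs
  have hlb : ∀ s ∈ Icc 0 u, 0 ≤ memoryKernel s := by
    intro s hs
    rcases le_total s (8 / 5) with h | h
    · linarith [quarter_le_memoryKernel hs.1 h]
    · rcases hs.2.eq_or_lt with rfl | h'
      · exact hIcc.1
      · exact (hbefore s ⟨h, h'⟩).1.le
  have hub : ∀ s ∈ Icc (4 / 5) u, memoryKernel s ≤ 2 / 3 := by
    intro s hs
    rcases le_total s (8 / 5) with h | h
    · exact (memoryKernel_lt_two_thirds hs.1 h).le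
    · rcases hs.2.eq_or_lt with rfl | h'
      · exact hIcc.2
      · exact (hbefore s ⟨h, h'⟩).2.le
  have hd := hasDerivAt_memoryKernel_symm (t := u) (by linarith)
  rcases hIcc.1.eq_or_lt with h0 | h0
  · have hpos := integral_pos_of_memoryKernel_eq_zero hu.le h0.symm hlb hub
    have := HasDerivAt.nonpos_of_le_left hd hu fun s hs => by
      rw [← h0]; exact (hbefore s ⟨hs.1.le, hs.2⟩).1.le
    linarith
  · rcases hIcc.2.eq_or_lt with h1 | h1
    · have hneg := integral_neg_of_memoryKernel_eq_two_thirds hu.le h1 hlb hub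
      have := HasDerivAt.nonpos_of_le_left hd.neg hu fun s hs => by
        simp only [Pi.neg_apply]
        rw [h1]
        linarith [(hbefore s ⟨hs.1.le, hs.2⟩).2]
      linarith
    · exact hmem.2 ⟨h0, h1⟩

theorem memoryKernel_nonneg {t : ℝ} (ht : 0 ≤ t) : 0 ≤ memoryKernel t := by
  rcases le_total t (8 / 5) with h | h
  · linarith [quarter_le_memoryKernel ht h]
  · exact (memoryKernel_mem_Ioo h).1.le

theorem memoryKernel_le_two {t : ℝ} (ht : 0 ≤ t) : memoryKernel t ≤ 2 := by
  rcases le_total t (8 / 5) with h | h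
  · rcases le_total t (4 / 5) with h' | h'
    · exact memoryKernel_le_two_of_le ht h'
    · linarith [memoryKernel_lt_two_thirds h' h]
  · linarith [(memoryKernel_mem_Ioo h).2]

theorem integrableOn_pow_mul_exp_neg_mul {X : ℝ} (hX : 0 < X) (k : ℕ) :
    IntegrableOn (fun t => t ^ k * exp (-X * t)) (Ioi 0) := by
  have h := integrableOn_rpow_mul_exp_neg_mul_rpow (p := 1) (s := k)
    (by linarith [k.cast_nonneg (α := ℝ)]) one_pos hX
  simpa only [rpow_natCast, rpow_one] using h

theorem integrableOn_pow_mul_exp_mul_memoryKernel {X : ℝ} (hX : 0 < X) (k : ℕ) :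
    IntegrableOn (fun t => t ^ k * (exp (-X * t) * memoryKernel t)) (Ioi 0) := by
  refine ((integrableOn_pow_mul_exp_neg_mul hX k).const_mul 2).mono' ?_ ?_
  · have := continuous_memoryKernel
    exact Continuous.aestronglyMeasurable (by fun_prop)
  · refine (ae_restrict_iff' measurableSet_Ioi).2 (.of_forall fun t ht => ?_)
    have ht : 0 < t := ht
    have h0 := memoryKernel_nonneg ht.le
    rw [norm_of_nonneg (by positivity)]
    calc t ^ k * (exp (-X * t) * memoryKernel t) = t ^ k * exp (-X * t) * memoryKernel t := by ring
      _ ≤ t ^ k * exp (-X * t) * 2 := by gcongr; exact memoryKernel_le_two ht.le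
      _ = 2 * (t ^ k * exp (-X * t)) := by ring

/-- The moments `∫ tᵏ e^{-Xt} m(t) dt` of the memory kernel `m`. -/
noncomputable def laplaceMoment (k : ℕ) (X : ℝ) : ℝ :=
  ∫ t in Ioi 0, t ^ k * (exp (-X * t) * memoryKernel t)

theorem laplaceMoment_nonneg (k : ℕ) (X : ℝ) : 0 ≤ laplaceMoment k X :=
  setIntegral_nonneg measurableSet_Ioi fun t (ht : 0 < t) =>
    mul_nonneg (pow_nonneg ht.le k) (mul_nonneg (exp_pos _).le (memoryKernel_nonneg ht.le))

theorem hasDerivAt_laplaceMoment (k : ℕ) {X : ℝ} (hX : 0 < X) :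
    HasDerivAt (laplaceMoment k) (-laplaceMoment (k + 1) X) X := by
  have hm := continuous_memoryKernel
  have h := (hasDerivAt_integral_of_dominated_loc_of_deriv_le
    (μ := volume.restrict (Ioi 0)) (s := Ioi (X / 2)) (x₀ := X)
    (F := fun Y t => t ^ k * (exp (-Y * t) * memoryKernel t))
    (F' := fun Y t => -(t ^ (k + 1) * (exp (-Y * t) * memoryKernel t)))
    (bound := fun t => t ^ (k + 1) * (exp (-(X / 2) * t) * memoryKernel t))
    (Ioi_mem_nhds (by linarith))
    (.of_forall fun Y => Continuous.aestronglyMeasurable (by fun_prop))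
    (integrableOn_pow_mul_exp_mul_memoryKernel hX k)
    (Continuous.aestronglyMeasurable (by fun_prop))
    ((ae_restrict_iff' measurableSet_Ioi).2 (.of_forall fun t ht Y hY => ?_))
    (integrableOn_pow_mul_exp_mul_memoryKernel (half_pos hX) (k + 1))
    (.of_forall fun t Y _ => ?_)).2
  · rwa [integral_neg] at h
  · have ht : 0 < t := ht
    have hY : X / 2 < Y := hY
    have h0 := memoryKernel_nonneg ht.le
    rw [norm_neg, norm_of_nonneg (by positivity)]
    gcongr
  · refine ((((hasDerivAt_neg Y).mul_const t).exp.mul_const (memoryKernel t)).const_mul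
      (t ^ k)).congr_deriv ?_
    ring

/-- The Laplace transform of a derivative. -/
theorem integral_exp_mul_deriv {u u' : ℝ → ℝ} {X : ℝ}
    (hd : ∀ t, 0 ≤ t → HasDerivAt u (u' t) t)
    (hu : IntegrableOn (fun t => exp (-X * t) * u t) (Ioi 0))
    (hu' : IntegrableOn (fun t => exp (-X * t) * u' t) (Ioi 0)) :
    ∫ t in Ioi 0, exp (-X * t) * u' t = X * (∫ t in Ioi 0, exp (-X * t) * u t) - u 0 := by
  have hD : ∀ t ∈ Ici (0 : ℝ), HasDerivAt (fun t => exp (-X * t) * u t)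
      (exp (-X * t) * u' t - X * (exp (-X * t) * u t)) t := fun t ht => by
    refine (((hasDerivAt_id t).const_mul (-X)).exp.mul (hd t ht)).congr_deriv ?_
    simp only [id]
    ring
  have hi := hu'.sub (hu.const_mul X)
  have h := integral_Ioi_of_hasDerivAt_of_tendsto' hD hi
    (tendsto_zero_of_hasDerivAt_of_integrableOn_Ioi (fun t ht => hD t (mem_Ioi.1 ht).le) hi hu)
  rw [integral_sub hu' (hu.const_mul X), integral_const_mul] at h
  simp only [mul_zero, exp_zero, one_mul] at h
  linarith

theorem laplaceMoment_riccati {X : ℝ} (hX : 0 < X) :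
    X * laplaceMoment 0 X - 2 =
      2 * (laplaceMoment 0 X / X - laplaceMoment 1 X - laplaceMoment 0 X ^ 2) := by
  have hm := continuous_memoryKernel
  have hN := continuous_memoryPrimitive
  have hi₀ : IntegrableOn (fun t => exp (-X * t) * memoryKernel t) (Ioi 0) := by
    simpa using integrableOn_pow_mul_exp_mul_memoryKernel hX 0
  have hi₁ : IntegrableOn (fun t => t * (exp (-X * t) * memoryKernel t)) (Ioi 0) := by
    simpa using integrableOn_pow_mul_exp_mul_memoryKernel hX 1
  have hiN : IntegrableOn (fun t => exp (-X * t) * memoryPrimitive t) (Ioi 0) := by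
    refine ((integrableOn_pow_mul_exp_neg_mul hX 1).const_mul 2).mono'
      (Continuous.aestronglyMeasurable (by fun_prop))
      ((ae_restrict_iff' measurableSet_Ioi).2 (.of_forall fun t ht => ?_))
    have ht : 0 < t := ht
    have hle : |memoryPrimitive t| ≤ 2 * t := by
      rw [memoryPrimitive_eq_integral, ← norm_eq_abs]
      have := intervalIntegral.norm_integral_le_of_norm_le_const (a := 0) (b := t) (C := 2)
        (f := memoryKernel) fun s hs => by
          rw [uIoc_of_le ht.le] at hs
          rw [norm_of_nonneg (memoryKernel_nonneg hs.1.le)]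
          exact memoryKernel_le_two hs.1.le
      simpa [abs_of_pos ht] using this
    rw [norm_mul, norm_of_nonneg (exp_pos _).le, norm_eq_abs]
    calc exp (-X * t) * |memoryPrimitive t| ≤ exp (-X * t) * (2 * t) := by gcongr
      _ = 2 * (t ^ 1 * exp (-X * t)) := by ring
  have hconv (t : ℝ) : ∫ s in 0..t, ContinuousLinearMap.mul ℝ ℝ
      (exp (-X * s) * memoryKernel s) (exp (-X * (t - s)) * memoryKernel (t - s)) =
      exp (-X * t) * ∫ s in 0..t, memoryKernel s * memoryKernel (t - s) := by
    rw [← intervalIntegral.integral_const_mul]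
    refine intervalIntegral.integral_congr fun s _ => ?_
    have he : exp (-X * t) = exp (-X * s) * exp (-X * (t - s)) := by
      rw [← exp_add]
      ring_nf
    simp only [ContinuousLinearMap.mul_apply', he]
    ring
  have hic : IntegrableOn (fun t => exp (-X * t) *
      ∫ s in 0..t, memoryKernel s * memoryKernel (t - s)) (Ioi 0) := by
    have := (integrable_posConvolution hi₀ hi₀ (ContinuousLinearMap.mul ℝ ℝ)).integrableOn
      (s := Ioi (0 : ℝ))
    refine this.congr_fun (fun t ht => ?_) measurableSet_Ioi
    simp only [posConvolution, indicator_of_mem ht, hconv]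
  have hsq : ∫ t in Ioi 0, exp (-X * t) * ∫ s in 0..t, memoryKernel s * memoryKernel (t - s) =
      laplaceMoment 0 X ^ 2 := by
    have := integral_posConvolution hi₀ hi₀ (ContinuousLinearMap.mul ℝ ℝ)
    simp only [hconv] at this
    rw [this, ContinuousLinearMap.mul_apply', laplaceMoment]
    simp only [pow_zero, one_mul, sq]
  have hLm := integral_exp_mul_deriv (fun t _ => hasDerivAt_memoryPrimitive t) hiN hi₀
  have hiN₁ : IntegrableOn (fun t => exp (-X * t) * memoryPrimitive t -
      t * (exp (-X * t) * memoryKernel t)) (Ioi 0) := hiN.sub hi₁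
  have hcongr : (fun t => exp (-X * t) * (2 * (memoryPrimitive t - t * memoryKernel t -
      ∫ s in 0..t, memoryKernel s * memoryKernel (t - s)))) =
      fun t => 2 * (exp (-X * t) * memoryPrimitive t - t * (exp (-X * t) * memoryKernel t) -
        exp (-X * t) * ∫ s in 0..t, memoryKernel s * memoryKernel (t - s)) := by
    ext t
    ring
  have hLd := integral_exp_mul_deriv (fun t ht => hasDerivAt_memoryKernel ht) hi₀
    (hcongr ▸ (hiN₁.sub hic).const_mul 2)
  have h0 : ∫ t in Ioi 0, exp (-X * t) * memoryKernel t = laplaceMoment 0 X := by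
    simp only [laplaceMoment, pow_zero, one_mul]
  have h1 : ∫ t in Ioi 0, t * (exp (-X * t) * memoryKernel t) = laplaceMoment 1 X := by
    simp only [laplaceMoment, pow_one]
  rw [hcongr, integral_const_mul, integral_sub hiN₁ hic, integral_sub hiN hi₁, hsq, h0, h1,
    memoryKernel_zero] at hLd
  rw [h0, memoryPrimitive_zero, sub_zero] at hLm
  rw [← hLd, eq_div_of_mul_eq hX.ne' ((mul_comm _ _).trans hLm.symm)]

/-- The exponential integral `E₁(z) = ∫_z^∞ e^{-v} / v dv`. -/
noncomputable def expIntegral (z : ℝ) : ℝ := ∫ v in Ioi z, exp (-v) / v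

theorem integrableOn_exp_neg_div {z : ℝ} (hz : 0 < z) :
    IntegrableOn (fun v => exp (-v) / v) (Ioi z) := by
  refine ((integrableOn_exp_neg_Ioi z).const_mul z⁻¹).mono'
    (Measurable.aestronglyMeasurable (by fun_prop))
    ((ae_restrict_iff' measurableSet_Ioi).2 (.of_forall fun v hv => ?_))
  have hv : z < v := hv
  have hv0 : 0 < v := hz.trans hv
  rw [norm_of_nonneg (by positivity), div_eq_inv_mul]
  gcongr

theorem hasDerivAt_expIntegral {z : ℝ} (hz : 0 < z) :
    HasDerivAt expIntegral (-(exp (-z) / z)) z := by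
  have hc (v : ℝ) (hv : 0 < v) : ContinuousAt (fun v => exp (-v) / v) v :=
    ContinuousAt.div (by fun_prop) continuousAt_id hv.ne'
  have hi : IntervalIntegrable (fun v => exp (-v) / v) volume (z / 2) z :=
    ContinuousOn.intervalIntegrable fun v hv => by
      rw [uIcc_of_le (by linarith)] at hv
      exact (hc v (by linarith [hv.1])).continuousWithinAt
  have h := (intervalIntegral.integral_hasDerivAt_right hi
    (Measurable.stronglyMeasurable (by fun_prop)).stronglyMeasurableAtFilter
    (hc z hz)).const_sub (expIntegral (z / 2))
  refine h.congr_of_eventuallyEq ?_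
  filter_upwards [Ioi_mem_nhds (show z / 2 < z by linarith)] with w hw
  have hw : z / 2 < w := hw
  rw [← intervalIntegral.integral_Ioi_sub_Ioi (integrableOn_exp_neg_div (by linarith)) hw.le,
    expIntegral, expIntegral]
  ring

theorem abs_expIntegral_le {z : ℝ} (hz : 1 ≤ z) : |expIntegral z| ≤ exp (-z) := by
  rw [expIntegral, ← integral_exp_neg_Ioi z, ← norm_eq_abs]
  refine norm_integral_le_of_norm_le (integrableOn_exp_neg_Ioi z)
    ((ae_restrict_iff' measurableSet_Ioi).2 (.of_forall fun v hv => ?_))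
  have hv : z < v := hv
  have hv0 : 0 < v := by linarith
  rw [norm_of_nonneg (by positivity)]
  exact div_le_self (exp_pos _).le (by linarith)

theorem integral_exp_div_sq_mul {z : ℝ} (hz : 0 < z) :
    ∫ l in Ioi (0 : ℝ), l⁻¹ * (1 + l ^ 2)⁻¹ * exp (-z / l ^ 2) = exp z * expIntegral z / 2 := by
  set f : ℝ → ℝ := fun l => z * (1 + (l ^ 2)⁻¹) with hf
  have himage : f '' Ioi 0 = Ioi z := by
    ext v
    simp only [mem_image, mem_Ioi, hf]
    constructor
    · rintro ⟨l, hl, rfl⟩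
      have : 0 < z * (l ^ 2)⁻¹ := by positivity
      linarith
    · intro hv
      have hvz : 0 < v / z - 1 := by rwa [sub_pos, one_lt_div hz]
      refine ⟨√(v / z - 1)⁻¹, by positivity, ?_⟩
      rw [sq_sqrt (by positivity), inv_inv]
      field_simp
      ring
  have hd (l : ℝ) (hl : l ∈ Ioi (0 : ℝ)) :
      HasDerivWithinAt f (-(2 * z / l ^ 3)) (Ioi 0) l := by
    have hl : 0 < l := hl
    refine (((((hasDerivAt_id l).pow 2).inv (by simpa using hl.ne')).const_add 1).const_mul
      z).hasDerivWithinAt.congr_deriv ?_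
    simp only [id]
    field_simp
    norm_num
    ring
  have hinj : InjOn f (Ioi 0) := by
    intro a ha b hb hab
    have ha : 0 < a := ha
    have hb : 0 < b := hb
    simp only [hf] at hab
    have h := mul_left_cancel₀ hz.ne' hab
    exact (pow_left_inj₀ ha.le hb.le two_ne_zero).1 (inv_injective (add_left_cancel h))
  have h := integral_image_eq_integral_abs_deriv_smul measurableSet_Ioi hd hinj
    (fun v => exp (-v) / v)
  rw [himage] at h
  rw [expIntegral, h, ← integral_const_mul, ← integral_div]
  refine setIntegral_congr_fun measurableSet_Ioi fun l hl => ?_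
  have hl : 0 < l := hl
  have he : exp (-f l) = exp (-z) * exp (-z / l ^ 2) := by
    rw [← exp_add]
    congr 1
    simp only [hf]
    field_simp
    ring
  simp only [smul_eq_mul, he]
  rw [abs_neg, abs_of_pos (by positivity), exp_neg z]
  simp only [hf]
  field_simp
  ring

theorem hasDerivAt_riccati_potential {X : ℝ} (hX : 0 < X) :
    HasDerivAt (fun X => (X * (2 * laplaceMoment 0 X + X))⁻¹)
      (-laplaceMoment 0 X * (X * (2 * laplaceMoment 0 X + X))⁻¹) X := by
  have hM := laplaceMoment_nonneg 0 X
  have hpos : 0 < X * (2 * laplaceMoment 0 X + X) := by positivity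
  refine (((hasDerivAt_id X).mul (((hasDerivAt_laplaceMoment 0 hX).const_mul 2).add
    (hasDerivAt_id X))).inv hpos.ne').congr_deriv ?_
  have h := laplaceMoment_riccati hX
  field_simp at h
  simp only [id, Pi.mul_apply, Pi.add_apply, zero_add]
  rw [div_eq_iff (by positivity)]
  field_simp
  linear_combination h

theorem expIntegral_eq {X : ℝ} (hX : 0 < X) :
    expIntegral (X ^ 2 / 4) =
      4 * exp (-(X ^ 2 / 4)) * (X * (2 * laplaceMoment 0 X + X))⁻¹ := by
  set D : ℝ → ℝ := fun X => expIntegral (X ^ 2 / 4) -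
      4 * exp (-(X ^ 2 / 4)) * (X * (2 * laplaceMoment 0 X + X))⁻¹ with hD
  have hd (Y : ℝ) (hY : 0 < Y) : HasDerivAt D 0 Y := by
    have hM := laplaceMoment_nonneg 0 Y
    have hs : HasDerivAt (fun Y : ℝ => Y ^ 2 / 4) (Y / 2) Y := by
      refine (((hasDerivAt_id Y).pow 2).div_const 4).congr_deriv ?_
      simp only [id]
      push_cast
      ring
    refine (((hasDerivAt_expIntegral (z := Y ^ 2 / 4) (by positivity)).comp Y hs).sub
      ((hs.neg.exp.const_mul 4).mul (hasDerivAt_riccati_potential hY))).congr_deriv ?_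
    simp only [Pi.neg_apply]
    field_simp
    ring
  have hconst (Y : ℝ) (hY : 0 < Y) : D X = D Y :=
    isOpen_Ioi.is_const_of_deriv_eq_zero isPreconnected_Ioi
      (fun Z hZ => (hd Z hZ).differentiableAt.differentiableWithinAt)
      (fun Z hZ => (hd Z hZ).deriv) hX hY
  have hle (Y : ℝ) (hY : 4 ≤ Y) : |D X| ≤ 5 * exp (-Y) := by
    have hM := laplaceMoment_nonneg 0 Y
    have hz : Y ≤ Y ^ 2 / 4 := by nlinarith
    have hexp : exp (-(Y ^ 2 / 4)) ≤ exp (-Y) := exp_le_exp.2 (neg_le_neg hz)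
    have hE := abs_expIntegral_le (z := Y ^ 2 / 4) (by linarith)
    have hq : (Y * (2 * laplaceMoment 0 Y + Y))⁻¹ ≤ 1 := inv_le_one_of_one_le₀ (by nlinarith)
    have hq0 : 0 ≤ (Y * (2 * laplaceMoment 0 Y + Y))⁻¹ := by positivity
    rw [hconst Y (by linarith)]
    refine (abs_sub _ _).trans ?_
    rw [abs_of_nonneg (by positivity : 0 ≤ 4 * exp (-(Y ^ 2 / 4)) * _)]
    nlinarith [exp_pos (-(Y ^ 2 / 4))]
  have hlim : Filter.Tendsto (fun Y => 5 * exp (-Y)) Filter.atTop (nhds 0) := by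
    simpa using (tendsto_exp_neg_atTop_nhds_zero.const_mul 5)
  have := ge_of_tendsto hlim ((Filter.eventually_ge_atTop 4).mono hle)
  exact sub_eq_zero.1 (abs_nonpos_iff.1 this)

theorem pHS_eq_expIntegral {τ x : ℝ} (hτ : 0 < τ) (hx : 0 < x) :
    pHS τ x = (√(2 * π))⁻¹ * τ⁻¹ * π⁻¹ *
      (exp ((√2 / τ * x) ^ 2 / 4) * expIntegral ((√2 / τ * x) ^ 2 / 4)) := by
  have hz : (√2 / τ * x) ^ 2 / 4 = x ^ 2 / (2 * τ ^ 2) := by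
    rw [mul_pow, div_pow, sq_sqrt zero_le_two]
    field_simp
    norm_num
  have h := integral_exp_div_sq_mul (z := x ^ 2 / (2 * τ ^ 2)) (by positivity)
  have hterm : pHS τ x = ∫ l in Ioi (0 : ℝ), (√(2 * π))⁻¹ * τ⁻¹ * (2 / π) *
      (l⁻¹ * (1 + l ^ 2)⁻¹ * exp (-(x ^ 2 / (2 * τ ^ 2)) / l ^ 2)) := by
    refine setIntegral_congr_fun measurableSet_Ioi fun l hl => ?_
    have hl : 0 < l := hl
    have he : -x ^ 2 / (2 * l ^ 2 * τ ^ 2) = -(x ^ 2 / (2 * τ ^ 2)) / l ^ 2 := by field_simp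
    simp only [he, mul_inv]
    ring
  rw [hterm, integral_const_mul, h, hz]
  ring

theorem pHS_eq {τ x : ℝ} (hτ : 0 < τ) (hx : 0 < x) :
    pHS τ x = (√(2 * π))⁻¹ * τ⁻¹ * π⁻¹ * 4 *
      (√2 / τ * x * (2 * laplaceMoment 0 (√2 / τ * x) + √2 / τ * x))⁻¹ := by
  have he : exp ((√2 / τ * x) ^ 2 / 4) * exp (-((√2 / τ * x) ^ 2 / 4)) = 1 := by
    rw [← exp_add, add_neg_cancel, exp_zero]
  rw [pHS_eq_expIntegral hτ hx, expIntegral_eq (by positivity)]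
  linear_combination (√(2 * π))⁻¹ * τ⁻¹ * π⁻¹ * 4 *
    (√2 / τ * x * (2 * laplaceMoment 0 (√2 / τ * x) + √2 / τ * x))⁻¹ * he

theorem neg_deriv_pHS_div {τ x : ℝ} (hτ : 0 < τ) (hx : 0 < x) :
    -deriv (pHS τ) x / pHS τ x = √2 / τ * laplaceMoment 0 (√2 / τ * x) := by
  have hM := laplaceMoment_nonneg 0 (√2 / τ * x)
  have hX : 0 < √2 / τ * x := by positivity
  have hd := (HasDerivAt.comp x (hasDerivAt_riccati_potential hX)
    ((hasDerivAt_id' x).const_mul (√2 / τ))).const_mul ((√(2 * π))⁻¹ * τ⁻¹ * π⁻¹ * 4)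
  simp only [Function.comp_def] at hd
  have heq : pHS τ =ᶠ[nhds x] fun y => (√(2 * π))⁻¹ * τ⁻¹ * π⁻¹ * 4 *
      (√2 / τ * y * (2 * laplaceMoment 0 (√2 / τ * y) + √2 / τ * y))⁻¹ :=
    Filter.eventuallyEq_of_mem (Ioi_mem_nhds hx) fun y hy => pHS_eq hτ hy
  rw [heq.deriv_eq, hd.deriv, pHS_eq hτ hx]
  have : 0 < 2 * laplaceMoment 0 (√2 / τ * x) + √2 / τ * x := by positivity
  have hpi := pi_pos
  generalize laplaceMoment 0 (√2 / τ * x) = M at *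
  field_simp

theorem iteratedDeriv_neg_deriv_pHS_div {τ : ℝ} (hτ : 0 < τ) (k : ℕ) {x : ℝ} (hx : 0 < x) :
    iteratedDeriv k (fun y => -(deriv (pHS τ) y) / pHS τ y) x =
      (√2 / τ) ^ (k + 1) * ((-1) ^ k * laplaceMoment k (√2 / τ * x)) := by
  induction k generalizing x with
  | zero => simp [neg_deriv_pHS_div hτ hx]
  | succ k ih =>
    have heq : iteratedDeriv k (fun y => -(deriv (pHS τ) y) / pHS τ y) =ᶠ[nhds x]
        fun y => (√2 / τ) ^ (k + 1) * ((-1) ^ k * laplaceMoment k (√2 / τ * y)) :=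
      Filter.eventuallyEq_of_mem (Ioi_mem_nhds hx) fun y hy => ih hy
    have hd := ((HasDerivAt.comp x
      (hasDerivAt_laplaceMoment k (by positivity : 0 < √2 / τ * x))
      ((hasDerivAt_id' x).const_mul (√2 / τ))).const_mul ((-1) ^ k)).const_mul
      ((√2 / τ) ^ (k + 1))
    simp only [Function.comp_apply] at hd
    rw [iteratedDeriv_succ, heq.deriv_eq, hd.deriv]
    ring

end Horseshoe

/-- The derivative of the horseshoe penalty, `pen'_HS = -p'_HS/p_HS`, is completely
monotone on `(0,∞)`; consequently `pen_HS` is a Bernstein function there. -/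
theorem horseshoe_penalty_deriv_completely_monotone (τ : ℝ) (hτ : 0 < τ) (k : ℕ)
    (x : ℝ) (hx : 0 < x) :
    0 ≤ (-1) ^ k * iteratedDeriv k (fun y => -(deriv (pHS τ) y) / pHS τ y) x := by
  rw [Horseshoe.iteratedDeriv_neg_deriv_pHS_div hτ k hx, mul_left_comm, ← mul_assoc ((-1) ^ k),
    ← mul_pow, neg_one_mul, neg_neg, one_pow, one_mul]
  exact mul_nonneg (by positivity) (Horseshoe.laplaceMoment_nonneg k _)
end
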